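/- Assume q is odd. Let t₂(7) denote the number of orbits of the natural action of PGL₃(𝔽_q) on the set of k-rational 7-sets of ℙ²(k̄). Then t₂(7) = q⁶ + q⁵ + 3q⁴ + 6q³ + 11q² + 4q + 2(q² + 6q + 9)·[3 ∣ q−1] + 4·[5 ∣ q+1] + 20·[5 ∣ q−1] + (4q + 6)·[4 ∣ q−1] + 8·[7 ∣ q−1] + 6·[7 ∣ q+1] + 4·[12 ∣ q−1] + 2·[7 ∣ q²+q+1] + (q² + 4q − 1)·[3 ∣ q] + 2·[3 ∣ q and 4 ∣ q−1] + 3·[5 ∣ q] + 2·[7 ∣ q], where [C] equals 1 if the condition C holds and 0 otherwise. -/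

import Mathlib

/-- The `q`-power Frobenius acting on `ℙ^{m-1}(k̄)` (raising homogeneous
coordinates to the `q`-th power), where `q = |k|`. -/
noncomputable def projFrob (k : Type*) [Field k] [Fintype k] (m : ℕ) :
    Projectivization (AlgebraicClosure k) (Fin m → AlgebraicClosure k) →
    Projectivization (AlgebraicClosure k) (Fin m → AlgebraicClosure k) :=
  fun P => Projectivization.mk (AlgebraicClosure k)
    (fun i => (P.rep i) ^ (Fintype.card k)) (by
      intro h
      apply P.rep_nonzero
      funext i
      have hi : P.rep i ^ (Fintype.card k) = 0 := by simpa using congrFun h i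
      simpa using pow_eq_zero_iff (Fintype.card_ne_zero (α := k)) |>.mp hi)

/-- The projective automorphism of `ℙ^{m-1}(k̄)` induced by
`g ∈ GL_m(𝔽_q)`; the induced action of `PGL_m(𝔽_q)`. -/
noncomputable def projGamma (k : Type*) [Field k] [Fintype k] (m : ℕ)
    (g : Matrix.GeneralLinearGroup (Fin m) k) :
    Projectivization (AlgebraicClosure k) (Fin m → AlgebraicClosure k) →
    Projectivization (AlgebraicClosure k) (Fin m → AlgebraicClosure k) :=
  fun P => Projectivization.mk (AlgebraicClosure k)
    (((g : Matrix (Fin m) (Fin m) k).map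
        (algebraMap k (AlgebraicClosure k))).mulVec P.rep) (by
      intro h
      apply P.rep_nonzero
      set f := algebraMap k (AlgebraicClosure k)
      have hBA : ((g⁻¹ : Matrix.GeneralLinearGroup (Fin m) k) : Matrix (Fin m) (Fin m) k).map f *
          ((g : Matrix (Fin m) (Fin m) k)).map f = 1 := by
        rw [← Matrix.map_mul]
        norm_cast
        rw [inv_mul_cancel g]
        exact Matrix.map_one f f.map_zero f.map_one
      calc P.rep = (1 : Matrix (Fin m) (Fin m) (AlgebraicClosure k)).mulVec P.rep := by
            rw [Matrix.one_mulVec]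
        _ = _ := by rw [← hBA, ← Matrix.mulVec_mulVec, h, Matrix.mulVec_zero])

/-- The number of orbits of the induced `PGL₃(𝔽_q)`-action on the set of
`k`-rational `7`-sets of `ℙ²(k̄)` (`7`-element subsets `S` with
`σ(S) = S`): the number of distinct orbits
`{g·S : g ∈ PGL₃(𝔽_q)}` of such `7`-sets. -/
noncomputable def t2seven (k : Type*) [Field k] [Fintype k] : ℕ :=
  Set.ncard {O : Set (Set (Projectivization (AlgebraicClosure k)
      (Fin 3 → AlgebraicClosure k))) |
    ∃ S : Set (Projectivization (AlgebraicClosure k) (Fin 3 → AlgebraicClosure k)),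
      (S.Finite ∧ S.ncard = 7 ∧ projFrob k 3 '' S = S) ∧
      O = {T | ∃ g : Matrix.GeneralLinearGroup (Fin 3) k, T = projGamma k 3 g '' S}}

namespace T7
open Finset

/-- lattice data of a point under two commuting permutations -/
theorem lattice_data {Ω : Type*} [Finite Ω] (g s : Equiv.Perm Ω) (hc : Commute g s) (x : Ω) :
    ∃ a b : ℕ, ∃ c : ℤ, 0 < a ∧ 0 < b ∧ (∀ i : ℤ, (g ^ i) x = x ↔ (a : ℤ) ∣ i) ∧
      (∀ n j : ℤ, (s ^ n) x = (g ^ j) x ↔ (b : ℤ) ∣ n ∧ (a : ℤ) ∣ j - c * (n / b)) := by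
  classical
  have hcz : ∀ i j : ℤ, ∀ y, (g ^ i) ((s ^ j) y) = (s ^ j) ((g ^ i) y) := by
    intro i j y
    have := (hc.zpow_zpow i j)
    rw [← Equiv.Perm.mul_apply, this.eq, Equiv.Perm.mul_apply]
  have ha : 0 < MulAction.period g x := by
    apply MulAction.period_pos_of_orderOf_pos
    exact orderOf_pos g
  have hper : ∀ i : ℤ, (g ^ i) x = x ↔ ((MulAction.period g x : ℕ) : ℤ) ∣ i := by
    intro i
    exact MulAction.zpow_smul_eq_iff_period_dvd (g := g) (a := x) (j := i)
  have hex : ∃ n : ℕ, 0 < n ∧ ∃ j : ℤ, (s ^ (n : ℤ)) x = (g ^ j) x := by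
    refine ⟨orderOf s, orderOf_pos s, 0, ?_⟩
    simp [pow_orderOf_eq_one]
  obtain ⟨hbpos, c, hbc⟩ := Nat.find_spec hex
  set b := Nat.find hex with hb
  have hadd : ∀ (h : Equiv.Perm Ω) (i j : ℤ) y, (h ^ (i + j)) y = (h ^ i) ((h ^ j) y) := by
    intro h i j y; rw [zpow_add, Equiv.Perm.mul_apply]
  have hgeq : ∀ i j : ℤ, (g ^ i) x = (g ^ j) x ↔ ((MulAction.period g x : ℕ) : ℤ) ∣ i - j := by
    intro i j
    rw [← hper, show i - j = -j + i by ring, hadd]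
    constructor
    · intro h; rw [h, ← hadd]; simp
    · intro h
      have : (g ^ j) ((g ^ (-j)) ((g ^ i) x)) = (g ^ j) x := by rw [h]
      rw [← hadd] at this
      simpa using this
  have hbt : ∀ t : ℤ, (s ^ ((b : ℤ) * t)) x = (g ^ (c * t)) x := by
    intro t
    induction t using Int.induction_on with
    | zero => simp
    | succ i ih =>
      rw [mul_add, mul_one, hadd, hbc, ← hcz, ih, ← hadd]
      congr 2; ring
    | pred i ih =>
      have h1 : (s ^ (-(b : ℤ))) x = (g ^ (-c)) x := by
        have h2 : (s ^ (-(b : ℤ))) ((s ^ (b : ℤ)) x) = x := by rw [← hadd]; simp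
        rw [hbc, ← hcz] at h2
        have h3 : (g ^ (-c)) ((g ^ c) ((s ^ (-(b : ℤ))) x)) = (g ^ (-c)) x := by rw [h2]
        rw [← hadd] at h3
        simpa using h3
      rw [mul_sub, mul_one, sub_eq_add_neg, hadd, h1, ← hcz, ih, ← hadd]
      congr 2; ring
  refine ⟨MulAction.period g x, b, c, ha, hbpos, hper, ?_⟩
  intro n j
  have hb0 : (b : ℤ) ≠ 0 := by exact_mod_cast hbpos.ne'
  constructor
  · intro h
    have hn : n = n % b + b * (n / b) := (Int.emod_add_mul_ediv n b).symm
    have hmod : n % b = 0 := by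
      by_contra hne
      have hnn := Int.emod_nonneg n hb0
      have hlt := Int.emod_lt_of_pos n (show (0 : ℤ) < b by exact_mod_cast hbpos)
      have : (s ^ (n % b)) x = (g ^ (j - c * (n / b))) x := by
        rw [hn, hadd, hbt, ← hcz] at h
        have h3 : (g ^ (-(c * (n / b)))) ((g ^ (c * (n / b))) ((s ^ (n % b)) x)) =
          (g ^ (-(c * (n / b)))) ((g ^ j) x) := by rw [h]
        rw [← hadd, ← hadd] at h3
        rw [show j - c * (n / b) = -(c * (n/b)) + j by ring, ← h3]; simp
      refine Nat.find_min hex (m := (n % b).toNat) ?_ ⟨?_, j - c * (n / b), ?_⟩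
      · omega
      · omega
      · rw [Int.toNat_of_nonneg hnn]; exact this
    have hdvd : (b : ℤ) ∣ n := Int.dvd_of_emod_eq_zero hmod
    refine ⟨hdvd, ?_⟩
    rw [← hgeq, ← h, ← hbt, Int.mul_ediv_cancel' hdvd]
  · rintro ⟨hd, h⟩
    rw [← hgeq] at h
    rw [h, ← hbt, Int.mul_ediv_cancel' hd]

/-- The equivalence relation generated by two commuting permutations. -/
def ksetoid {Ω : Type*} (g s : Equiv.Perm Ω) (hc : Commute g s) : Setoid Ω where
  r x y := ∃ i j : ℤ, y = (g ^ i) ((s ^ j) x)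
  iseqv := by
    have hcz : ∀ i j : ℤ, ∀ y, (g ^ i) ((s ^ j) y) = (s ^ j) ((g ^ i) y) := by
      intro i j y
      have := (hc.zpow_zpow i j)
      rw [← Equiv.Perm.mul_apply, this.eq, Equiv.Perm.mul_apply]
    have hadd : ∀ (h : Equiv.Perm Ω) (i j : ℤ) y, (h ^ i) ((h ^ j) y) = (h ^ (i + j)) y := by
      intro h i j y; rw [zpow_add, Equiv.Perm.mul_apply]
    refine ⟨fun x => ⟨0, 0, by simp⟩, ?_, ?_⟩
    · rintro x y ⟨i, j, rfl⟩
      refine ⟨-i, -j, ?_⟩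
      rw [← hcz i, hadd, hadd]; simp
    · rintro x y z ⟨i, j, rfl⟩ ⟨i', j', rfl⟩
      refine ⟨i' + i, j' + j, ?_⟩
      rw [← hcz i, hadd, hadd]

theorem class_card {Ω : Type*} [Finite Ω] (g s : Equiv.Perm Ω) (hc : Commute g s) (x : Ω)
    (a b : ℕ) (c : ℤ) (ha : 0 < a) (hb : 0 < b) (h1 : ∀ i : ℤ, (g ^ i) x = x ↔ (a : ℤ) ∣ i)
    (h2 : ∀ n j : ℤ, (s ^ n) x = (g ^ j) x ↔ (b : ℤ) ∣ n ∧ (a : ℤ) ∣ j - c * (n / b)) :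
    Nat.card {y // ksetoid g s hc x y} = a * b := by
  have hcz : ∀ i j : ℤ, ∀ y, (g ^ i) ((s ^ j) y) = (s ^ j) ((g ^ i) y) := by
    intro i j y
    have := (hc.zpow_zpow i j)
    rw [← Equiv.Perm.mul_apply, this.eq, Equiv.Perm.mul_apply]
  have hadd : ∀ (h : Equiv.Perm Ω) (i j : ℤ) y, (h ^ (i + j)) y = (h ^ i) ((h ^ j) y) := by
    intro h i j y; rw [zpow_add, Equiv.Perm.mul_apply]
  have hinj : ∀ (h : Equiv.Perm Ω) (i j : ℤ) y z, (h ^ i) y = (h ^ j) z → y = (h ^ (j - i)) z := by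
    intro h i j y z e
    have := congrArg (h ^ (-i)) e
    rw [← hadd, ← hadd] at this
    rw [sub_eq_neg_add, ← this]; simp
  have key : Function.Bijective (fun p : Fin a × Fin b =>
      (⟨(g ^ ((p.1 : ℕ) : ℤ)) ((s ^ ((p.2 : ℕ) : ℤ)) x), _, _, rfl⟩ :
        {y // ksetoid g s hc x y})) := by
    constructor
    · rintro ⟨i, j⟩ ⟨i', j'⟩ h
      have h : (g ^ ((i : ℕ) : ℤ)) ((s ^ ((j : ℕ) : ℤ)) x) =
        (g ^ ((i' : ℕ) : ℤ)) ((s ^ ((j' : ℕ) : ℤ)) x) := congrArg Subtype.val h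
      have e1 := hinj _ _ _ _ _ h
      rw [hcz] at e1
      have e2 := hinj _ _ _ _ _ e1
      rw [← hcz] at e2
      have e4 : (s ^ (((j : ℕ) : ℤ) - (j' : ℕ))) x = (g ^ (((i' : ℕ) : ℤ) - (i : ℕ))) x := by
        have := hinj s j j' x _ e1
        have h5 := congrArg (s ^ (((j : ℕ) : ℤ) - (j' : ℕ))) this
        rw [← hadd] at h5
        simpa using h5
      obtain ⟨hd1, hd2⟩ := (h2 _ _).1 e4
      have hjj : (j : ℕ) = j' := by
        have := Int.eq_zero_of_abs_lt_dvd hd1 (by rw [abs_lt]; constructor <;> omega)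
        omega
      have hii : (i : ℕ) = i' := by
        rw [hjj] at hd2
        simp at hd2
        have := Int.eq_zero_of_abs_lt_dvd hd2 (by rw [abs_lt]; constructor <;> omega)
        omega
      exact Prod.ext (Fin.ext hii) (Fin.ext hjj)
    · rintro ⟨y, i, j, rfl⟩
      have hb0 : (b : ℤ) ≠ 0 := by exact_mod_cast hb.ne'
      have ha0 : (a : ℤ) ≠ 0 := by exact_mod_cast ha.ne'
      have n1 := Int.emod_nonneg j hb0
      have n2 := Int.emod_lt_of_pos j (show (0 : ℤ) < b by exact_mod_cast hb)
      set I := i + c * (j / b) with hI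
      have n3 := Int.emod_nonneg I ha0
      have n4 := Int.emod_lt_of_pos I (show (0 : ℤ) < a by exact_mod_cast ha)
      refine ⟨⟨⟨(I % a).toNat, by omega⟩, ⟨(j % b).toNat, by omega⟩⟩, ?_⟩
      apply Subtype.ext
      simp only [Int.toNat_of_nonneg n1, Int.toNat_of_nonneg n3]
      have e1 : (s ^ ((b : ℤ) * (j / b))) x = (g ^ (c * (j / b))) x := by
        rw [h2, Int.mul_ediv_cancel_left _ hb0]; simp
      conv_rhs => rw [← Int.emod_add_mul_ediv j b, hadd, e1, ← hcz, ← hadd, ← hI,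
        ← Int.emod_add_mul_ediv I a, hadd, hcz]
      rw [hcz]
      have e2 : (g ^ ((a : ℤ) * (I / a))) x = x := by rw [h1]; simp
      rw [← hcz ((a : ℤ) * (I / a)), ] 
      rw [hcz ((a : ℤ) * (I / a)), e2]
      rw [hcz]
  rw [← Nat.card_congr (Equiv.ofBijective _ key)]
  simp
end T7

namespace T7
open Finset

theorem inner_count (a d : ℕ) (e : ℤ) (ha : 0 < a) (had : a ∣ d) :
    #((range d).filter fun j : ℕ => (a : ℤ) ∣ (j : ℤ) - e) = d / a := by
  obtain ⟨m, rfl⟩ := had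
  have h := Int.Ico_filter_modEq_card (a := 0) (b := ((a * m : ℕ) : ℤ)) (r := (a : ℤ))
    (by exact_mod_cast ha) e
  have h3 : #((range (a * m)).filter fun j : ℕ => (a : ℤ) ∣ (j : ℤ) - e) =
      #{x ∈ Ico (0 : ℤ) ((a * m : ℕ) : ℤ) | x ≡ e [ZMOD (a : ℤ)]} := by
    refine Finset.card_bij (fun j _ => (j : ℤ)) ?_ ?_ ?_
    · intro j hj
      simp only [mem_filter, mem_range, mem_Ico] at hj ⊢
      refine ⟨⟨by omega, by exact_mod_cast hj.1⟩, ?_⟩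
      exact (Int.modEq_iff_dvd.2 hj.2).symm
    · intro j _ j' _ h; exact_mod_cast h
    · intro x hx
      simp only [mem_filter, mem_Ico] at hx
      refine ⟨x.toNat, ?_, by simp [hx.1.1]⟩
      simp only [mem_filter, mem_range]
      refine ⟨by omega, ?_⟩
      rw [Int.toNat_of_nonneg hx.1.1]
      exact Int.modEq_iff_dvd.1 hx.2.symm
  rw [h3, Nat.mul_div_cancel_left _ ha]
  have ha' : (a : ℚ) ≠ 0 := by exact_mod_cast ha.ne'
  have h4 : ⌈((((a * m : ℕ) : ℤ) : ℚ) - (e : ℚ)) / ((a : ℤ) : ℚ)⌉ = ⌈((0 : ℚ) - e) / (a : ℚ)⌉ + m := by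
    rw [← Int.ceil_add_natCast]
    congr 1
    push_cast
    field_simp
    ring
  have h5 : (#{x ∈ Ico (0 : ℤ) ((a * m : ℕ) : ℤ) | x ≡ e [ZMOD (a : ℤ)]} : ℤ) = m := by
    rw [h]
    rw [h4]
    simp
  exact_mod_cast h5

theorem sum_div_aux (N a b : ℕ) (ha : 0 < a) (hb : 0 < b) :
    (∑ d ∈ N.divisors, if a ∣ d ∧ b ∣ N / d then d / a else 0) =
      if a * b ∣ N then ∑ d ∈ (N / (a * b)).divisors, d else 0 := by
  rcases Nat.eq_zero_or_pos N with rfl | hN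
  · simp
  split_ifs with h
  · obtain ⟨M, rfl⟩ := h
    rw [← Finset.sum_filter, Nat.mul_div_cancel_left _ (Nat.mul_pos ha hb)]
    have hM : 0 < M := Nat.pos_of_mul_pos_left hN
    symm
    refine Finset.sum_bij (fun d _ => a * d) ?_ ?_ ?_ ?_
    · intro d hd
      obtain ⟨hd, -⟩ := Nat.mem_divisors.1 hd
      obtain ⟨e, rfl⟩ := hd
      have hd0 : 0 < d := Nat.pos_of_mul_pos_right hM
      simp only [mem_filter, Nat.mem_divisors]
      refine ⟨⟨⟨b * e, by ring⟩, hN.ne'⟩, ⟨d, rfl⟩, ?_⟩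
      rw [show a * b * (d * e) = (a * d) * (b * e) by ring,
        Nat.mul_div_cancel_left _ (Nat.mul_pos ha hd0)]
      exact ⟨e, rfl⟩
    · intro x _ y _ h; exact Nat.eq_of_mul_eq_mul_left ha h
    · intro d hd
      simp only [mem_filter, Nat.mem_divisors] at hd
      obtain ⟨⟨h1, _⟩, ⟨d', rfl⟩, h3⟩ := hd
      obtain ⟨e, he⟩ := h1
      have hd0 : 0 < a * d' := by
        rcases Nat.eq_zero_or_pos (a * d') with h | h
        · rw [h] at he; simp at he; omega
        · exact h
      rw [he, Nat.mul_div_cancel_left _ hd0] at h3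
      obtain ⟨f, rfl⟩ := h3
      refine ⟨d', ?_, rfl⟩
      rw [Nat.mem_divisors]
      refine ⟨⟨f, ?_⟩, hM.ne'⟩
      apply Nat.eq_of_mul_eq_mul_left (Nat.mul_pos ha hb)
      rw [he]; ring
    · intro d _
      rw [Nat.mul_div_cancel_left _ ha]
  · apply Finset.sum_eq_zero
    intro d hd
    rw [if_neg]
    rintro ⟨⟨d', rfl⟩, h2⟩
    apply h
    obtain ⟨e, rfl⟩ := (Nat.mem_divisors.1 hd).1
    have hd0 : 0 < a * d' := Nat.pos_of_mul_pos_right hN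
    rw [Nat.mul_div_cancel_left _ hd0] at h2
    obtain ⟨f, rfl⟩ := h2
    exact ⟨d' * f, by ring⟩

open Classical in
theorem point_count {Ω : Type*} [Finite Ω] (g s : Equiv.Perm Ω) (hc : Commute g s) (x : Ω)
    (N : ℕ) :
    (∑ d ∈ N.divisors, ∑ j ∈ range d,
      if (g ^ d) x = x ∧ (s ^ (N / d)) x = (g ^ j) x then (1 : ℕ) else 0) =
    if Nat.card {y // ksetoid g s hc x y} ∣ N then
      ∑ d ∈ (N / Nat.card {y // ksetoid g s hc x y}).divisors, d else 0 := by
  obtain ⟨a, b, c, ha, hb, h1, h2⟩ := lattice_data g s hc x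
  rw [class_card g s hc x a b c ha hb h1 h2, ← sum_div_aux N a b ha hb]
  refine Finset.sum_congr rfl fun d hd => ?_
  have e1 : (g ^ d) x = x ↔ a ∣ d := by
    have := h1 d
    rw [zpow_natCast] at this
    rw [this, Int.natCast_dvd_natCast]
  have e2 : ∀ j : ℕ, (s ^ (N / d)) x = (g ^ j) x ↔ b ∣ N / d ∧
      (a : ℤ) ∣ (j : ℤ) - c * (((N / d : ℕ) : ℤ) / b) := by
    intro j
    have := h2 (N / d : ℕ) j
    rw [zpow_natCast, zpow_natCast] at this
    rw [this, Int.natCast_dvd_natCast]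
  split_ifs with h
  · rw [← inner_count a d (c * (((N / d : ℕ) : ℤ) / b)) ha h.1, Finset.card_filter]
    refine Finset.sum_congr rfl fun j hj => ?_
    simp only [e1, e2, h.1, h.2, true_and]
  · apply Finset.sum_eq_zero
    intro j hj
    rw [if_neg]
    rw [e1, e2]
    tauto

/-- size of a class -/
noncomputable def csz {Ω : Type*} (r : Setoid Ω) (c : Quotient r) : ℕ :=
  Nat.card {x // Quotient.mk r x = c}

/-- number of classes of size m -/
noncomputable def ncl {Ω : Type*} (r : Setoid Ω) (m : ℕ) : ℕ :=
  Nat.card {c : Quotient r // csz r c = m}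

open Classical in
theorem sum_class {Ω : Type*} [Fintype Ω] (r : Setoid Ω) (N : ℕ) (hN : 0 < N) (f : ℕ → ℕ) :
    (∑ x : Ω, if csz r (Quotient.mk r x) ∣ N then f (csz r (Quotient.mk r x)) else 0) =
      ∑ m ∈ N.divisors, m * ncl r m * f m := by
  have : Fintype (Quotient r) := Fintype.ofFinite _
  have h1 : (∑ x : Ω, if csz r (Quotient.mk r x) ∣ N then f (csz r (Quotient.mk r x)) else 0) =
      ∑ c : Quotient r, csz r c * (if csz r c ∣ N then f (csz r c) else 0) := by
    rw [← Finset.sum_fiberwise (s := univ) (g := fun x : Ω => Quotient.mk r x)]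
    refine Finset.sum_congr rfl fun c _ => ?_
    rw [Finset.sum_congr rfl (g := fun _ => (if csz r c ∣ N then f (csz r c) else 0))]
    · rw [Finset.sum_const, smul_eq_mul]
      congr 1
      rw [csz, Nat.card_eq_fintype_card, Fintype.card_subtype]
    · intro x hx
      rw [(mem_filter.1 hx).2]
  rw [h1]
  have h2 : ∀ c : Quotient r, csz r c * (if csz r c ∣ N then f (csz r c) else 0) =
      ∑ m ∈ N.divisors, if csz r c = m then m * f m else 0 := by
    intro c
    rw [Finset.sum_ite_eq]
    simp only [Nat.mem_divisors]
    split_ifs with h h' h'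
    · rfl
    · exact absurd ⟨h, hN.ne'⟩ h'
    · exact absurd h'.1 h
    · simp
  simp only [h2]
  rw [Finset.sum_comm]
  refine Finset.sum_congr rfl fun m _ => ?_
  rw [← Finset.sum_filter, Finset.sum_const, smul_eq_mul, ncl, Nat.card_eq_fintype_card,
    Fintype.card_subtype]
  ring

/-- number of points with prescribed lattice relations -/
noncomputable def fixc {Ω : Type*} (g s : Equiv.Perm Ω) (d n j : ℕ) : ℕ :=
  Nat.card {x // (g ^ d) x = x ∧ (s ^ n) x = (g ^ j) x}

theorem lattice_count {Ω : Type*} [Finite Ω] (g s : Equiv.Perm Ω) (hc : Commute g s)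
    (N : ℕ) (hN : 0 < N) :
    (∑ d ∈ N.divisors, ∑ j ∈ range d, fixc g s d (N / d) j) =
      ∑ m ∈ N.divisors, m * ncl (ksetoid g s hc) m * ∑ d ∈ (N / m).divisors, d := by
  classical
  have : Fintype Ω := Fintype.ofFinite Ω
  rw [← sum_class (ksetoid g s hc) N hN (fun m => ∑ d ∈ (N / m).divisors, d)]
  have h : ∀ x : Ω, csz (ksetoid g s hc) (Quotient.mk _ x) =
      Nat.card {y // ksetoid g s hc x y} := by
    intro x
    rw [csz]
    refine Nat.card_congr (Equiv.subtypeEquivRight fun y => ?_)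
    rw [Quotient.eq]
    exact ⟨fun h => (ksetoid g s hc).symm h, fun h => (ksetoid g s hc).symm h⟩
  simp only [h, ← point_count]
  rw [Finset.sum_comm]
  refine Finset.sum_congr rfl fun d _ => ?_
  rw [Finset.sum_comm]
  refine Finset.sum_congr rfl fun j _ => ?_
  rw [fixc, Nat.card_eq_fintype_card, Fintype.card_subtype, Finset.card_filter]
end T7

namespace T7
open Finset

/-- the coefficient of `t^7` in `∏ (1+t^m)^{n_m}` -/
def Phi (n1 n2 n3 n4 n5 n6 n7 : ℚ) : ℚ :=
  n1*(n1-1)*(n1-2)*(n1-3)*(n1-4)*(n1-5)*(n1-6)/5040 + n1*(n1-1)*(n1-2)*(n1-3)*(n1-4)/120*n2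
  + n1*(n1-1)*(n1-2)*(n1-3)/24*n3 + n1*(n1-1)*(n1-2)/6*(n4 + n2*(n2-1)/2)
  + n1*(n1-1)/2*(n5+n2*n3) + n1*(n6+n2*n4+n3*(n3-1)/2+n2*(n2-1)*(n2-2)/6)
  + n7 + n2*n5 + n3*n4 + n2*(n2-1)/2*n3

theorem choose_step (n k : ℕ) :
    ((n.choose (k+1) : ℕ) : ℚ) = (n.choose k : ℕ) * ((n : ℚ) - k) / (k+1) := by
  have h := Nat.choose_succ_right_eq n k
  rw [eq_div_iff (by positivity)]
  rcases le_or_gt k n with hk | hk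
  · have : ((n.choose (k+1) * (k+1) : ℕ) : ℚ) = (n.choose k * (n-k) : ℕ) := by rw [h]
    push_cast [hk] at this
    exact this
  · rw [Nat.choose_eq_zero_of_lt hk, Nat.choose_eq_zero_of_lt (by omega)]; simp

theorem coeff_one_add_pow (m n k : ℕ) (hm : 0 < m) :
    ((1 + Polynomial.X ^ m : Polynomial ℚ) ^ n).coeff k =
      if m ∣ k then ((n.choose (k / m) : ℕ) : ℚ) else 0 := by
  have : (1 + Polynomial.X ^ m : Polynomial ℚ) ^ n =
      Polynomial.expand ℚ m ((1 + Polynomial.X) ^ n) := by simp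
  rw [this, Polynomial.coeff_expand hm]
  simp [Polynomial.coeff_one_add_X_pow]

/-- the first eight coefficients -/
def Coe (A : Polynomial ℚ) (c0 c1 c2 c3 c4 c5 c6 c7 : ℚ) : Prop :=
  A.coeff 0 = c0 ∧ A.coeff 1 = c1 ∧ A.coeff 2 = c2 ∧ A.coeff 3 = c3 ∧ A.coeff 4 = c4 ∧
  A.coeff 5 = c5 ∧ A.coeff 6 = c6 ∧ A.coeff 7 = c7

theorem Coe.mul {A B : Polynomial ℚ} {a0 a1 a2 a3 a4 a5 a6 a7 b0 b1 b2 b3 b4 b5 b6 b7 : ℚ}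
    (hA : Coe A a0 a1 a2 a3 a4 a5 a6 a7) (hB : Coe B b0 b1 b2 b3 b4 b5 b6 b7) :
    Coe (A * B) (a0*b0) (a0*b1+a1*b0) (a0*b2+a1*b1+a2*b0) (a0*b3+a1*b2+a2*b1+a3*b0)
     (a0*b4+a1*b3+a2*b2+a3*b1+a4*b0) (a0*b5+a1*b4+a2*b3+a3*b2+a4*b1+a5*b0)
     (a0*b6+a1*b5+a2*b4+a3*b3+a4*b2+a5*b1+a6*b0)
     (a0*b7+a1*b6+a2*b5+a3*b4+a4*b3+a5*b2+a6*b1+a7*b0) := by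
  obtain ⟨h0, h1, h2, h3, h4, h5, h6, h7⟩ := hA
  obtain ⟨k0, k1, k2, k3, k4, k5, k6, k7⟩ := hB
  have key : ∀ (m : ℕ), (A * B).coeff m =
      ∑ i ∈ range (m+1), A.coeff i * B.coeff (m - i) := by
    intro m
    rw [Polynomial.coeff_mul, Finset.Nat.sum_antidiagonal_eq_sum_range_succ_mk]
  unfold Coe
  simp only [key, Finset.sum_range_succ, Finset.sum_range_zero]
  norm_num [h0, h1, h2, h3, h4, h5, h6, h7, k0, k1, k2, k3, k4, k5, k6, k7]

theorem coeff_seven (n1 n2 n3 n4 n5 n6 n7 : ℕ) :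
    ((1 + Polynomial.X ^ 1 : Polynomial ℚ) ^ n1 * ((1 + Polynomial.X ^ 2) ^ n2 *
      ((1 + Polynomial.X ^ 3) ^ n3 * ((1 + Polynomial.X ^ 4) ^ n4 * ((1 + Polynomial.X ^ 5) ^ n5 *
       ((1 + Polynomial.X ^ 6) ^ n6 * (1 + Polynomial.X ^ 7) ^ n7)))))).coeff 7 =
      Phi n1 n2 n3 n4 n5 n6 n7 := by
  have c : ∀ m n : ℕ, 0 < m → Coe ((1 + Polynomial.X ^ m : Polynomial ℚ) ^ n) _ _ _ _ _ _ _ _ :=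
    fun m n hm => ⟨coeff_one_add_pow m n 0 hm, coeff_one_add_pow m n 1 hm, coeff_one_add_pow m n 2 hm,
      coeff_one_add_pow m n 3 hm, coeff_one_add_pow m n 4 hm, coeff_one_add_pow m n 5 hm,
      coeff_one_add_pow m n 6 hm, coeff_one_add_pow m n 7 hm⟩
  have d7 := c 7 n7 (by norm_num)
  have d6 := (c 6 n6 (by norm_num)).mul d7
  norm_num [choose_step] at d6
  have d5 := (c 5 n5 (by norm_num)).mul d6
  norm_num [choose_step] at d5
  have d4 := (c 4 n4 (by norm_num)).mul d5
  norm_num [choose_step] at d4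
  have d3 := (c 3 n3 (by norm_num)).mul d4
  norm_num [choose_step] at d3
  have d2 := (c 2 n2 (by norm_num)).mul d3
  norm_num [choose_step] at d2
  have d1 := (c 1 n1 (by norm_num)).mul d2
  norm_num [choose_step] at d1
  have := d1.2.2.2.2.2.2.2
  rw [pow_one, this, Phi]
  ring

theorem subset_count {Q : Type*} [Fintype Q] [DecidableEq Q] (w : Q → ℕ) (hw : ∀ c, 0 < w c) :
    ((#{T : Finset Q | ∑ c ∈ T, w c = 7} : ℕ) : ℚ) =
      Phi (#{c | w c = 1} : ℕ) (#{c | w c = 2} : ℕ) (#{c | w c = 3} : ℕ) (#{c | w c = 4} : ℕ)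
        (#{c | w c = 5} : ℕ) (#{c | w c = 6} : ℕ) (#{c | w c = 7} : ℕ) := by
  have h1 : ((#{T : Finset Q | ∑ c ∈ T, w c = 7} : ℕ) : ℚ) =
      (∏ c : Q, (1 + Polynomial.X ^ (w c) : Polynomial ℚ)).coeff 7 := by
    rw [Finset.prod_one_add, Polynomial.finsetSum_coeff, Finset.card_filter]
    push_cast
    rw [Finset.powerset_univ]
    refine Finset.sum_congr rfl fun T _ => ?_
    rw [Finset.prod_pow_eq_pow_sum, Polynomial.coeff_X_pow]
    simp only [eq_comm]
  rw [h1, ← coeff_seven]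
  have h2 : (∏ c : Q, (1 + Polynomial.X ^ (w c) : Polynomial ℚ)) =
      (∏ m ∈ Icc 1 7, (1 + Polynomial.X ^ m : Polynomial ℚ) ^ (#{c | w c = m} : ℕ)) *
      ∏ c ∈ univ.filter (fun c => ¬ w c ≤ 7), (1 + Polynomial.X ^ (w c) : Polynomial ℚ) := by
    rw [← Finset.prod_filter_mul_prod_filter_not univ (fun c => w c ≤ 7)]
    congr 1
    rw [← Finset.prod_fiberwise_of_maps_to (s := univ.filter (fun c => w c ≤ 7)) (t := Icc 1 7)
      (g := w)]
    · refine Finset.prod_congr rfl fun m hm => ?_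
      rw [← Finset.prod_const]
      rw [Finset.filter_filter]
      have : univ.filter (fun c => w c ≤ 7 ∧ w c = m) = univ.filter (fun c => w c = m) := by
        ext c
        simp only [mem_filter, mem_univ, true_and, mem_Icc] at hm ⊢
        omega
      rw [this]
      refine Finset.prod_congr rfl fun c hc => ?_
      rw [(mem_filter.1 hc).2]
    · intro c hc
      have := hw c
      simp only [mem_filter, mem_univ, true_and, mem_Icc] at hc ⊢
      omega
  have h3 : ∀ U : Finset Q, (∀ c ∈ U, ¬ w c ≤ 7) → ∃ R : Polynomial ℚ,
      ∏ c ∈ U, (1 + Polynomial.X ^ (w c) : Polynomial ℚ) = 1 + R * Polynomial.X ^ 8 := by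
    intro U
    induction U using Finset.induction_on with
    | empty => intro _; exact ⟨0, by simp⟩
    | insert c U hc ih =>
      intro h
      obtain ⟨R, hR⟩ := ih (fun c' h' => h c' (mem_insert_of_mem h'))
      have := h c (mem_insert_self _ _)
      obtain ⟨e, he⟩ : ∃ e, w c = e + 8 := ⟨w c - 8, by omega⟩
      refine ⟨R + Polynomial.X ^ e + Polynomial.X ^ e * R * Polynomial.X ^ 8, ?_⟩
      rw [Finset.prod_insert hc, hR, he]
      ring
  obtain ⟨R, hR⟩ := h3 (univ.filter (fun c => ¬ w c ≤ 7)) (fun c hc => (mem_filter.1 hc).2)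
  rw [h2, hR, mul_add, mul_one, ← mul_assoc, Polynomial.coeff_add, Polynomial.coeff_mul_X_pow']
  simp only [show ¬ (8 ≤ 7) by norm_num, if_false, add_zero]
  have h4 : Icc 1 7 = ({1,2,3,4,5,6,7} : Finset ℕ) := by decide
  rw [h4]
  simp [Finset.prod_insert]

theorem stable_sets {Ω : Type*} [Fintype Ω] (r : Setoid Ω) :
    ((Nat.card {S : Finset Ω // S.card = 7 ∧ ∀ x ∈ S, ∀ y, r x y → y ∈ S} : ℕ) : ℚ) =
      Phi (ncl r 1) (ncl r 2) (ncl r 3) (ncl r 4) (ncl r 5) (ncl r 6) (ncl r 7) := by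
  classical
  have : Fintype (Quotient r) := Fintype.ofFinite _
  have hw : ∀ c, 0 < csz r c := by
    intro c
    induction c using Quotient.inductionOn with
    | h x =>
      rw [csz]
      have : Nonempty {y // Quotient.mk r y = Quotient.mk r x} := ⟨⟨x, rfl⟩⟩
      exact Nat.card_pos
  have h := subset_count (csz r) hw
  have hn : ∀ m, ncl r m = #{c | csz r c = m} := by
    intro m; rw [ncl, Nat.card_eq_fintype_card, Fintype.card_subtype]
  simp only [hn]
  rw [← h]
  congr 1
  rw [Nat.card_eq_fintype_card, Fintype.card_subtype]
  symm
  have hcard : ∀ T : Finset (Quotient r), #{x : Ω | Quotient.mk r x ∈ T} = ∑ c ∈ T, csz r c := by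
    intro T
    rw [Finset.card_eq_sum_card_fiberwise (f := fun x => Quotient.mk r x) (t := T)]
    · refine Finset.sum_congr rfl fun c hc => ?_
      rw [csz, Nat.card_eq_fintype_card, Fintype.card_subtype, Finset.filter_filter]
      congr 1
      ext x
      simp only [mem_filter, mem_univ, true_and]
      constructor
      · exact fun h => h.2
      · intro h; exact ⟨h ▸ hc, h⟩
    · intro x hx
      simpa using hx
  refine Finset.card_bij (fun T _ => univ.filter (fun x : Ω => Quotient.mk r x ∈ T)) ?_ ?_ ?_
  · intro T hT
    simp only [mem_filter, mem_univ, true_and] at hT ⊢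
    refine ⟨by rw [hcard, hT], ?_⟩
    intro x hx y hxy
    rwa [← Quotient.sound hxy]
  · intro T _ T' _ h
    ext c
    induction c using Quotient.inductionOn with
    | h x =>
      have := congrArg (x ∈ ·) h
      simpa using this
  · intro S hS
    simp only [mem_filter, mem_univ, true_and] at hS
    have e : univ.filter (fun x : Ω => Quotient.mk r x ∈ S.image (Quotient.mk r)) = S := by
      ext x
      simp only [mem_filter, mem_univ, true_and, mem_image]
      constructor
      · rintro ⟨y, hy, hxy⟩
        exact hS.2 y hy x (Quotient.exact hxy)
      · intro h; exact ⟨x, h, rfl⟩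
    refine ⟨S.image (Quotient.mk r), ?_, e⟩
    simp only [mem_filter, mem_univ, true_and]
    rw [← hcard, e, hS.1]
end T7

namespace T7
open Finset

section fieldfacts
variable (k K : Type*) [Field k] [Fintype k] [Field K] [Algebra k K]

/-- the `n`-th power of Frobenius -/
noncomputable def frn (n : ℕ) : K →ₐ[k] K := (FiniteField.frobeniusAlgHom k K) ^ n

theorem frn_apply (n : ℕ) (x : K) : frn k K n x = x ^ (Fintype.card k ^ n) := by
  unfold frn
  rw [AlgHom.coe_pow, FiniteField.coe_frobeniusAlgHom, pow_iterate]

theorem frn_root_finset [IsAlgClosed K] (n : ℕ) (hn : 0 < n) :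
    ∃ s : Finset K, s.card = Fintype.card k ^ n ∧ ∀ x, x ∈ s ↔ x ^ (Fintype.card k ^ n) = x := by
  classical
  obtain ⟨p, hp⟩ := CharP.exists k
  have := hp
  have : CharP K p := charP_of_injective_algebraMap (algebraMap k K).injective p
  have hpp : p.Prime := (CharP.char_is_prime k p)
  have : Fact p.Prime := ⟨hpp⟩
  obtain ⟨e, -, he⟩ := FiniteField.card k p
  have h1 : 1 < Fintype.card k ^ n := Nat.one_lt_pow hn.ne' Fintype.one_lt_card
  have hpd : p ∣ Fintype.card k ^ n := by
    rw [he, ← pow_mul]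
    exact dvd_pow_self p (by positivity)
  have hsep : (Polynomial.X ^ (Fintype.card k ^ n) - Polynomial.X : Polynomial K).Separable :=
    galois_poly_separable p _ hpd
  refine ⟨(Polynomial.X ^ (Fintype.card k ^ n) - Polynomial.X : Polynomial K).roots.toFinset, ?_, ?_⟩
  · rw [Multiset.toFinset_card_of_nodup (Polynomial.nodup_roots hsep),
      IsAlgClosed.card_roots_eq_natDegree, FiniteField.X_pow_card_sub_X_natDegree_eq K h1]
  · intro x
    rw [Multiset.mem_toFinset, Polynomial.mem_roots (FiniteField.X_pow_card_sub_X_ne_zero K h1)]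
    simp [Polynomial.IsRoot, sub_eq_zero]

theorem lang_c [IsAlgClosed K] (n m : ℕ) (hn : 0 < n) (hm : 0 < m) (h3 : 3 ≤ Fintype.card k)
    (T : Finset K) (hT : T.card ≤ 3) :
    ∃ c : K, c ^ ((Fintype.card k ^ n) ^ m) = c ∧
      ∀ β ∈ T, ∑ i ∈ range m, β ^ i * c ^ ((Fintype.card k ^ n) ^ i) ≠ 0 := by
  classical
  set Q := Fintype.card k ^ n with hQ
  have hQ3 : 3 ≤ Q := h3.trans (Nat.le_self_pow hn.ne' _)
  obtain ⟨s, hs, hs'⟩ := frn_root_finset k K (n * m) (by positivity)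
  rw [pow_mul, ← hQ] at hs hs'
  let p : K → Polynomial K := fun β => ∑ i ∈ range m, Polynomial.C (β ^ i) * Polynomial.X ^ (Q ^ i - 1)
  have hp0 : ∀ β, p β ≠ 0 := by
    intro β h
    have h2 : (p β).coeff 0 = 1 := by
      simp only [p, Polynomial.finsetSum_coeff, Polynomial.coeff_C_mul, Polynomial.coeff_X_pow]
      rw [Finset.sum_eq_single 0]
      · simp
      · intro i _ hi
        have : 1 < Q ^ i := Nat.one_lt_pow hi (by omega)
        rw [if_neg (by omega), mul_zero]
      · intro h; simp at h; omega
    rw [h] at h2; simp at h2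
  have hpd : ∀ β, (p β).natDegree ≤ Q ^ (m - 1) - 1 := by
    intro β
    apply Polynomial.natDegree_sum_le_of_forall_le
    intro i hi
    refine (Polynomial.natDegree_C_mul_X_pow_le _ _).trans ?_
    have : Q ^ i ≤ Q ^ (m - 1) := Nat.pow_le_pow_right (by omega) (by simp at hi; omega)
    omega
  let R : Polynomial K := Polynomial.X * ∏ β ∈ T, p β
  have hR0 : R ≠ 0 := mul_ne_zero Polynomial.X_ne_zero (Finset.prod_ne_zero_iff.2 fun β _ => hp0 β)
  have hRd : R.natDegree ≤ 1 + 3 * (Q ^ (m - 1) - 1) := by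
    refine Polynomial.natDegree_mul_le.trans ?_
    rw [Polynomial.natDegree_X]
    have : (∏ β ∈ T, p β).natDegree ≤ ∑ β ∈ T, (Q ^ (m - 1) - 1) :=
      (Polynomial.natDegree_prod_le _ _).trans (Finset.sum_le_sum fun β _ => hpd β)
    rw [Finset.sum_const, smul_eq_mul] at this
    have := this.trans (Nat.mul_le_mul_right _ hT)
    omega
  have hlt : R.roots.toFinset.card < s.card := by
    have h1 := (Multiset.toFinset_card_le R.roots).trans (R.card_roots'.trans hRd)
    have h2 : 3 * Q ^ (m - 1) ≤ Q ^ m := by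
      conv_rhs => rw [show m = (m - 1) + 1 by omega, pow_succ, mul_comm]
      exact Nat.mul_le_mul_right _ hQ3
    have : 0 < Q ^ (m - 1) := by positivity
    omega
  obtain ⟨c, hc, hcR⟩ := Finset.exists_mem_notMem_of_card_lt_card hlt
  rw [Multiset.mem_toFinset, Polynomial.mem_roots hR0, Polynomial.IsRoot] at hcR
  simp only [R, Polynomial.eval_mul, Polynomial.eval_X, Polynomial.eval_prod, mul_eq_zero, not_or,
    Finset.prod_eq_zero_iff, not_exists, not_and] at hcR
  refine ⟨c, (hs' c).1 hc, fun β hβ h => hcR.2 β hβ ?_⟩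
  have : c * (p β).eval c = 0 := by
    rw [← h]
    simp only [p, Polynomial.eval_finsetSum, Finset.mul_sum]
    refine Finset.sum_congr rfl fun i _ => ?_
    simp only [Polynomial.eval_mul, Polynomial.eval_C, Polynomial.eval_pow, Polynomial.eval_X]
    have : 0 < Q ^ i := by positivity
    conv_rhs => rw [show Q ^ i = (Q ^ i - 1) + 1 by omega, pow_succ]
    ring
  exact (mul_eq_zero.1 this).resolve_left hcR.1

end fieldfacts
section lang
variable {k K : Type*} [Field k] [Fintype k] [Field K] [Algebra k K]

theorem lang [IsAlgClosed K] (n : ℕ) (hn : 0 < n) (h3 : 3 ≤ Fintype.card k)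
    (h : Matrix.GeneralLinearGroup (Fin 3) k) :
    ∃ M : Matrix (Fin 3) (Fin 3) K, M.det ≠ 0 ∧
      (∀ x : Matrix (Fin 3) (Fin 3) k, Commute x h.val →
        Commute (x.map (algebraMap k K)) M) ∧
      M.map (fun y => y ^ (Fintype.card k ^ n)) = h.val.map (algebraMap k K) * M := by
  classical
  set Q := Fintype.card k ^ n with hQ
  set m := orderOf h with hm
  have hm0 : 0 < m := orderOf_pos h
  let φ : Matrix (Fin 3) (Fin 3) k →+* Matrix (Fin 3) (Fin 3) K := (algebraMap k K).mapMatrix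
  set U : Matrix (Fin 3) (Fin 3) K := φ ((h⁻¹).val) with hU
  have hUm : U ^ m = 1 := by
    rw [hU, ← map_pow, ← Units.val_pow_eq_pow_val, inv_pow, pow_orderOf_eq_one, inv_one]
    simp
  obtain ⟨c, hc, hcT⟩ := lang_c k K n m hn hm0 h3 (U.charpoly.roots.toFinset) (by
    refine (Multiset.toFinset_card_le _).trans ((Polynomial.card_roots' _).trans ?_)
    rw [Matrix.charpoly_natDegree_eq_dim]; simp)
  rw [← hQ] at hc hcT
  let M : Matrix (Fin 3) (Fin 3) K := ∑ i ∈ range m, c ^ (Q ^ i) • U ^ i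
  have hcomU : Commute U M := by
    apply Commute.sum_right
    intro i _
    exact ((Commute.refl U).pow_right i).smul_right _
  have hFM : M.map (fun y => y ^ Q) = ∑ i ∈ range m, c ^ (Q ^ (i + 1)) • U ^ i := by
    have e1 : M.map (fun y => y ^ Q) = (frn k K n).toRingHom.mapMatrix M := by
      ext a b
      simp [frn_apply, hQ]
    have e2 : (frn k K n).toRingHom.mapMatrix U = U := by
      ext a b
      simp [hU, φ]
    rw [e1, map_sum]
    refine Finset.sum_congr rfl fun i _ => ?_
    rw [show c ^ (Q ^ i) • U ^ i = Matrix.scalar (Fin 3) (c ^ Q ^ i) * U ^ i by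
      simp [Matrix.smul_eq_diagonal_mul]]
    rw [map_mul, map_pow _ U, e2]
    rw [show (frn k K n).toRingHom.mapMatrix (Matrix.scalar (Fin 3) (c ^ Q ^ i))
      = Matrix.scalar (Fin 3) (c ^ Q ^ (i+1)) by
        ext a b
        by_cases hab : a = b
        · subst hab
          simp [frn_apply, ← pow_mul, pow_succ, hQ]
        · simp [Matrix.scalar_apply, Matrix.diagonal_apply_ne _ hab]]
    simp [Matrix.smul_eq_diagonal_mul]
  have hUF : U * M.map (fun y => y ^ Q) = M := by
    rw [hFM, Finset.mul_sum]
    have e1 : ∀ i, U * (c ^ (Q ^ (i + 1)) • U ^ i) = c ^ (Q ^ (i+1)) • U ^ (i+1) := by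
      intro i
      rw [mul_smul_comm, pow_succ' U]
    simp only [e1]
    have e2 := Finset.sum_range_succ (fun i => c ^ (Q ^ i) • U ^ i) m
    rw [Finset.sum_range_succ'] at e2
    simp only [hc, hUm, pow_zero, pow_one] at e2
    exact add_right_cancel e2
  have hhU : φ h.val * U = 1 := by
    rw [hU, ← map_mul]
    simp
  refine ⟨M, ?_, ?_, ?_⟩
  · intro hdet
    obtain ⟨v, hv0, hv⟩ := Matrix.exists_mulVec_eq_zero_iff.2 hdet
    let W := LinearMap.ker (Matrix.toLin' M)
    have hWs : ∀ x ∈ W, Matrix.toLin' U x ∈ W := by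
      intro x hx
      simp only [W, LinearMap.mem_ker, Matrix.toLin'_apply] at hx ⊢
      rw [Matrix.mulVec_mulVec, ← hcomU.eq, ← Matrix.mulVec_mulVec, hx, Matrix.mulVec_zero]
    have : Nontrivial W := ⟨⟨⟨v, by simpa [W] using hv⟩, 0, fun h => hv0 (by simpa using congrArg Subtype.val h)⟩⟩
    obtain ⟨β, hβ⟩ := Module.End.exists_eigenvalue ((Matrix.toLin' U).restrict hWs)
    obtain ⟨x, hx⟩ := hβ.exists_hasEigenvector
    have hx1 : U.mulVec x.1 = β • x.1 := by
      have := congrArg Subtype.val hx.apply_eq_smul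
      simpa using this
    have hx0 : x.1 ≠ 0 := fun h => hx.2 (Subtype.ext h)
    have hMx : M.mulVec x.1 = 0 := by simpa only [W, LinearMap.mem_ker, Matrix.toLin'_apply] using x.2
    have hpow : ∀ i, (U ^ i).mulVec x.1 = β ^ i • x.1 := by
      intro i
      induction i with
      | zero => simp
      | succ i ih => rw [pow_succ, ← Matrix.mulVec_mulVec, hx1, Matrix.mulVec_smul, ih, smul_smul, pow_succ, mul_comm]
    have hS : (∑ i ∈ range m, β ^ i * c ^ (Q ^ i)) • x.1 = 0 := by
      rw [← hMx]
      simp only [M, Matrix.sum_mulVec, Matrix.smul_mulVec, hpow, smul_smul, Finset.sum_smul]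
      refine Finset.sum_congr rfl fun i _ => by rw [mul_comm]
    refine hcT β ?_ ((smul_eq_zero.1 hS).resolve_right hx0)
    rw [Multiset.mem_toFinset, Polynomial.mem_roots U.charpoly_monic.ne_zero]
    have : Module.End.HasEigenvalue (Matrix.toLin' U) β :=
      Module.End.hasEigenvalue_of_hasEigenvector (x := x.1) ⟨by
        rw [Module.End.mem_eigenspace_iff]; simpa using hx1, hx0⟩
    rw [Module.End.hasEigenvalue_iff_isRoot_charpoly] at this
    simpa using this
  · intro x hx
    have h1 : Commute (φ x) U := by
      have : Commute x (h⁻¹).val := by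
        have := hx.units_inv_right (u := h)
        exact this
      exact this.map φ
    exact Commute.sum_right _ _ _ fun i _ => (h1.pow_right i).smul_right _
  · conv_rhs => rw [← hUF, ← mul_assoc]
    rw [show h.val.map (algebraMap k K) * U = 1 from hhU, one_mul]

end lang
end T7

namespace T7
open Finset
set_option linter.unusedSectionVars false

section proj
variable (k : Type*) {K : Type*} [Field k] [Fintype k] [Field K] [Algebra k K]

/-- projective plane over `K` -/
abbrev PP (K : Type*) [Field K] := Projectivization K (Fin 3 → K)

theorem GL_mulVec_ne {K : Type*} [Field K] (M : Matrix.GeneralLinearGroup (Fin 3) K) {v : Fin 3 → K}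
    (hv : v ≠ 0) : M.val.mulVec v ≠ 0 := by
  intro h
  apply hv
  have : (M⁻¹).val.mulVec (M.val.mulVec v) = v := by
    rw [Matrix.mulVec_mulVec, ← Units.val_mul, inv_mul_cancel]; simp
  rw [← this, h, Matrix.mulVec_zero]

/-- the projective transformation of a matrix -/
noncomputable def pmf (M : Matrix.GeneralLinearGroup (Fin 3) K) : PP K → PP K :=
  Projectivization.lift (fun v => Projectivization.mk K (M.val.mulVec v.1) (GL_mulVec_ne M v.2)) (by
    rintro ⟨a, ha⟩ ⟨b, hb⟩ t h
    rw [Projectivization.mk_eq_mk_iff']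
    refine ⟨t, ?_⟩
    simp only at h ⊢
    rw [h, Matrix.mulVec_smul])

theorem pmf_mk (M : Matrix.GeneralLinearGroup (Fin 3) K) (v : Fin 3 → K) (hv : v ≠ 0) :
    pmf M (Projectivization.mk K v hv) = Projectivization.mk K (M.val.mulVec v) (GL_mulVec_ne M hv) := rfl

theorem pmf_mul (M N : Matrix.GeneralLinearGroup (Fin 3) K) (x : PP K) :
    pmf (M * N) x = pmf M (pmf N x) := by
  induction x using Projectivization.ind with
  | h v hv => simp only [pmf_mk, Units.val_mul, Matrix.mulVec_mulVec]

theorem pmf_one (x : PP K) : pmf (1 : Matrix.GeneralLinearGroup (Fin 3) K) x = x := by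
  induction x using Projectivization.ind with
  | h v hv => simp only [pmf_mk, Units.val_one, Matrix.one_mulVec]

/-- the projective linear action as a homomorphism -/
noncomputable def pm : Matrix.GeneralLinearGroup (Fin 3) K →* Equiv.Perm (PP K) where
  toFun M := ⟨pmf M, pmf M⁻¹, fun x => by rw [← pmf_mul, inv_mul_cancel, pmf_one],
    fun x => by rw [← pmf_mul, mul_inv_cancel, pmf_one]⟩
  map_one' := by ext x; exact pmf_one x
  map_mul' M N := by ext x; exact pmf_mul M N x

theorem pm_mk (M : Matrix.GeneralLinearGroup (Fin 3) K) (v : Fin 3 → K) (hv : v ≠ 0) :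
    pm M (Projectivization.mk K v hv) = Projectivization.mk K (M.val.mulVec v) (GL_mulVec_ne M hv) := rfl

theorem frv_ne (n : ℕ) {v : Fin 3 → K} (hv : v ≠ 0) :
    (fun i => v i ^ (Fintype.card k ^ n)) ≠ 0 := by
  intro h
  apply hv
  funext i
  have := congrFun h i
  exact eq_zero_of_pow_eq_zero this

/-- Frobenius -/
noncomputable def pff : PP K → PP K :=
  Projectivization.lift (fun v => Projectivization.mk K (fun i => v.1 i ^ (Fintype.card k ^ 1)) (frv_ne k 1 v.2)) (by
    rintro ⟨a, ha⟩ ⟨b, hb⟩ t h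
    rw [Projectivization.mk_eq_mk_iff']
    refine ⟨t ^ (Fintype.card k ^ 1), ?_⟩
    simp only at h ⊢
    rw [h]
    funext i
    simp [mul_pow])

theorem pff_mk (v : Fin 3 → K) (hv : v ≠ 0) :
    pff k (Projectivization.mk K v hv) =
      Projectivization.mk K (fun i => v i ^ (Fintype.card k ^ 1)) (frv_ne k 1 hv) := rfl

variable [IsAlgClosed K]

theorem pff_bij : Function.Bijective (pff k : PP K → PP K) := by
  have hq : 0 < Fintype.card k := Fintype.card_pos
  have hinj : Function.Injective (fun x : K => x ^ (Fintype.card k ^ 1)) := by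
    intro x y h
    have : frn k K 1 x = frn k K 1 y := by rw [frn_apply, frn_apply]; exact h
    exact (frn k K 1).toRingHom.injective this
  constructor
  · intro x y h
    induction x using Projectivization.ind with
    | h v hv =>
    induction y using Projectivization.ind with
    | h w hw =>
    rw [pff_mk, pff_mk, Projectivization.mk_eq_mk_iff'] at h
    obtain ⟨a, ha⟩ := h
    obtain ⟨b, hb⟩ := IsAlgClosed.exists_pow_nat_eq a (n := Fintype.card k ^ 1) (by positivity)
    rw [Projectivization.mk_eq_mk_iff']
    refine ⟨b, ?_⟩
    funext i
    apply hinj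
    have := congrFun ha i
    simp only [Pi.smul_apply, smul_eq_mul, mul_pow] at this ⊢
    rw [hb, this]
  · intro y
    induction y using Projectivization.ind with
    | h w hw =>
    choose f hf using fun i => IsAlgClosed.exists_pow_nat_eq (w i) (n := Fintype.card k ^ 1) (by positivity)
    have hf0 : f ≠ 0 := by
      intro h
      apply hw
      funext i
      rw [← hf i, h]
      exact zero_pow (by positivity)
    refine ⟨Projectivization.mk K f hf0, ?_⟩
    rw [pff_mk]
    congr 1
    funext i
    exact hf i

/-- Frobenius as a permutation -/
noncomputable def pf (K : Type*) [Field K] [Algebra k K] [IsAlgClosed K] : Equiv.Perm (PP K) :=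
  Equiv.ofBijective _ (pff_bij k)

theorem pf_apply (x : PP K) : pf k K x = pff k x := by
  unfold pf
  rfl

theorem pf_pow_mk (n : ℕ) (v : Fin 3 → K) (hv : v ≠ 0) :
    (pf k K ^ n) (Projectivization.mk K v hv) =
      Projectivization.mk K (fun i => v i ^ (Fintype.card k ^ n)) (frv_ne k n hv) := by
  induction n with
  | zero => simp
  | succ n ih =>
    rw [pow_succ', Equiv.Perm.mul_apply, ih]
    rw [pf_apply, pff_mk]
    congr 1
    funext i
    rw [← pow_mul, pow_one, pow_succ]

/-- action of the finite group -/
noncomputable def ga (K : Type*) [Field K] [Algebra k K] :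
    Matrix.GeneralLinearGroup (Fin 3) k →* Equiv.Perm (PP K) :=
  pm.comp (Matrix.GeneralLinearGroup.map (algebraMap k K))

theorem ga_ne (g : Matrix.GeneralLinearGroup (Fin 3) k) {v : Fin 3 → K} (hv : v ≠ 0) :
    (g.val.map (algebraMap k K)).mulVec v ≠ 0 :=
  GL_mulVec_ne (Matrix.GeneralLinearGroup.map (algebraMap k K) g) hv

theorem ga_mk (g : Matrix.GeneralLinearGroup (Fin 3) k) (v : Fin 3 → K) (hv : v ≠ 0) :
    ga k K g (Projectivization.mk K v hv) = Projectivization.mk K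
      ((g.val.map (algebraMap k K)).mulVec v) (ga_ne k g hv) :=
  rfl

theorem frob_mulVec (n : ℕ) (M : Matrix (Fin 3) (Fin 3) K) (v : Fin 3 → K) :
    (fun i => M.mulVec v i ^ (Fintype.card k ^ n)) =
      (M.map (fun y => y ^ (Fintype.card k ^ n))).mulVec (fun i => v i ^ (Fintype.card k ^ n)) := by
  funext i
  rw [← frn_apply k K n]
  simp only [Matrix.mulVec, dotProduct, map_sum, map_mul, frn_apply, Matrix.map_apply]

theorem map_frob (n : ℕ) (g : Matrix (Fin 3) (Fin 3) k) :
    (g.map (algebraMap k K)).map (fun y => y ^ (Fintype.card k ^ n)) = g.map (algebraMap k K) := by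
  ext i j
  simp only [Matrix.map_apply]
  rw [← frn_apply k K n, AlgHom.commutes]

theorem ga_pf (g : Matrix.GeneralLinearGroup (Fin 3) k) : Commute (ga k K g) (pf k K) := by
  ext x
  rw [Equiv.Perm.mul_apply, Equiv.Perm.mul_apply]
  induction x using Projectivization.ind with
  | h v hv =>
  have h1 := fun (w : Fin 3 → K) hw => pf_pow_mk k 1 w hw
  simp only [pow_one] at h1
  rw [h1, ga_mk, ga_mk, h1]
  congr 1
  have := frob_mulVec k 1 (g.val.map (algebraMap k K)) v
  rw [map_frob] at this
  simpa using this.symm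

/-- number of points of `ℙ²` fixed by `g^d` and `σ^n` -/
noncomputable def PC (K : Type*) [Field K] [Algebra k K] [IsAlgClosed K] (n : ℕ)
    (h : Matrix.GeneralLinearGroup (Fin 3) k) : ℕ :=
  Nat.card {x : PP K // ga k K h x = x ∧ (pf k K ^ n) x = x}

theorem lang_points (h3 : 3 ≤ Fintype.card k) (g : Matrix.GeneralLinearGroup (Fin 3) k) (d n j : ℕ)
    (hn : 0 < n) :
    Nat.card {x : PP K // (ga k K g ^ d) x = x ∧ (pf k K ^ n) x = (ga k K g ^ j) x} =
      PC k K n (g ^ d) := by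
  obtain ⟨M, hM, hcom, hF⟩ := lang (K := K) n hn h3 (g ^ j)
  let M' : Matrix.GeneralLinearGroup (Fin 3) K := Matrix.GeneralLinearGroup.mkOfDetNeZero M hM
  have hM' : M'.val = M := rfl
  symm
  refine Nat.card_congr ((pm M').subtypeEquiv ?_)
  intro x
  have e1 : Commute (pm M') (ga k K (g ^ d)) := by
    unfold ga
    rw [MonoidHom.comp_apply]
    apply Commute.map
    apply Units.ext
    have := (hcom (g ^ d).val (by
      have : Commute (g ^ d) (g ^ j) := (Commute.refl g).pow_pow d j
      exact congrArg Units.val this)).symm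
    exact this
  have e2 : (pf k K ^ n) (pm M' x) = (ga k K (g ^ j)) (pm M' ((pf k K ^ n) x)) := by
    induction x using Projectivization.ind with
    | h v hv =>
    rw [pm_mk, pf_pow_mk, pf_pow_mk, pm_mk, ga_mk]
    congr 1
    rw [frob_mulVec, hM', hF, Matrix.mulVec_mulVec]
  rw [← map_pow, ← map_pow, e2]
  have e3 : (ga k K (g ^ d)) (pm M' x) = pm M' (ga k K (g ^ d) x) := by
    rw [← Equiv.Perm.mul_apply, ← e1.eq, Equiv.Perm.mul_apply]
  rw [e3]
  simp

end proj
end T7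

namespace T7
open Finset
set_option linter.unusedSectionVars false

section rat
variable (k K : Type*) [Field k] [Fintype k] [Field K] [Algebra k K] [IsAlgClosed K]

/-- the subfield with `q^n` elements, as a type -/
abbrev FQ (n : ℕ) := {a : K // a ^ (Fintype.card k ^ n) = a}

theorem card_FQ (n : ℕ) (hn : 0 < n) : Nat.card (FQ k K n) = Fintype.card k ^ n := by
  obtain ⟨s, hs, hs'⟩ := frn_root_finset k K n hn
  rw [← hs, ← Nat.card_eq_finsetCard s]
  exact Nat.card_congr (Equiv.subtypeEquivRight fun x => (hs' x).symm)

theorem finite_FQ (n : ℕ) (hn : 0 < n) : Finite (FQ k K n) := by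
  apply Nat.finite_of_card_ne_zero
  rw [card_FQ k K n hn]
  have : 0 < Fintype.card k := Fintype.card_pos
  positivity

variable {k K}
theorem v1_ne (a b : K) : (![1, a, b] : Fin 3 → K) ≠ 0 := fun h => by simpa using congrFun h 0
theorem v2_ne (a : K) : (![0, 1, a] : Fin 3 → K) ≠ 0 := fun h => by simpa using congrFun h 1
theorem v3_ne : (![0, 0, 1] : Fin 3 → K) ≠ 0 := fun h => by simpa using congrFun h 2

variable (k K)
/-- normalised points -/
noncomputable def nrm (n : ℕ) : (FQ k K n × FQ k K n) ⊕ FQ k K n ⊕ Unit → PP K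
  | Sum.inl ab => Projectivization.mk K ![1, ab.1.1, ab.2.1] (v1_ne _ _)
  | Sum.inr (Sum.inl a) => Projectivization.mk K ![0, 1, a.1] (v2_ne _)
  | Sum.inr (Sum.inr _) => Projectivization.mk K ![0, 0, 1] v3_ne

theorem nrm_inj (n : ℕ) : Function.Injective (nrm k K n) := by
  rintro (⟨⟨a, ha⟩, ⟨b, hb⟩⟩ | ⟨a, ha⟩ | _) (⟨⟨c, hc⟩, ⟨d, hd⟩⟩ | ⟨c, hc⟩ | _) h <;>
  (try rfl) <;> simp only [nrm, Projectivization.mk_eq_mk_iff'] at h <;> obtain ⟨t, ht⟩ := h <;>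
  have h0 := congrFun ht 0 <;> have h1 := congrFun ht 1 <;> have h2 := congrFun ht 2 <;>
  simp at h0 h1 h2
  all_goals simp_all

theorem nrm_fix (n : ℕ) (y) : (pf k K ^ n) (nrm k K n y) = nrm k K n y := by
  have hq : Fintype.card k ^ n ≠ 0 := pow_ne_zero _ Fintype.card_ne_zero
  rcases y with ⟨⟨a, ha⟩, ⟨b, hb⟩⟩ | ⟨a, ha⟩ | _ <;> simp only [nrm] <;> rw [pf_pow_mk] <;> congr 1 <;> funext i <;> fin_cases i <;>
  simp [*]

theorem nrm_surj (n : ℕ) (x : PP K) (hx : (pf k K ^ n) x = x) : ∃ y, nrm k K n y = x := by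
  have hq : Fintype.card k ^ n ≠ 0 := pow_ne_zero _ Fintype.card_ne_zero
  induction x using Projectivization.ind with
  | h v hv =>
  rw [pf_pow_mk, Projectivization.mk_eq_mk_iff'] at hx
  obtain ⟨t, ht⟩ := hx
  have hti : ∀ i, t * v i = v i ^ (Fintype.card k ^ n) := fun i => congrFun ht i
  have key : ∀ i j, v i ≠ 0 → (v j / v i) ^ (Fintype.card k ^ n) = v j / v i := by
    intro i j hi
    rw [div_pow, ← hti, ← hti, mul_div_mul_left]
    intro h0
    have := hti i
    rw [h0, zero_mul] at this
    exact hi (eq_zero_of_pow_eq_zero this.symm)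
  by_cases h0 : v 0 = 0
  · by_cases h1 : v 1 = 0
    · have h2 : v 2 ≠ 0 := by
        intro h2
        apply hv
        funext i
        fin_cases i <;> simp [h0, h1, h2]
      refine ⟨Sum.inr (Sum.inr ()), ?_⟩
      simp only [nrm]
      rw [Projectivization.mk_eq_mk_iff']
      refine ⟨(v 2)⁻¹, ?_⟩
      funext i
      fin_cases i <;> simp [h0, h1, h2]
    · refine ⟨Sum.inr (Sum.inl ⟨v 2 / v 1, key 1 2 h1⟩), ?_⟩
      simp only [nrm]
      rw [Projectivization.mk_eq_mk_iff']
      refine ⟨(v 1)⁻¹, ?_⟩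
      funext i
      fin_cases i <;> simp [h0, h1]; field_simp
  · refine ⟨Sum.inl (⟨v 1 / v 0, key 0 1 h0⟩, ⟨v 2 / v 0, key 0 2 h0⟩), ?_⟩
    simp only [nrm]
    rw [Projectivization.mk_eq_mk_iff']
    refine ⟨(v 0)⁻¹, ?_⟩
    funext i
    fin_cases i <;> simp [h0] <;> field_simp

/-- normal form equivalence -/
noncomputable def nrmEquiv (n : ℕ) (Z : PP K → Prop) :
    {x : PP K // Z x ∧ (pf k K ^ n) x = x} ≃ {y // Z (nrm k K n y)} :=
  (Equiv.ofBijective (fun y : {y // Z (nrm k K n y)} =>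
    (⟨nrm k K n y.1, y.2, nrm_fix k K n y.1⟩ : {x : PP K // Z x ∧ (pf k K ^ n) x = x}))
    ⟨fun y z h => Subtype.ext (nrm_inj k K n (congrArg Subtype.val h)), by
      rintro ⟨x, hZ, hx⟩
      obtain ⟨y, rfl⟩ := nrm_surj k K n x hx
      exact ⟨⟨y, hZ⟩, rfl⟩⟩).symm

theorem finite_fix (n : ℕ) (hn : 0 < n) : Finite {x : PP K // (pf k K ^ n) x = x} := by
  have := finite_FQ k K n hn
  have h2 := Finite.of_equiv _ (nrmEquiv k K n (fun _ => True)).symm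
  exact Finite.of_equiv _ (Equiv.subtypeEquivRight (fun x => by simp) : {x : PP K // True ∧ (pf k K ^ n) x = x} ≃ _)

theorem rat_all (n : ℕ) (hn : 0 < n) (Z : PP K → Prop) (hZ : ∀ x, Z x) :
    Nat.card {x : PP K // Z x ∧ (pf k K ^ n) x = x} =
     (Fintype.card k ^ n) ^ 2 + Fintype.card k ^ n + 1 := by
  have := finite_FQ k K n hn
  rw [Nat.card_congr (nrmEquiv k K n Z), Nat.card_congr (Equiv.subtypeUnivEquiv (fun y => hZ _)),
    Nat.card_sum, Nat.card_sum, Nat.card_prod, card_FQ k K n hn]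
  simp; ring

theorem rat_line (n : ℕ) (hn : 0 < n) (w : Fin 3 → K) (hw : ∀ i, w i ^ (Fintype.card k ^ n) = w i)
    (hw0 : w ≠ 0) (Z : PP K → Prop)
    (hZ : ∀ v hv, Z (Projectivization.mk K v hv) ↔ w 0 * v 0 + w 1 * v 1 + w 2 * v 2 = 0) :
    Nat.card {x : PP K // Z x ∧ (pf k K ^ n) x = x} = Fintype.card k ^ n + 1 := by
  have hfin := finite_FQ k K n hn
  have hwf : ∀ i, frn k K n (w i) = w i := fun i => by rw [frn_apply]; exact hw i
  rw [Nat.card_congr (nrmEquiv k K n Z)]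
  have hu : Nat.card (FQ k K n ⊕ Unit) = Fintype.card k ^ n + 1 := by
    rw [Nat.card_sum, card_FQ k K n hn]; simp
  rw [← hu]
  symm
  by_cases h2 : w 2 = 0
  · by_cases h1 : w 1 = 0
    · have h0 : w 0 ≠ 0 := by
        intro h0
        apply hw0
        funext i
        fin_cases i <;> simp [h0, h1, h2]
      let f : FQ k K n ⊕ Unit → {y // Z (nrm k K n y)} := fun y => ⟨Sum.inr y, by
        rcases y with y | y <;> simp only [nrm, hZ] <;> simp [h1, h2]⟩
      apply Nat.card_congr (Equiv.ofBijective f ?_)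
      constructor
      · intro a b h; simpa [f] using h
      · rintro ⟨⟨a, b⟩ | y, hy⟩
        · simp only [nrm, hZ] at hy; simp [h1, h2, h0] at hy
        · exact ⟨y, rfl⟩
    · have hfr : (-(w 0 / w 1)) ^ (Fintype.card k ^ n) = -(w 0 / w 1) := by
        rw [← frn_apply, map_neg, map_div₀, hwf, hwf]
      let f : FQ k K n ⊕ Unit → {y // Z (nrm k K n y)} := fun y => 
        match y with
        | Sum.inl y => ⟨Sum.inl (⟨_, hfr⟩, y), by
            simp only [nrm, hZ]; simp [h2]; field_simp; ring⟩
        | Sum.inr y => ⟨Sum.inr (Sum.inr ()), by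
            simp only [nrm, hZ]; simp [h2]⟩
      apply Nat.card_congr (Equiv.ofBijective f ?_)
      constructor
      · rintro (a | a) (b | b) h <;> simp [f] at h <;> simp [h]
      · rintro ⟨⟨⟨a, ha⟩, b⟩ | y | y, hy⟩
        · simp only [nrm, hZ] at hy; simp [h2] at hy
          refine ⟨Sum.inl b, ?_⟩
          have : a = -(w 0 / w 1) := by field_simp; linear_combination hy
          subst this
          simp [f]
        · simp only [nrm, hZ] at hy; simp [h2, h1] at hy
        · exact ⟨Sum.inr y, rfl⟩
  · have hfr2 : (-(w 1 / w 2)) ^ (Fintype.card k ^ n) = -(w 1 / w 2) := by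
      rw [← frn_apply, map_neg, map_div₀, hwf, hwf]
    have hfr : ∀ a : FQ k K n, (-((w 0 + w 1 * a.1) / w 2)) ^ (Fintype.card k ^ n) = -((w 0 + w 1 * a.1) / w 2) := by
      intro a
      have ha : frn k K n a.1 = a.1 := by rw [frn_apply]; exact a.2
      rw [← frn_apply, map_neg, map_div₀, map_add, map_mul, hwf, hwf, hwf, ha]
    let f : FQ k K n ⊕ Unit → {y // Z (nrm k K n y)} := fun y => 
        match y with
        | Sum.inl y => ⟨Sum.inl (y, ⟨_, hfr y⟩), by
            simp only [nrm, hZ]; simp; field_simp; ring⟩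
        | Sum.inr y => ⟨Sum.inr (Sum.inl ⟨_, hfr2⟩), by
            simp only [nrm, hZ]; simp; field_simp; ring⟩
    apply Nat.card_congr (Equiv.ofBijective f ?_)
    constructor
    · rintro (a | a) (b | b) h <;> simp [f] at h <;> simp [h]
    · rintro ⟨⟨a, ⟨b, hb⟩⟩ | ⟨y, hy'⟩ | y, hy⟩
      · simp only [nrm, hZ] at hy; simp at hy
        refine ⟨Sum.inl a, ?_⟩
        have : b = -((w 0 + w 1 * a.1) / w 2) := by field_simp; linear_combination hy
        subst this
        simp [f]
      · simp only [nrm, hZ] at hy; simp at hy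
        refine ⟨Sum.inr (), ?_⟩
        have : y = -(w 1 / w 2) := by field_simp; linear_combination hy
        subst this
        simp [f]
      · simp only [nrm, hZ] at hy; simp [h2] at hy

end rat
end T7

namespace T7
open Finset
set_option linter.unusedSectionVars false

theorem perm_zpow_mem {α : Type*} (e : Equiv.Perm α) (S : Set α) (h : e '' S = S) (i : ℤ) (x : α)
    (hx : x ∈ S) : (e ^ i) x ∈ S := by
  have h1 : ∀ y ∈ S, e y ∈ S := fun y hy => h ▸ Set.mem_image_of_mem e hy
  have h2 : ∀ y ∈ S, e⁻¹ y ∈ S := fun y hy => by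
    rw [← h] at hy
    obtain ⟨z, hz, rfl⟩ := hy
    simpa using hz
  induction i using Int.induction_on with
  | zero => simpa
  | succ n ih =>
    rw [add_comm, zpow_add, Equiv.Perm.mul_apply]
    simpa using h1 _ ih
  | pred n ih =>
    rw [sub_eq_add_neg, add_comm, zpow_add, Equiv.Perm.mul_apply]
    simpa using h2 _ ih

theorem perm_small_period {α : Type*} (e : Equiv.Perm α) (S : Set α) (h : e '' S = S) (hS : S.Finite)
    (hc : S.ncard = 7) (x : α) (hx : x ∈ S) : (e ^ 5040) x = x := by
  classical
  obtain ⟨i, hi, j, hj, hij, he⟩ := Finset.exists_ne_map_eq_of_card_lt_of_maps_to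
    (s := range 8) (t := hS.toFinset) (f := fun i => (e ^ i) x) (by
      rw [← Set.ncard_eq_toFinset_card S hS, hc]; simp) (by
      intro i _
      simpa using perm_zpow_mem e S h i x hx)
  simp only [Finset.mem_range] at hi hj
  have key : ∀ i j : ℕ, i < j → j < 8 → (e ^ i) x = (e ^ j) x → (e ^ 5040) x = x := by
    intro i j hij hj he
    have h1 : (e ^ (j - i)) x = x := by
      rw [show j = i + (j - i) by omega, pow_add, Equiv.Perm.mul_apply] at he
      exact ((e ^ i).injective he).symm
    have h2 : (j - i) ∣ 5040 := by
      have : 1 ≤ j - i := by omega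
      have : j - i ≤ 7 := by omega
      interval_cases (j - i) <;> decide
    obtain ⟨c, hc⟩ := h2
    rw [hc, pow_mul]
    exact Function.IsFixedPt.perm_pow h1 c
  rcases lt_or_gt_of_ne hij with h | h
  · exact key i j h hj he
  · exact key j i h hi he.symm

section ns
variable (k K : Type*) [Field k] [Fintype k] [Field K] [Algebra k K] [IsAlgClosed K]

/-- number of rational 7-sets stable under `g` -/
noncomputable def NS (g : Matrix.GeneralLinearGroup (Fin 3) k) : ℕ :=
  Nat.card {S : Set (PP K) // (S.Finite ∧ S.ncard = 7 ∧ pf k K '' S = S) ∧ ga k K g '' S = S}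

/-- big finite set -/
abbrev Om := {x : PP K // (pf k K ^ 5040) x = x}

theorem finite_Om : Finite (Om k K) := finite_fix k K 5040 (by norm_num)

theorem om_g (g : Matrix.GeneralLinearGroup (Fin 3) k) (x : PP K) :
    (pf k K ^ 5040) (ga k K g x) = ga k K g x ↔ (pf k K ^ 5040) x = x := by
  have h := (ga_pf k (K := K) g).pow_right 5040
  rw [← Equiv.Perm.mul_apply, ← h.eq, Equiv.Perm.mul_apply]
  exact (ga k K g).injective.eq_iff

theorem om_s (x : PP K) :
    (pf k K ^ 5040) (pf k K x) = pf k K x ↔ (pf k K ^ 5040) x = x := by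
  rw [← Equiv.Perm.mul_apply, ← pow_succ, pow_succ', Equiv.Perm.mul_apply]
  exact (pf k K).injective.eq_iff

/-- restricted `g` -/
noncomputable def gO (g : Matrix.GeneralLinearGroup (Fin 3) k) : Equiv.Perm (Om k K) :=
  (ga k K g).subtypePerm (om_g k K g)

/-- restricted Frobenius -/
noncomputable def sO : Equiv.Perm (Om k K) := (pf k K).subtypePerm (om_s k K)

theorem gO_val (g : Matrix.GeneralLinearGroup (Fin 3) k) (x : Om k K) : (gO k K g x).1 = ga k K g x.1 := rfl
theorem sO_val (x : Om k K) : (sO k K x).1 = pf k K x.1 := rfl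

theorem gO_pow_val (g : Matrix.GeneralLinearGroup (Fin 3) k) (i : ℕ) (x : Om k K) :
    ((gO k K g ^ i) x).1 = (ga k K g ^ i) x.1 := by
  unfold gO
  rw [Equiv.Perm.subtypePerm_pow]; rfl
theorem gO_zpow_val (g : Matrix.GeneralLinearGroup (Fin 3) k) (i : ℤ) (x : Om k K) :
    ((gO k K g ^ i) x).1 = (ga k K g ^ i) x.1 := by
  unfold gO
  rw [Equiv.Perm.subtypePerm_zpow]; rfl
theorem sO_pow_val (i : ℕ) (x : Om k K) :
    ((sO k K ^ i) x).1 = (pf k K ^ i) x.1 := by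
  unfold sO
  rw [Equiv.Perm.subtypePerm_pow]; rfl
theorem sO_zpow_val (i : ℤ) (x : Om k K) :
    ((sO k K ^ i) x).1 = (pf k K ^ i) x.1 := by
  unfold sO
  rw [Equiv.Perm.subtypePerm_zpow]; rfl

theorem gsO_comm (g : Matrix.GeneralLinearGroup (Fin 3) k) : Commute (gO k K g) (sO k K) := by
  ext x
  rw [Equiv.Perm.mul_apply, Equiv.Perm.mul_apply, gO_val, sO_val, sO_val, gO_val,
    ← Equiv.Perm.mul_apply, (ga_pf k g).eq, Equiv.Perm.mul_apply]

theorem fixc_eq (h3 : 3 ≤ Fintype.card k) (g : Matrix.GeneralLinearGroup (Fin 3) k) (d n j : ℕ)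
    (hn : 0 < n) (hdn : d * n ∣ 5040) :
    fixc (gO k K g) (sO k K) d n j = PC k K n (g ^ d) := by
  rw [← lang_points k h3 g d n j hn]
  unfold fixc
  refine Nat.card_congr (Equiv.ofBijective (fun x => ⟨x.1.1, ?_, ?_⟩) ⟨?_, ?_⟩)
  · rw [← gO_pow_val, x.2.1]
  · rw [← sO_pow_val, ← gO_pow_val, x.2.2]
  · intro x y h
    have h' := congrArg Subtype.val h
    exact Subtype.ext (Subtype.ext h')
  · rintro ⟨x, hx1, hx2⟩
    have hx : (pf k K ^ 5040) x = x := by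
      obtain ⟨c, hc⟩ := hdn
      have hcom : Commute (ga k K g ^ j) (pf k K ^ n) := (ga_pf k g).pow_pow j n
      have h1 : ∀ i : ℕ, ((pf k K ^ n) ^ i) x = ((ga k K g ^ j) ^ i) x := by
        intro i
        induction i with
        | zero => simp
        | succ i ih =>
          rw [pow_succ', Equiv.Perm.mul_apply, ih, ← Equiv.Perm.mul_apply, ← (hcom.pow_left i).eq,
            Equiv.Perm.mul_apply, hx2, ← Equiv.Perm.mul_apply, ← pow_succ]
      have h2 : (pf k K ^ (d * n)) x = x := by
        rw [mul_comm, pow_mul, h1, ← pow_mul, mul_comm, pow_mul]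
        exact Function.IsFixedPt.perm_pow hx1 j
      rw [hc, pow_mul]
      exact Function.IsFixedPt.perm_pow h2 c
    refine ⟨⟨⟨x, hx⟩, ?_, ?_⟩, rfl⟩
    · apply Subtype.ext; rw [gO_pow_val]; exact hx1
    · apply Subtype.ext; rw [gO_pow_val, sO_pow_val]; exact hx2

theorem NS_eq_stable (g : Matrix.GeneralLinearGroup (Fin 3) k) :
    NS k K g = Nat.card {S : Finset (Om k K) // S.card = 7 ∧
      ∀ x ∈ S, ∀ y, (ksetoid (gO k K g) (sO k K) (gsO_comm k K g)) x y → y ∈ S} := by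
  classical
  symm
  have sat : ∀ (S : Finset (Om k K)), (∀ x ∈ S, ∀ y, (ksetoid (gO k K g) (sO k K) (gsO_comm k K g)) x y → y ∈ S) →
      ∀ i j : ℤ, ∀ x ∈ S, (gO k K g ^ i) ((sO k K ^ j) x) ∈ S := by
    intro S hS i j x hx
    exact hS x hx _ ⟨i, j, rfl⟩
  unfold NS
  refine Nat.card_congr (Equiv.ofBijective (fun S => ⟨Subtype.val '' (S.1 : Set (Om k K)), ⟨?_, ?_, ?_⟩, ?_⟩) ⟨?_, ?_⟩)
  · exact (S.1.finite_toSet).image _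
  · rw [Set.ncard_image_of_injective _ Subtype.val_injective, Set.ncard_coe_finset, S.2.1]
  · have h1 := sat S.1 S.2.2
    ext y
    constructor
    · rintro ⟨_, ⟨x, hx, rfl⟩, rfl⟩
      exact ⟨sO k K x, by simpa using h1 0 1 x hx, rfl⟩
    · rintro ⟨x, hx, rfl⟩
      refine ⟨_, ⟨(sO k K)⁻¹ x, by simpa using h1 0 (-1) x hx, rfl⟩, ?_⟩
      rw [← sO_val]; simp
  · have h1 := sat S.1 S.2.2
    ext y
    constructor
    · rintro ⟨_, ⟨x, hx, rfl⟩, rfl⟩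
      exact ⟨gO k K g x, by simpa using h1 1 0 x hx, rfl⟩
    · rintro ⟨x, hx, rfl⟩
      refine ⟨_, ⟨(gO k K g)⁻¹ x, by simpa using h1 (-1) 0 x hx, rfl⟩, ?_⟩
      rw [← gO_val]; simp
  · intro S T h
    have h1 : Subtype.val '' (S.1 : Set (Om k K)) = Subtype.val '' (T.1 : Set (Om k K)) :=
      congrArg Subtype.val h
    exact Subtype.ext (Finset.coe_injective (Subtype.val_injective.image_injective h1))
  · rintro ⟨S, ⟨hS1, hS2, hS3⟩, hS4⟩
    have hfin := finite_Om k K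
    have hO : ∀ x ∈ S, (pf k K ^ 5040) x = x := fun x hx => perm_small_period _ S hS3 hS1 hS2 x hx
    let T : Set (Om k K) := Subtype.val ⁻¹' S
    have hT : Subtype.val '' T = S := by
      ext x
      constructor
      · rintro ⟨y, hy, rfl⟩
        exact hy
      · intro h
        exact ⟨⟨x, hO x h⟩, h, rfl⟩
    have hTf : T.Finite := Set.toFinite T
    refine ⟨⟨hTf.toFinset, ?_, ?_⟩, ?_⟩
    · rw [← Set.ncard_eq_toFinset_card T hTf, ← hS2, ← hT,
        Set.ncard_image_of_injective _ Subtype.val_injective]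
    · rintro x hx y ⟨i, j, rfl⟩
      rw [Set.Finite.mem_toFinset] at hx ⊢
      change ((gO k K g ^ i) ((sO k K ^ j) x)).1 ∈ S
      rw [gO_zpow_val, sO_zpow_val]
      exact perm_zpow_mem _ S hS4 i _ (perm_zpow_mem _ S hS3 j _ hx)
    · apply Subtype.ext
      simp only [Set.Finite.coe_toFinset]
      exact hT

/-- the class numbers in terms of the point counts -/
def NP (P : ℕ → ℕ → ℚ) : ℚ :=
  let n1 := P 1 1
  let n2 := (P 1 2 + 2 * P 2 1 - 3 * n1) / 2
  let n3 := (P 1 3 + 3 * P 3 1 - 4 * n1) / 3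
  let n4 := (P 1 4 + 2 * P 2 2 + 4 * P 4 1 - 6 * n2 - 7 * n1) / 4
  let n5 := (P 1 5 + 5 * P 5 1 - 6 * n1) / 5
  let n6 := (P 1 6 + 2 * P 2 3 + 3 * P 3 2 + 6 * P 6 1 - 9 * n3 - 8 * n2 - 12 * n1) / 6
  let n7 := (P 1 7 + 7 * P 7 1 - 8 * n1) / 7
  Phi n1 n2 n3 n4 n5 n6 n7

theorem NS_eq (h3 : 3 ≤ Fintype.card k) (g : Matrix.GeneralLinearGroup (Fin 3) k) :
    (NS k K g : ℚ) = NP (fun d n => (PC k K n (g ^ d) : ℚ)) := by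
  have hfin := finite_Om k K
  have : Fintype (Om k K) := Fintype.ofFinite _
  rw [NS_eq_stable, stable_sets]
  have H : ∀ N ∈ ({1,2,3,4,5,6,7} : Finset ℕ), ∑ d ∈ N.divisors, (d : ℚ) * PC k K (N / d) (g ^ d) =
      ∑ m ∈ N.divisors, (m : ℚ) * ncl (ksetoid (gO k K g) (sO k K) (gsO_comm k K g)) m * ∑ d ∈ (N / m).divisors, (d : ℚ) := by
    intro N hN
    have hN0 : 0 < N ∧ N ∣ 5040 := by
      simp only [Finset.mem_insert, Finset.mem_singleton] at hN
      rcases hN with rfl | rfl | rfl | rfl | rfl | rfl | rfl <;> exact ⟨by norm_num, by norm_num⟩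
    have h := lattice_count (gO k K g) (sO k K) (gsO_comm k K g) N hN0.1
    have h2 : ∑ d ∈ N.divisors, ∑ j ∈ range d, fixc (gO k K g) (sO k K) d (N/d) j =
        ∑ d ∈ N.divisors, d * PC k K (N / d) (g ^ d) := by
      refine Finset.sum_congr rfl fun d hd => ?_
      have hd' := Nat.dvd_of_mem_divisors hd
      rw [Finset.sum_congr rfl fun j _ => fixc_eq k K h3 g d (N/d) j
        (Nat.div_pos (Nat.le_of_dvd hN0.1 hd') (Nat.pos_of_mem_divisors hd))
        (by rw [Nat.mul_div_cancel' hd']; exact hN0.2)]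
      simp
    rw [h2] at h
    have h' := congrArg (Nat.cast : ℕ → ℚ) h
    push_cast at h'
    exact h'
  have d1 : Nat.divisors 1 = {1} := by decide
  have d2 : Nat.divisors 2 = {1,2} := by decide
  have d3 : Nat.divisors 3 = {1,3} := by decide
  have d4 : Nat.divisors 4 = {1,2,4} := by decide
  have d5 : Nat.divisors 5 = {1,5} := by decide
  have d6 : Nat.divisors 6 = {1,2,3,6} := by decide
  have d7 : Nat.divisors 7 = {1,7} := by decide
  have h1 := H 1 (by simp)
  have h2 := H 2 (by simp)
  have h3 := H 3 (by simp)
  have h4 := H 4 (by simp)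
  have h5 := H 5 (by simp)
  have h6 := H 6 (by simp)
  have h7 := H 7 (by simp)
  norm_num [d1, d2, d3, d4, d5, d6, d7] at h1 h2 h3 h4 h5 h6 h7
  have h1' := congrArg (Nat.cast : ℕ → ℚ) h1
  unfold NP
  simp only [pow_one]
  congr 1
  · linarith
  · linarith
  · linarith
  · linarith
  · linarith
  · linarith
  · linarith

end ns
end T7

namespace T7
open Finset
set_option linter.unusedSectionVars false

section burn
variable (k : Type*) [Field k] [Fintype k]

theorem projFrob_eq : projFrob k 3 = pf k (AlgebraicClosure k) := by
  funext P
  have h := pf_pow_mk k (K := AlgebraicClosure k) 1 P.rep P.rep_nonzero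
  rw [pow_one, Projectivization.mk_rep] at h
  rw [h]
  unfold projFrob
  congr 1
  funext i
  rw [pow_one]

theorem projGamma_eq (g : Matrix.GeneralLinearGroup (Fin 3) k) :
    projGamma k 3 g = ga k (AlgebraicClosure k) g := by
  funext P
  have h := ga_mk k (K := AlgebraicClosure k) g P.rep P.rep_nonzero
  rw [Projectivization.mk_rep] at h
  rw [h]
  rfl

/-- rational 7-sets -/
structure RS where
  car : Set (PP (AlgebraicClosure k))
  prop : car.Finite ∧ car.ncard = 7 ∧ pf k (AlgebraicClosure k) '' car = car

theorem RS.inj : Function.Injective (RS.car (k := k)) := by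
  rintro ⟨S, hS⟩ ⟨T, hT⟩ h
  simp only at h
  subst h
  rfl

noncomputable instance : MulAction (Matrix.GeneralLinearGroup (Fin 3) k) (RS k) where
  smul g S := ⟨ga k (AlgebraicClosure k) g '' S.car, S.prop.1.image _, by
    rw [Set.ncard_image_of_injective _ (Equiv.injective _), S.prop.2.1], by
    have h : ∀ x, pf k (AlgebraicClosure k) (ga k (AlgebraicClosure k) g x) = ga k (AlgebraicClosure k) g (pf k (AlgebraicClosure k) x) := by
      intro x
      rw [← Equiv.Perm.mul_apply, ← (ga_pf k g).eq, Equiv.Perm.mul_apply]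
    rw [← Set.image_comp]
    conv_rhs => rw [← S.prop.2.2, ← Set.image_comp]
    congr 1
    funext x
    exact h x⟩
  one_smul S := RS.inj k (by
    change ga k (AlgebraicClosure k) 1 '' S.car = S.car
    rw [map_one]; simp)
  mul_smul g h S := RS.inj k (by
    change ga k (AlgebraicClosure k) (g * h) '' S.car = ga k (AlgebraicClosure k) g '' (ga k (AlgebraicClosure k) h '' S.car)
    rw [map_mul, ← Set.image_comp]; rfl)

theorem RS_smul_val (g : Matrix.GeneralLinearGroup (Fin 3) k) (S : RS k) :
    (g • S).car = ga k (AlgebraicClosure k) g '' S.car := rfl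

theorem finite_RS : Finite (RS k) := by
  have hfin := finite_Om k (AlgebraicClosure k)
  refine Finite.of_injective (β := Set (Om k (AlgebraicClosure k))) (fun S : RS k => Subtype.val ⁻¹' S.car) ?_
  intro S T h
  have h' : (Subtype.val ⁻¹' S.car : Set (Om k (AlgebraicClosure k))) = Subtype.val ⁻¹' T.car := h
  have key : ∀ S : RS k, ∀ x ∈ S.car, (pf k (AlgebraicClosure k) ^ 5040) x = x :=
    fun S x hx => perm_small_period _ S.car S.prop.2.2 S.prop.1 S.prop.2.1 x hx
  apply RS.inj
  ext x
  constructor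
  · intro hx
    have : (⟨x, key S x hx⟩ : Om k (AlgebraicClosure k)) ∈ (Subtype.val ⁻¹' T.car : Set (Om k (AlgebraicClosure k))) := by
      rw [← h']; exact hx
    exact this
  · intro hx
    have : (⟨x, key T x hx⟩ : Om k (AlgebraicClosure k)) ∈ (Subtype.val ⁻¹' S.car : Set (Om k (AlgebraicClosure k))) := by
      rw [h']; exact hx
    exact this

theorem t2seven_orbits :
    t2seven k = Nat.card (MulAction.orbitRel.Quotient (Matrix.GeneralLinearGroup (Fin 3) k) (RS k)) := by
  unfold t2seven
  rw [projFrob_eq]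
  simp only [projGamma_eq]
  have hinj : ∀ S T : RS k, MulAction.orbit (Matrix.GeneralLinearGroup (Fin 3) k) S =
      MulAction.orbit (Matrix.GeneralLinearGroup (Fin 3) k) T ↔
      {A | ∃ g : Matrix.GeneralLinearGroup (Fin 3) k, A = ga k (AlgebraicClosure k) g '' S.car} = 
      {A | ∃ g : Matrix.GeneralLinearGroup (Fin 3) k, A = ga k (AlgebraicClosure k) g '' T.car} := by
    intro S T
    have e : ∀ S : RS k, {A | ∃ g : Matrix.GeneralLinearGroup (Fin 3) k, A = ga k (AlgebraicClosure k) g '' S.car} =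
        RS.car '' (MulAction.orbit (Matrix.GeneralLinearGroup (Fin 3) k) S) := by
      intro S
      ext A
      constructor
      · rintro ⟨g, rfl⟩
        exact ⟨g • S, ⟨g, rfl⟩, rfl⟩
      · rintro ⟨_, ⟨g, rfl⟩, rfl⟩
        exact ⟨g, rfl⟩
    rw [e, e]
    exact ((RS.inj k).image_injective.eq_iff).symm
  rw [← Nat.card_coe_set_eq]
  symm
  refine Nat.card_congr (Equiv.ofBijective (Quotient.lift (fun S : RS k => ⟨_, S.car, S.prop, rfl⟩) ?_) ⟨?_, ?_⟩)
  · intro S T h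
    apply Subtype.ext
    apply (hinj S T).1
    exact MulAction.orbit_eq_iff.2 h
  · intro a b
    refine Quotient.inductionOn₂ a b ?_
    intro S T h
    apply Quotient.sound
    apply MulAction.orbit_eq_iff.1
    apply (hinj S T).2
    exact congrArg Subtype.val h
  · rintro ⟨O, S, hS, rfl⟩
    exact ⟨Quotient.mk _ ⟨S, hS⟩, rfl⟩

theorem burnside [DecidableEq k] :
    t2seven k * Fintype.card (Matrix.GeneralLinearGroup (Fin 3) k) =
      ∑ g : Matrix.GeneralLinearGroup (Fin 3) k, NS k (AlgebraicClosure k) g := by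
  classical
  have hfin := finite_RS k
  have : Fintype (RS k) := Fintype.ofFinite _
  have h := MulAction.sum_card_fixedBy_eq_card_orbits_mul_card_group
    (Matrix.GeneralLinearGroup (Fin 3) k) (RS k)
  rw [t2seven_orbits, Nat.card_eq_fintype_card, ← h]
  refine Finset.sum_congr rfl fun g _ => ?_
  rw [← Nat.card_eq_fintype_card]
  unfold NS
  refine Nat.card_congr (Equiv.ofBijective (fun S => ⟨S.1.car, S.1.prop, ?_⟩) ⟨?_, ?_⟩)
  · have := S.2
    rw [MulAction.mem_fixedBy] at this
    exact congrArg RS.car this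
  · intro S T h
    have h' := congrArg Subtype.val h
    exact Subtype.ext (RS.inj k h')
  · rintro ⟨S, hS, h⟩
    exact ⟨⟨⟨S, hS⟩, RS.inj k h⟩, rfl⟩

end burn
end T7

namespace T7
open Finset
set_option linter.unusedSectionVars false

section pcs
variable (k K : Type*) [Field k] [Fintype k] [Field K] [Algebra k K] [IsAlgClosed K]

/-- eigenvector condition -/
def eig (h : Matrix (Fin 3) (Fin 3) k) (v : Fin 3 → K) : Prop :=
  ∃ l : K, (h.map (algebraMap k K)).mulVec v = l • v

variable {k K}
theorem ga_fix_iff (h : Matrix.GeneralLinearGroup (Fin 3) k) (v : Fin 3 → K) (hv : v ≠ 0) :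
    ga k K h (Projectivization.mk K v hv) = Projectivization.mk K v hv ↔ eig k K h.val v := by
  rw [ga_mk, Projectivization.mk_eq_mk_iff']
  constructor
  · rintro ⟨a, ha⟩
    exact ⟨a, ha.symm⟩
  · rintro ⟨a, ha⟩
    exact ⟨a, ha.symm⟩

variable (k K)
theorem PC_conj (n : ℕ) (b h : Matrix.GeneralLinearGroup (Fin 3) k) :
    PC k K n (b * h * b⁻¹) = PC k K n h := by
  symm
  unfold PC
  refine Nat.card_congr ((ga k K b).subtypeEquiv ?_)
  intro x
  have e2 : (pf k K ^ n) (ga k K b x) = ga k K b ((pf k K ^ n) x) := by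
    rw [← Equiv.Perm.mul_apply, ← ((ga_pf k b).pow_right n).eq, Equiv.Perm.mul_apply]
  rw [e2, map_mul, map_mul, map_inv]
  simp

theorem NS_conj (h3 : 3 ≤ Fintype.card k) (b h : Matrix.GeneralLinearGroup (Fin 3) k) :
    NS k K (b * h * b⁻¹) = NS k K h := by
  have : (NS k K (b * h * b⁻¹) : ℚ) = NS k K h := by
    rw [NS_eq k K h3, NS_eq k K h3]
    congr 1
    funext d n
    rw [conj_pow, PC_conj]
  exact_mod_cast this

variable {k K}
theorem PC_all (n : ℕ) (hn : 0 < n) (h : Matrix.GeneralLinearGroup (Fin 3) k)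
    (H : ∀ v : Fin 3 → K, eig k K h.val v) :
    PC k K n h = (Fintype.card k ^ n) ^ 2 + Fintype.card k ^ n + 1 := by
  unfold PC
  apply rat_all k K n hn
  intro x
  induction x using Projectivization.ind with
  | h v hv => rw [ga_fix_iff]; exact H v

theorem PC_line (n : ℕ) (hn : 0 < n) (h : Matrix.GeneralLinearGroup (Fin 3) k) (w : Fin 3 → K)
    (hw : ∀ i, w i ^ (Fintype.card k ^ n) = w i) (hw0 : w ≠ 0)
    (H : ∀ v : Fin 3 → K, v ≠ 0 → (eig k K h.val v ↔ w 0 * v 0 + w 1 * v 1 + w 2 * v 2 = 0)) :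
    PC k K n h = Fintype.card k ^ n + 1 := by
  unfold PC
  apply rat_line k K n hn w hw hw0
  intro v hv
  rw [ga_fix_iff]; exact H v hv

theorem PC_line_pt (n : ℕ) (hn : 0 < n) (h : Matrix.GeneralLinearGroup (Fin 3) k) (w u : Fin 3 → K)
    (hw : ∀ i, w i ^ (Fintype.card k ^ n) = w i) (hu : ∀ i, u i ^ (Fintype.card k ^ n) = u i)
    (hwu : w 0 * u 0 + w 1 * u 1 + w 2 * u 2 ≠ 0)
    (H : ∀ v : Fin 3 → K, v ≠ 0 → (eig k K h.val v ↔ w 0 * v 0 + w 1 * v 1 + w 2 * v 2 = 0 ∨ ∃ m : K, v = m • u)) :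
    PC k K n h = Fintype.card k ^ n + 2 := by
  classical
  have hfin := finite_fix k K n hn
  have hw0 : w ≠ 0 := by rintro rfl; simp at hwu
  have hu0 : u ≠ 0 := by rintro rfl; simp at hwu
  let Z : PP K → Prop := fun x => w 0 * x.rep 0 + w 1 * x.rep 1 + w 2 * x.rep 2 = 0
  have hZ : ∀ v hv, Z (Projectivization.mk K v hv) ↔ w 0 * v 0 + w 1 * v 1 + w 2 * v 2 = 0 := by
    intro v hv
    obtain ⟨a, ha⟩ := Projectivization.exists_smul_eq_mk_rep K v hv
    simp only [Z, ← ha]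
    simp only [Pi.smul_apply, Units.smul_def, smul_eq_mul]
    rw [show w 0 * (a * v 0) + w 1 * (a * v 1) + w 2 * (a * v 2) = a * (w 0 * v 0 + w 1 * v 1 + w 2 * v 2) by ring]
    simp
  have hline := rat_line k K n hn w hw hw0 Z hZ
  have hset : {x : PP K | ga k K h x = x ∧ (pf k K ^ n) x = x} =
      insert (Projectivization.mk K u hu0) {x | Z x ∧ (pf k K ^ n) x = x} := by
    ext x
    induction x using Projectivization.ind with
    | h v hv =>
    simp only [Set.mem_ofPred_eq, Set.mem_insert_iff]
    rw [ga_fix_iff, H v hv, hZ, Projectivization.mk_eq_mk_iff']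
    constructor
    · rintro ⟨h1 | ⟨m, rfl⟩, h2⟩
      · exact Or.inr ⟨h1, h2⟩
      · exact Or.inl ⟨m, rfl⟩
    · rintro (⟨m, rfl⟩ | ⟨h1, h2⟩)
      · refine ⟨Or.inr ⟨m, rfl⟩, ?_⟩
        rw [pf_pow_mk, Projectivization.mk_eq_mk_iff']
        have hm : m ≠ 0 := by rintro rfl; simp at hv
        refine ⟨m ^ (Fintype.card k ^ n) / m, ?_⟩
        funext i
        simp only [Pi.smul_apply, smul_eq_mul, mul_pow, hu]
        field_simp
      · exact ⟨Or.inl h1, h2⟩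
  have hc : PC k K n h = Set.ncard {x : PP K | ga k K h x = x ∧ (pf k K ^ n) x = x} := rfl
  have hF : Finite {x : PP K | Z x ∧ (pf k K ^ n) x = x} :=
      Finite.of_injective (fun x => (⟨x.1, x.2.2⟩ : {x : PP K // (pf k K ^ n) x = x}))
        (fun x y h => Subtype.ext (congrArg (fun z => z.1) h))
  rw [hc, hset, Set.ncard_insert_of_notMem (fun hx => hwu ((hZ u hu0).1 hx.1)) (Set.toFinite _)]
  have : Set.ncard {x | Z x ∧ (pf k K ^ n) x = x} = Fintype.card k ^ n + 1 := hline
  rw [this]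

/-- the fixed points are a finite explicit set -/
theorem PC_set (n : ℕ) (h : Matrix.GeneralLinearGroup (Fin 3) k) (T : Set (PP K))
    (H : ∀ v : Fin 3 → K, (hv : v ≠ 0) → (eig k K h.val v ↔ Projectivization.mk K v hv ∈ T)) :
    PC k K n h = Set.ncard {x | x ∈ T ∧ (pf k K ^ n) x = x} := by
  unfold PC
  rw [← Nat.card_coe_set_eq]
  refine Nat.card_congr (Equiv.subtypeEquivRight fun x => ?_)
  induction x using Projectivization.ind with
  | h v hv => rw [ga_fix_iff, H v hv]; rfl

theorem alg_fix (n : ℕ) (a : k) : (algebraMap k K a) ^ (Fintype.card k ^ n) = algebraMap k K a := by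
  rw [← frn_apply k K n, AlgHom.commutes]

theorem fix_alg (a : K) (h : a ^ Fintype.card k = a) : ∃ b : k, algebraMap k K b = a := by
  classical
  obtain ⟨s, hs, hs'⟩ := frn_root_finset k K 1 (by norm_num)
  have h1 : (Finset.univ.image (algebraMap k K)) = s := by
    apply Finset.eq_of_subset_of_card_le
    · intro x hx
      obtain ⟨b, -, rfl⟩ := Finset.mem_image.1 hx
      exact (hs' _).2 (alg_fix 1 b)
    · rw [hs, Finset.card_image_of_injective _ (algebraMap k K).injective, Finset.card_univ, pow_one]
  have : a ∈ s := (hs' a).2 (by rwa [pow_one])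
  rw [← h1] at this
  obtain ⟨b, -, hb⟩ := Finset.mem_image.1 this
  exact ⟨b, hb⟩

end pcs
end T7

namespace T7
open Finset
set_option linter.unusedSectionVars false

section bas
variable {K : Type*} [Field K]

/-- determinant of three vectors -/
def d3 (u v w : Fin 3 → K) : K := u 0 * (v 1 * w 2 - v 2 * w 1) - u 1 * (v 0 * w 2 - v 2 * w 0) +
  u 2 * (v 0 * w 1 - v 1 * w 0)

theorem d3_span (u v w : Fin 3 → K) (h : d3 u v w ≠ 0) (t : Fin 3 → K) :
    ∃ x y z : K, t = x • u + y • v + z • w := by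
  refine ⟨d3 t v w / d3 u v w, d3 u t w / d3 u v w, d3 u v t / d3 u v w, ?_⟩
  funext i
  simp only [Pi.add_apply, Pi.smul_apply, smul_eq_mul]
  field_simp
  fin_cases i <;> simp [d3] <;> ring

theorem d3_indep (u v w : Fin 3 → K) (h : d3 u v w ≠ 0) (x y z x' y' z' : K) :
    x • u + y • v + z • w = x' • u + y' • v + z' • w ↔ x = x' ∧ y = y' ∧ z = z' := by
  constructor
  · intro e
    have e0 := congrFun e 0
    have e1 := congrFun e 1
    have e2 := congrFun e 2
    simp only [Pi.add_apply, Pi.smul_apply, smul_eq_mul] at e0 e1 e2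
    refine ⟨?_, ?_, ?_⟩ <;> apply sub_eq_zero.1 <;> apply (mul_eq_zero.1 _).resolve_right h <;> unfold d3
    · linear_combination (v 1 * w 2 - v 2 * w 1) * e0 - (v 0 * w 2 - v 2 * w 0) * e1 + (v 0 * w 1 - v 1 * w 0) * e2
    · linear_combination -(u 1 * w 2 - u 2 * w 1) * e0 + (u 0 * w 2 - u 2 * w 0) * e1 - (u 0 * w 1 - u 1 * w 0) * e2
    · linear_combination (u 1 * v 2 - u 2 * v 1) * e0 - (u 0 * v 2 - u 2 * v 0) * e1 + (u 0 * v 1 - u 1 * v 0) * e2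
  · rintro ⟨rfl, rfl, rfl⟩; rfl

end bas

section comp
variable {k K : Type*} [Field k] [Fintype k] [Field K] [Algebra k K] [IsAlgClosed K]

/-- companion matrix -/
def cm (c : Fin 3 → k) : Matrix (Fin 3) (Fin 3) k := !![0,1,0;0,0,1;c 0,c 1,c 2]

theorem cm_det (c : Fin 3 → k) : (cm c).det = c 0 := by
  simp [cm, Matrix.det_fin_three]

/-- `c` has the roots `α β γ` in `K` -/
def isE (c : Fin 3 → k) (α β γ : K) : Prop :=
  algebraMap k K (c 0) = α * β * γ ∧ algebraMap k K (c 1) = -(α*β+β*γ+α*γ) ∧ algebraMap k K (c 2) = α+β+γ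

/-- vandermonde vector -/
def vd (x : K) : Fin 3 → K := ![1, x, x^2]
def vd1 (x : K) : Fin 3 → K := ![0, 1, 2*x]
def vd2 (_ : K) : Fin 3 → K := ![0, 0, 1]

theorem vd_ne (x : K) : vd x ≠ 0 := fun h => by simpa [vd] using congrFun h 0

theorem cm_vd (c : Fin 3 → k) (α β γ : K) (hE : isE c α β γ) :
    ((cm c).map (algebraMap k K)).mulVec (vd α) = α • vd α := by
  obtain ⟨h0, h1, h2⟩ := hE
  funext i
  fin_cases i <;> simp [cm, vd, Matrix.mulVec, dotProduct, Fin.sum_univ_three]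
  · ring
  · rw [h0, h1, h2]; ring

theorem cm_vd1 (c : Fin 3 → k) (α γ : K) (hE : isE c α α γ) :
    ((cm c).map (algebraMap k K)).mulVec (vd1 α) = α • vd1 α + vd α := by
  obtain ⟨h0, h1, h2⟩ := hE
  funext i
  fin_cases i <;> simp [cm, vd, vd1, Matrix.mulVec, dotProduct, Fin.sum_univ_three]
  · ring
  · rw [h1, h2]; ring

theorem cm_vd2 (c : Fin 3 → k) (α : K) (hE : isE c α α α) :
    ((cm c).map (algebraMap k K)).mulVec (vd2 α) = α • vd2 α + vd1 α := by
  obtain ⟨h0, h1, h2⟩ := hE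
  funext i
  fin_cases i <;> simp [cm, vd1, vd2, Matrix.mulVec, dotProduct, Fin.sum_univ_three]
  · rw [h2]; ring

theorem isE_rot {c : Fin 3 → k} {α β γ : K} (h : isE c α β γ) : isE c β γ α := by
  obtain ⟨h0, h1, h2⟩ := h
  exact ⟨by rw [h0]; ring, by rw [h1]; ring, by rw [h2]; ring⟩

theorem isE_swap {c : Fin 3 → k} {α β γ : K} (h : isE c α β γ) : isE c β α γ := by
  obtain ⟨h0, h1, h2⟩ := h
  exact ⟨by rw [h0]; ring, by rw [h1]; ring, by rw [h2]; ring⟩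

theorem pow_mv (M : Matrix (Fin 3) (Fin 3) K) (v : Fin 3 → K) (l : K) (h : M.mulVec v = l • v) (d : ℕ) :
    (M^d).mulVec v = l^d • v := by
  induction d with
  | zero => simp
  | succ d ih => rw [pow_succ, ← Matrix.mulVec_mulVec, h, Matrix.mulVec_smul, ih, smul_smul]; ring_nf

theorem pow_mv1 (M : Matrix (Fin 3) (Fin 3) K) (v v1 : Fin 3 → K) (l : K) (h : M.mulVec v = l • v)
    (h1 : M.mulVec v1 = l • v1 + v) (d : ℕ) :
    (M^(d+1)).mulVec v1 = l^(d+1) • v1 + ((d+1 : ℕ) * l^d) • v := by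
  induction d with
  | zero => simp [h1]
  | succ d ih =>
    rw [pow_succ, ← Matrix.mulVec_mulVec, h1, Matrix.mulVec_add, Matrix.mulVec_smul, ih, pow_mv M v l h]
    funext i
    simp only [Pi.add_apply, Pi.smul_apply, smul_eq_mul]
    push_cast
    ring

theorem pow_mv2 (M : Matrix (Fin 3) (Fin 3) K) (v v1 v2 : Fin 3 → K) (l : K) (h : M.mulVec v = l • v)
    (h1 : M.mulVec v1 = l • v1 + v) (h2 : M.mulVec v2 = l • v2 + v1) (d : ℕ) : ∃ r : K, 
    (M^(d+1)).mulVec v2 = l^(d+1) • v2 + ((d+1 : ℕ) * l^d) • v1 + r • v ∧ 2 * l * r = (d+1 : ℕ) * d * l^d := by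
  induction d with
  | zero => exact ⟨0, by simp [h2], by simp⟩
  | succ d ih =>
    obtain ⟨r, ih, hr⟩ := ih
    refine ⟨l * r + (d+1 : ℕ) * l^d, ?_, ?_⟩
    · rw [pow_succ, ← Matrix.mulVec_mulVec, h2, Matrix.mulVec_add, Matrix.mulVec_smul, ih, pow_mv1 M v v1 l h h1]
      funext i
      simp only [Pi.add_apply, Pi.smul_apply, smul_eq_mul]
      push_cast
      ring
    · push_cast at hr ⊢
      linear_combination l * hr

theorem map_pow3 (M : Matrix (Fin 3) (Fin 3) k) (d : ℕ) :
    (M^d).map (algebraMap k K) = (M.map (algebraMap k K))^d := by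
  have := map_pow (algebraMap k K).mapMatrix M d
  simpa using this

/-- eigenvectors, distinct roots -/
theorem eig_dist (c : Fin 3 → k) (α β γ : K) (hE : isE c α β γ) (d : ℕ) (x y z : K)
    (h12 : α ≠ β) (h23 : β ≠ γ) (h13 : α ≠ γ) :
    eig k K (cm c ^ d) (x • vd α + y • vd β + z • vd γ) ↔
      ∃ l, x * (α^d - l) = 0 ∧ y * (β^d - l) = 0 ∧ z * (γ^d - l) = 0 := by
  have hd : d3 (vd α) (vd β) (vd γ) ≠ 0 := by
    have : d3 (vd α) (vd β) (vd γ) = (β - α) * (γ - β) * (γ - α) := by simp [d3, vd]; ring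
    rw [this]
    exact mul_ne_zero (mul_ne_zero (sub_ne_zero.2 h12.symm) (sub_ne_zero.2 h23.symm)) (sub_ne_zero.2 h13.symm)
  unfold eig
  refine exists_congr fun l => ?_
  rw [map_pow3, Matrix.mulVec_add, Matrix.mulVec_add, Matrix.mulVec_smul, Matrix.mulVec_smul, Matrix.mulVec_smul,
    pow_mv _ _ _ (cm_vd c α β γ hE), pow_mv _ _ _ (cm_vd c β γ α (isE_rot hE)),
    pow_mv _ _ _ (cm_vd c γ α β (isE_rot (isE_rot hE))), smul_add, smul_add, smul_smul, smul_smul, smul_smul,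
    smul_smul, smul_smul, smul_smul, d3_indep _ _ _ hd, ← sub_eq_zero, ← sub_eq_zero (a := y * _), ← sub_eq_zero (a := z * _)]
  ring_nf

theorem eig_dbl (c : Fin 3 → k) (α γ : K) (hE : isE c α α γ) (d : ℕ) (x y z : K)
    (h13 : α ≠ γ) :
    eig k K (cm c ^ (d+1)) (x • vd α + y • vd1 α + z • vd γ) ↔
      ∃ l, x * (α^(d+1) - l) + y * ((d+1:ℕ) * α^d) = 0 ∧ y * (α^(d+1) - l) = 0 ∧ z * (γ^(d+1) - l) = 0 := by
  have hd : d3 (vd α) (vd1 α) (vd γ) ≠ 0 := by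
    have : d3 (vd α) (vd1 α) (vd γ) = (γ - α) * (γ - α) := by simp [d3, vd, vd1]; ring
    rw [this]
    exact (mul_ne_zero (sub_ne_zero.2 h13.symm) (sub_ne_zero.2 h13.symm))
  unfold eig
  refine exists_congr fun l => ?_
  rw [map_pow3, Matrix.mulVec_add, Matrix.mulVec_add, Matrix.mulVec_smul, Matrix.mulVec_smul, Matrix.mulVec_smul,
    pow_mv _ _ _ (cm_vd c α α γ hE), pow_mv1 _ _ _ _ (cm_vd c α α γ hE) (cm_vd1 c α γ hE),
    pow_mv _ _ _ (cm_vd c γ α α (isE_rot (isE_rot hE)))]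
  have e1 : x • α ^ (d + 1) • vd α + y • (α ^ (d + 1) • vd1 α + (((d + 1 : ℕ) : K) * α ^ d) • vd α) + z • γ ^ (d + 1) • vd γ
    = (x * α^(d+1) + y * ((d+1 : ℕ) * α^d)) • vd α + (y * α^(d+1)) • vd1 α + (z * γ^(d+1)) • vd γ := by module
  have e2 : l • (x • vd α + y • vd1 α + z • vd γ) = (l * x) • vd α + (l * y) • vd1 α + (l*z) • vd γ := by module
  rw [e1, e2, d3_indep _ _ _ hd, ← sub_eq_zero, ← sub_eq_zero (a := y * _), ← sub_eq_zero (a := z * _)]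
  ring_nf

theorem eig_tri (c : Fin 3 → k) (α : K) (hE : isE c α α α) (d : ℕ) : ∃ r : K, 
     2 * α * r = (d+1 : ℕ) * d * α^d ∧ ∀ x y z : K, (
    eig k K (cm c ^ (d+1)) (x • vd α + y • vd1 α + z • vd2 α) ↔
      ∃ l, x * (α^(d+1) - l) + y * ((d+1:ℕ) * α^d) + z * r = 0 ∧ y * (α^(d+1) - l) + z * ((d+1:ℕ) * α^d) = 0 ∧ z * (α^(d+1) - l) = 0) := by
  have hd : d3 (vd α) (vd1 α) (vd2 α) ≠ 0 := by
    have : d3 (vd α) (vd1 α) (vd2 α) = 1 := by simp [d3, vd, vd1, vd2]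
    rw [this]; exact one_ne_zero
  obtain ⟨r, hr, hr'⟩ := pow_mv2 _ _ _ _ _ (cm_vd c α α α hE) (cm_vd1 c α α hE) (cm_vd2 c α hE) d
  refine ⟨r, hr', fun x y z => ?_⟩
  unfold eig
  refine exists_congr fun l => ?_
  rw [map_pow3, Matrix.mulVec_add, Matrix.mulVec_add, Matrix.mulVec_smul, Matrix.mulVec_smul, Matrix.mulVec_smul,
    pow_mv _ _ _ (cm_vd c α α α hE), pow_mv1 _ _ _ _ (cm_vd c α α α hE) (cm_vd1 c α α hE), hr]
  have e1 : x • α ^ (d + 1) • vd α + y • (α ^ (d + 1) • vd1 α + (((d + 1 : ℕ) : K) * α ^ d) • vd α) + 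
      z • (α ^ (d + 1) • vd2 α + (((d + 1 : ℕ) : K) * α ^ d) • vd1 α + r • vd α)
    = (x * α^(d+1) + y * ((d+1 : ℕ) * α^d) + z * r) • vd α + (y * α^(d+1) + z * ((d+1:ℕ) * α^d)) • vd1 α + (z * α^(d+1)) • vd2 α := by module
  have e2 : l • (x • vd α + y • vd1 α + z • vd2 α) = (l * x) • vd α + (l * y) • vd1 α + (l*z) • vd2 α := by module
  rw [e1, e2, d3_indep _ _ _ hd, ← sub_eq_zero, ← sub_eq_zero (a := y * _ + _), ← sub_eq_zero (a := z * _)]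
  ring_nf

end comp
end T7

namespace T7
open Finset
set_option linter.unusedSectionVars false

section comp
variable {k K : Type*} [Field k] [Fintype k] [Field K] [Algebra k K] [IsAlgClosed K]

theorem isE_root {c : Fin 3 → k} {α β γ : K} (h : isE c α β γ) (n : ℕ) :
    α ^ (Fintype.card k ^ n) = α ∨ α ^ (Fintype.card k ^ n) = β ∨ α ^ (Fintype.card k ^ n) = γ := by
  obtain ⟨h0, h1, h2⟩ := h
  have e : α^3 = algebraMap k K (c 2) * α^2 + algebraMap k K (c 1) * α + algebraMap k K (c 0) := by
    rw [h0, h1, h2]; ring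
  have e2 := congrArg (frn k K n) e
  simp only [map_add, map_mul, map_pow, AlgHom.commutes, frn_apply] at e2
  set x := α ^ (Fintype.card k ^ n)
  have : (x - α) * ((x - β) * (x - γ)) = 0 := by
    rw [h0, h1, h2] at e2
    linear_combination e2
  rcases mul_eq_zero.1 this with h | h
  · exact Or.inl (sub_eq_zero.1 h)
  rcases mul_eq_zero.1 h with h | h
  · exact Or.inr (Or.inl (sub_eq_zero.1 h))
  · exact Or.inr (Or.inr (sub_eq_zero.1 h))

theorem frn_inj (n : ℕ) {x y : K} (h : x ^ (Fintype.card k ^ n) = y ^ (Fintype.card k ^ n)) : x = y := by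
  rw [← frn_apply k K n, ← frn_apply k K n] at h
  exact (frn k K n).toRingHom.injective h

theorem fix_add (n : ℕ) {x y : K} (hx : x ^ (Fintype.card k ^ n) = x) (hy : y ^ (Fintype.card k ^ n) = y) :
    (x + y) ^ (Fintype.card k ^ n) = x + y := by
  rw [← frn_apply k K n] at *; rw [map_add, hx, hy]

theorem fix_neg (n : ℕ) {x : K} (hx : x ^ (Fintype.card k ^ n) = x) :
    (-x) ^ (Fintype.card k ^ n) = -x := by
  rw [← frn_apply k K n] at *; rw [map_neg, hx]

theorem fix_sub (n : ℕ) {x y : K} (hx : x ^ (Fintype.card k ^ n) = x) (hy : y ^ (Fintype.card k ^ n) = y) :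
    (x - y) ^ (Fintype.card k ^ n) = x - y := by
  rw [← frn_apply k K n] at *; rw [map_sub, hx, hy]

theorem fix_mul (n : ℕ) {x y : K} (hx : x ^ (Fintype.card k ^ n) = x) (hy : y ^ (Fintype.card k ^ n) = y) :
    (x * y) ^ (Fintype.card k ^ n) = x * y := by
  rw [mul_pow, hx, hy]

theorem d3_vd (α β γ : K) (h12 : α ≠ β) (h23 : β ≠ γ) (h13 : α ≠ γ) : d3 (vd α) (vd β) (vd γ) ≠ 0 := by
  have : d3 (vd α) (vd β) (vd γ) = (β - α) * (γ - β) * (γ - α) := by simp [d3, vd]; ring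
  rw [this]
  exact mul_ne_zero (mul_ne_zero (sub_ne_zero.2 h12.symm) (sub_ne_zero.2 h23.symm)) (sub_ne_zero.2 h13.symm)

theorem PC_dist_all (c : Fin 3 → k) (g : Matrix.GeneralLinearGroup (Fin 3) k) (hg : g.val = cm c)
    (α β γ : K) (hE : isE c α β γ) (h12 : α ≠ β) (h23 : β ≠ γ) (h13 : α ≠ γ) (d n : ℕ) (hn : 0 < n)
    (e1 : α^d = β^d) (e2 : β^d = γ^d) :
    PC k K n (g^d) = (Fintype.card k ^ n)^2 + Fintype.card k ^ n + 1 := by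
  apply PC_all n hn
  intro v
  obtain ⟨x, y, z, rfl⟩ := d3_span _ _ _ (d3_vd α β γ h12 h23 h13) v
  rw [Units.val_pow_eq_pow_val, hg, eig_dist c α β γ hE d x y z h12 h23 h13]
  exact ⟨α^d, by simp, by simp [e1], by simp [e1, e2]⟩

theorem PC_dist_two (c : Fin 3 → k) (g : Matrix.GeneralLinearGroup (Fin 3) k) (hg : g.val = cm c)
    (α β γ : K) (hE : isE c α β γ) (h12 : α ≠ β) (h23 : β ≠ γ) (h13 : α ≠ γ) (d n : ℕ) (hn : 0 < n)
    (e1 : α^d = β^d) (e2 : β^d ≠ γ^d) :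
    PC k K n (g^d) = Fintype.card k ^ n + 2 := by
  have hγ : γ ^ (Fintype.card k ^ n) = γ := by
    have r1 := isE_root hE n
    have r2 := isE_root (isE_rot hE) n
    have r3 := isE_root (isE_rot (isE_rot hE)) n
    have i12 : α ^ (Fintype.card k ^ n) ≠ β ^ (Fintype.card k ^ n) := fun h => h12 (frn_inj n h)
    have i13 : α ^ (Fintype.card k ^ n) ≠ γ ^ (Fintype.card k ^ n) := fun h => h13 (frn_inj n h)
    have i23 : β ^ (Fintype.card k ^ n) ≠ γ ^ (Fintype.card k ^ n) := fun h => h23 (frn_inj n h)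
    have f1 : (α ^ (Fintype.card k ^ n)) ^ d = (β ^ (Fintype.card k ^ n)) ^ d := by
      rw [← pow_mul, mul_comm, pow_mul, e1, ← pow_mul, mul_comm, pow_mul]
    have e3 : α^d ≠ γ^d := by rw [e1]; exact e2
    generalize α ^ (Fintype.card k ^ n) = A at *
    generalize β ^ (Fintype.card k ^ n) = B at *
    generalize γ ^ (Fintype.card k ^ n) = C at *
    rcases r3 with h | h | h
    · exact h
    · subst h
      rcases r1 with h | h | h
      · exact absurd h i13
      · subst h
        rcases r2 with h | h | h
        · exact absurd h.symm i12
        · rw [h] at f1; exact absurd f1 e2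
        · exact absurd h i23
      · subst h
        rcases r2 with h | h | h
        · rw [h] at f1; exact absurd f1.symm e2
        · exact absurd h.symm i12
        · exact absurd h i23
    · subst h
      rcases r1 with h | h | h
      · subst h
        rcases r2 with h | h | h
        · exact absurd h i23
        · rw [h] at f1; exact absurd f1 e3
        · exact absurd h.symm i12
      · exact absurd h i13
      · subst h
        rcases r2 with h | h | h
        · exact absurd h i23
        · exact absurd h.symm i12
        · rw [h] at f1; exact absurd f1.symm e3
  have hsum : α + β = algebraMap k K (c 2) - γ := by rw [hE.2.2]; ring
  have hprod : α * β = -algebraMap k K (c 1) - γ * (algebraMap k K (c 2) - γ) := by rw [hE.2.2, hE.2.1]; ring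
  have fs : (α + β) ^ (Fintype.card k ^ n) = α + β := by
    rw [hsum]; exact fix_sub n (alg_fix n _) hγ
  have fp : (α * β) ^ (Fintype.card k ^ n) = α * β := by
    rw [hprod]
    exact fix_sub n (fix_neg n (alg_fix n _)) (fix_mul n hγ (fix_sub n (alg_fix n _) hγ))
  apply PC_line_pt n hn _ ![α*β, -(α+β), 1] (vd γ)
  · intro i
    fin_cases i
    · exact fp
    · exact fix_neg n fs
    · simp
  · intro i
    fin_cases i
    · simp [vd]
    · simpa [vd] using hγ
    · simp only [vd]
      show (γ^2) ^ _ = γ^2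
      rw [← pow_mul, mul_comm, pow_mul, hγ]
  · have : (![α*β, -(α+β), 1] : Fin 3 → K) 0 * vd γ 0 + (![α*β, -(α+β), 1] : Fin 3 → K) 1 * vd γ 1 + (![α*β, -(α+β), 1] : Fin 3 → K) 2 * vd γ 2
      = (γ - α) * (γ - β) := by simp [vd]; ring
    rw [this]
    exact mul_ne_zero (sub_ne_zero.2 h13.symm) (sub_ne_zero.2 h23.symm)
  intro v _
  obtain ⟨x, y, z, rfl⟩ := d3_span _ _ _ (d3_vd α β γ h12 h23 h13) v
  rw [Units.val_pow_eq_pow_val, hg, eig_dist c α β γ hE d x y z h12 h23 h13]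
  have hw : (![α*β, -(α+β), 1] : Fin 3 → K) 0 * (x • vd α + y • vd β + z • vd γ) 0 + (![α*β, -(α+β), 1] : Fin 3 → K) 1 * (x • vd α + y • vd β + z • vd γ) 1
      + (![α*β, -(α+β), 1] : Fin 3 → K) 2 * (x • vd α + y • vd β + z • vd γ) 2 = z * ((γ - α) * (γ - β)) := by
    simp [vd]; ring
  rw [hw]
  have hu : ∀ m : K, x • vd α + y • vd β + z • vd γ = m • vd γ ↔ x = 0 ∧ y = 0 ∧ z = m := by
    intro m
    rw [← d3_indep _ _ _ (d3_vd α β γ h12 h23 h13), zero_smul, zero_smul, zero_add, zero_add]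
  simp only [hu]
  have hne : (γ - α) * (γ - β) ≠ 0 := mul_ne_zero (sub_ne_zero.2 h13.symm) (sub_ne_zero.2 h23.symm)
  constructor
  · rintro ⟨l, h1, h2, h3⟩
    by_cases hl : γ^d - l = 0
    · right
      have hl' : l = γ^d := (sub_eq_zero.1 hl).symm
      subst hl'
      refine ⟨z, (mul_eq_zero.1 h1).resolve_right ?_, (mul_eq_zero.1 h2).resolve_right ?_, rfl⟩
      · rw [e1]; exact sub_ne_zero.2 e2
      · exact sub_ne_zero.2 e2
    · left
      rw [(mul_eq_zero.1 h3).resolve_right hl, zero_mul]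
  · rintro (h | ⟨m, rfl, rfl, h⟩)
    · have hz : z = 0 := (mul_eq_zero.1 h).resolve_right hne
      exact ⟨α^d, by simp, by simp [e1], by simp [hz]⟩
    · exact ⟨γ^d, by simp, by simp, by simp⟩

theorem mk_vd_fix (α : K) (n : ℕ) : (pf k K ^ n) (Projectivization.mk K (vd α) (vd_ne α)) = Projectivization.mk K (vd α) (vd_ne α) ↔
    α ^ (Fintype.card k ^ n) = α := by
  rw [pf_pow_mk, Projectivization.mk_eq_mk_iff']
  constructor
  · rintro ⟨a, ha⟩
    have h0 := congrFun ha 0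
    have h1 := congrFun ha 1
    simp [vd] at h0 h1
    rw [h0, one_mul] at h1
    exact h1.symm
  · intro h
    refine ⟨1, ?_⟩
    rw [one_smul]
    funext i
    fin_cases i
    · simp [vd]
    · simp [vd, h]
    · show α^2 = (α^2)^ _
      rw [← pow_mul, mul_comm, pow_mul, h]

theorem mk_vd_inj (α β : K) : Projectivization.mk K (vd α) (vd_ne α) = Projectivization.mk K (vd β) (vd_ne β) ↔ α = β := by
  rw [Projectivization.mk_eq_mk_iff']
  constructor
  · rintro ⟨a, ha⟩
    have h0 := congrFun ha 0
    have h1 := congrFun ha 1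
    simp [vd] at h0 h1
    rw [h0, one_mul] at h1
    exact h1.symm
  · rintro rfl; exact ⟨1, by simp⟩

open Classical in
/-- fixed points are the Vandermonde points of a finite set -/
theorem PC_vd (n : ℕ) (h : Matrix.GeneralLinearGroup (Fin 3) k) (s : Finset K)
    (H : ∀ v : Fin 3 → K, v ≠ 0 → (eig k K h.val v ↔ ∃ a ∈ s, ∃ m : K, v = m • vd a)) :
    PC k K n h = (s.filter fun a => a ^ (Fintype.card k ^ n) = a).card := by
  rw [PC_set n h {x | ∃ a ∈ s, x = Projectivization.mk K (vd a) (vd_ne a)}]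
  · rw [← Set.ncard_coe_finset]
    rw [← Set.ncard_image_of_injective (f := fun a : K => Projectivization.mk K (vd a) (vd_ne a))]
    · congr 1
      ext x
      simp only [Set.mem_ofPred_eq, Set.mem_image, Finset.mem_coe, Finset.mem_filter]
      constructor
      · rintro ⟨⟨a, ha, rfl⟩, h2⟩
        exact ⟨a, ⟨ha, (mk_vd_fix a n).1 h2⟩, rfl⟩
      · rintro ⟨a, ⟨ha, h2⟩, rfl⟩
        exact ⟨⟨a, ha, rfl⟩, (mk_vd_fix a n).2 h2⟩
    · intro a b hab
      exact (mk_vd_inj a b).1 hab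
  · intro v hv
    rw [H v hv]
    simp only [Set.mem_ofPred_eq, Projectivization.mk_eq_mk_iff']
    constructor
    · rintro ⟨a, ha, m, rfl⟩; exact ⟨a, ha, m, rfl⟩
    · rintro ⟨a, ha, m, rfl⟩; exact ⟨a, ha, m, rfl⟩

open Classical in
theorem PC_dist_none (c : Fin 3 → k) (g : Matrix.GeneralLinearGroup (Fin 3) k) (hg : g.val = cm c)
    (α β γ : K) (hE : isE c α β γ) (h12 : α ≠ β) (h23 : β ≠ γ) (h13 : α ≠ γ) (d n : ℕ) 
    (e1 : α^d ≠ β^d) (e2 : β^d ≠ γ^d) (e3 : α^d ≠ γ^d) :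
    PC k K n (g^d) = (({α, β, γ} : Finset K).filter fun a => a ^ (Fintype.card k ^ n) = a).card := by
  apply PC_vd
  intro v _
  obtain ⟨x, y, z, rfl⟩ := d3_span _ _ _ (d3_vd α β γ h12 h23 h13) v
  rw [Units.val_pow_eq_pow_val, hg, eig_dist c α β γ hE d x y z h12 h23 h13]
  simp only [Finset.mem_insert, Finset.mem_singleton, exists_eq_or_imp, exists_eq_left]
  have hu : ∀ m : K, x • vd α + y • vd β + z • vd γ = m • vd γ ↔ x = 0 ∧ y = 0 ∧ z = m := by
    intro m
    rw [← d3_indep _ _ _ (d3_vd α β γ h12 h23 h13), zero_smul, zero_smul, zero_add, zero_add]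
  have hu2 : ∀ m : K, x • vd α + y • vd β + z • vd γ = m • vd α ↔ x = m ∧ y = 0 ∧ z = 0 := by
    intro m
    rw [← d3_indep _ _ _ (d3_vd α β γ h12 h23 h13), zero_smul, zero_smul, add_zero, add_zero]
  have hu3 : ∀ m : K, x • vd α + y • vd β + z • vd γ = m • vd β ↔ x = 0 ∧ y = m ∧ z = 0 := by
    intro m
    rw [← d3_indep _ _ _ (d3_vd α β γ h12 h23 h13), zero_smul, zero_smul, zero_add, add_zero]
  simp only [hu, hu2, hu3]
  constructor
  · rintro ⟨l, h1, h2, h3⟩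
    rw [mul_eq_zero, sub_eq_zero] at h1 h2 h3
    by_cases a1 : α^d = l
    · subst a1
      exact Or.inl ⟨x, rfl, h2.resolve_right e1.symm, h3.resolve_right e3.symm⟩
    by_cases a2 : β^d = l
    · subst a2
      exact Or.inr (Or.inl ⟨y, h1.resolve_right e1, rfl, h3.resolve_right e2.symm⟩)
    · exact Or.inr (Or.inr ⟨z, h1.resolve_right a1, h2.resolve_right a2, rfl⟩)
  · rintro (⟨m, rfl, rfl, rfl⟩ | ⟨m, rfl, rfl, rfl⟩ | ⟨m, rfl, rfl, rfl⟩)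
    · exact ⟨α^d, by simp, by simp, by simp⟩
    · exact ⟨β^d, by simp, by simp, by simp⟩
    · exact ⟨γ^d, by simp, by simp, by simp⟩

end comp
end T7

namespace T7
open Finset
set_option linter.unusedSectionVars false
set_option linter.unusedSimpArgs false

section comp
variable {k K : Type*} [Field k] [Fintype k] [Field K] [Algebra k K] [IsAlgClosed K]

theorem d3_dbl (α γ : K) (h13 : α ≠ γ) : d3 (vd α) (vd1 α) (vd γ) ≠ 0 := by
  have : d3 (vd α) (vd1 α) (vd γ) = (γ - α) * (γ - α) := by simp [d3, vd, vd1]; ring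
  rw [this]
  exact (mul_ne_zero (sub_ne_zero.2 h13.symm) (sub_ne_zero.2 h13.symm))

theorem d3_tri (α : K) : d3 (vd α) (vd1 α) (vd2 α) ≠ 0 := by
  have : d3 (vd α) (vd1 α) (vd2 α) = 1 := by simp [d3, vd, vd1, vd2]
  rw [this]; exact one_ne_zero

theorem vd_fix (n : ℕ) (a : K) (h : a ^ (Fintype.card k ^ n) = a) (i : Fin 3) : vd a i ^ (Fintype.card k ^ n) = vd a i := by
  fin_cases i
  · simp [vd]
  · simpa [vd] using h
  · simp only [vd]
    show (a^2) ^ _ = a^2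
    rw [← pow_mul, mul_comm, pow_mul, h]

theorem PC_dbl_all (c : Fin 3 → k) (g : Matrix.GeneralLinearGroup (Fin 3) k) (hg : g.val = cm c)
    (α γ : K) (hE : isE c α α γ) (h13 : α ≠ γ) (d n : ℕ) (hn : 0 < n)
    (e1 : α^(d+1) = γ^(d+1)) (hd : ((d+1:ℕ):K) = 0) :
    PC k K n (g^(d+1)) = (Fintype.card k ^ n)^2 + Fintype.card k ^ n + 1 := by
  apply PC_all n hn
  intro v
  obtain ⟨x, y, z, rfl⟩ := d3_span _ _ _ (d3_dbl α γ h13) v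
  rw [Units.val_pow_eq_pow_val, hg, eig_dbl c α γ hE d x y z h13]
  exact ⟨α^(d+1), by simp [hd], by simp, by simp [e1]⟩

theorem PC_dbl_ne (c : Fin 3 → k) (g : Matrix.GeneralLinearGroup (Fin 3) k) (hg : g.val = cm c)
    (α γ : K) (hE : isE c α α γ) (h13 : α ≠ γ) (hα : α ^ Fintype.card k = α) (hγ : γ ^ Fintype.card k = γ) (d n : ℕ) (hn : 0 < n)
    (e1 : α^(d+1) ≠ γ^(d+1)) (hd : ((d+1:ℕ):K) = 0) :
    PC k K n (g^(d+1)) = Fintype.card k ^ n + 2 := by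
  obtain ⟨a, rfl⟩ := fix_alg α hα
  obtain ⟨b, rfl⟩ := fix_alg γ hγ
  set α := algebraMap k K a with ha
  set γ := algebraMap k K b with hb
  have fα : α ^ (Fintype.card k ^ n) = α := alg_fix n a
  have fγ : γ ^ (Fintype.card k ^ n) = γ := alg_fix n b
  have hne : (γ - α) * (γ - α) ≠ 0 := mul_ne_zero (sub_ne_zero.2 h13.symm) (sub_ne_zero.2 h13.symm)
  apply PC_line_pt n hn _ ![α*α, -(α+α), 1] (vd γ)
  · intro i
    fin_cases i
    · exact fix_mul n fα fα
    · exact fix_neg n (fix_add n fα fα)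
    · simp
  · exact vd_fix n γ fγ
  · have : (![α*α, -(α+α), 1] : Fin 3 → K) 0 * vd γ 0 + (![α*α, -(α+α), 1] : Fin 3 → K) 1 * vd γ 1 + (![α*α, -(α+α), 1] : Fin 3 → K) 2 * vd γ 2
      = (γ - α) * (γ - α) := by simp [vd]; ring
    rw [this]
    exact hne
  intro v _
  obtain ⟨x, y, z, rfl⟩ := d3_span _ _ _ (d3_dbl α γ h13) v
  rw [Units.val_pow_eq_pow_val, hg, eig_dbl c α γ hE d x y z h13]
  have hw : (![α*α, -(α+α), 1] : Fin 3 → K) 0 * (x • vd α + y • vd1 α + z • vd γ) 0 + (![α*α, -(α+α), 1] : Fin 3 → K) 1 * (x • vd α + y • vd1 α + z • vd γ) 1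
      + (![α*α, -(α+α), 1] : Fin 3 → K) 2 * (x • vd α + y • vd1 α + z • vd γ) 2 = z * ((γ - α) * (γ - α)) := by
    simp [vd, vd1]; ring
  rw [hw]
  have hu : ∀ m : K, x • vd α + y • vd1 α + z • vd γ = m • vd γ ↔ x = 0 ∧ y = 0 ∧ z = m := by
    intro m
    rw [← d3_indep _ _ _ (d3_dbl α γ h13), zero_smul, zero_smul, zero_add, zero_add]
  simp only [hu, hd]
  constructor
  · rintro ⟨l, h1, h2, h3⟩
    by_cases hl : γ^(d+1) = l
    · subst hl
      right
      refine ⟨z, (mul_eq_zero.1 (by simpa using h1)).resolve_right ?_, (mul_eq_zero.1 h2).resolve_right ?_, rfl⟩ <;> exact sub_ne_zero.2 e1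
    · left
      rw [(mul_eq_zero.1 h3).resolve_right (sub_ne_zero.2 hl), zero_mul]
  · rintro (h | ⟨m, rfl, rfl, h⟩)
    · have hz : z = 0 := (mul_eq_zero.1 h).resolve_right hne
      exact ⟨α^(d+1), by simp, by simp, by simp [hz]⟩
    · exact ⟨γ^(d+1), by simp, by simp, by simp⟩

theorem PC_dbl_eq (c : Fin 3 → k) (g : Matrix.GeneralLinearGroup (Fin 3) k) (hg : g.val = cm c)
    (α γ : K) (hE : isE c α α γ) (h13 : α ≠ γ) (hα : α ^ Fintype.card k = α) (hγ : γ ^ Fintype.card k = γ) (h0 : α ≠ 0) (d n : ℕ) (hn : 0 < n)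
    (e1 : α^(d+1) = γ^(d+1)) (hd : ((d+1:ℕ):K) ≠ 0) :
    PC k K n (g^(d+1)) = Fintype.card k ^ n + 1 := by
  obtain ⟨a, rfl⟩ := fix_alg α hα
  obtain ⟨b, rfl⟩ := fix_alg γ hγ
  set α := algebraMap k K a with ha
  set γ := algebraMap k K b with hb
  have fα : α ^ (Fintype.card k ^ n) = α := alg_fix n a
  have fγ : γ ^ (Fintype.card k ^ n) = γ := alg_fix n b
  apply PC_line n hn _ ![α*γ, -(α+γ), 1]
  · intro i
    fin_cases i
    · exact fix_mul n fα fγ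
    · exact fix_neg n (fix_add n fα fγ)
    · simp
  · intro h; simpa using congrFun h 2
  intro v _
  obtain ⟨x, y, z, rfl⟩ := d3_span _ _ _ (d3_dbl α γ h13) v
  rw [Units.val_pow_eq_pow_val, hg, eig_dbl c α γ hE d x y z h13]
  have hw : (![α*γ, -(α+γ), 1] : Fin 3 → K) 0 * (x • vd α + y • vd1 α + z • vd γ) 0 + (![α*γ, -(α+γ), 1] : Fin 3 → K) 1 * (x • vd α + y • vd1 α + z • vd γ) 1
      + (![α*γ, -(α+γ), 1] : Fin 3 → K) 2 * (x • vd α + y • vd1 α + z • vd γ) 2 = y * (α - γ) := by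
    simp [vd, vd1]; ring
  rw [hw]
  have hs : ((d+1:ℕ):K) * α^d ≠ 0 := mul_ne_zero hd (pow_ne_zero _ h0)
  constructor
  · rintro ⟨l, h1, h2, h3⟩
    by_cases hl : α^(d+1) = l
    · rw [hl, sub_self, mul_zero, zero_add] at h1
      rw [(mul_eq_zero.1 h1).resolve_right hs, zero_mul]
    · rw [(mul_eq_zero.1 h2).resolve_right (sub_ne_zero.2 hl), zero_mul]
  · intro h
    have hz : y = 0 := (mul_eq_zero.1 h).resolve_right (sub_ne_zero.2 h13)
    exact ⟨α^(d+1), by simp [hz], by simp, by simp [e1]⟩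

theorem PC_dbl_none (c : Fin 3 → k) (g : Matrix.GeneralLinearGroup (Fin 3) k) (hg : g.val = cm c)
    (α γ : K) (hE : isE c α α γ) (h13 : α ≠ γ) (hα : α ^ Fintype.card k = α) (hγ : γ ^ Fintype.card k = γ) (h0 : α ≠ 0) (d n : ℕ)
    (e1 : α^(d+1) ≠ γ^(d+1)) (hd : ((d+1:ℕ):K) ≠ 0) :
    PC k K n (g^(d+1)) = 2 := by
  classical
  obtain ⟨a, rfl⟩ := fix_alg α hα
  obtain ⟨b, rfl⟩ := fix_alg γ hγ
  set α := algebraMap k K a with ha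
  set γ := algebraMap k K b with hb
  have fα : α ^ (Fintype.card k ^ n) = α := alg_fix n a
  have fγ : γ ^ (Fintype.card k ^ n) = γ := alg_fix n b
  rw [PC_vd n _ {α, γ}]
  · rw [Finset.filter_true_of_mem, Finset.card_pair h13]
    intro x hx
    simp only [Finset.mem_insert, Finset.mem_singleton] at hx
    rcases hx with rfl | rfl <;> assumption
  intro v _
  obtain ⟨x, y, z, rfl⟩ := d3_span _ _ _ (d3_dbl α γ h13) v
  rw [Units.val_pow_eq_pow_val, hg, eig_dbl c α γ hE d x y z h13]
  have hs : ((d+1:ℕ):K) * α^d ≠ 0 := mul_ne_zero hd (pow_ne_zero _ h0)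
  simp only [Finset.mem_insert, Finset.mem_singleton, exists_eq_or_imp, exists_eq_left]
  have hu : ∀ m : K, x • vd α + y • vd1 α + z • vd γ = m • vd γ ↔ x = 0 ∧ y = 0 ∧ z = m := by
    intro m
    rw [← d3_indep _ _ _ (d3_dbl α γ h13), zero_smul, zero_smul, zero_add, zero_add]
  have hu2 : ∀ m : K, x • vd α + y • vd1 α + z • vd γ = m • vd α ↔ x = m ∧ y = 0 ∧ z = 0 := by
    intro m
    rw [← d3_indep _ _ _ (d3_dbl α γ h13), zero_smul, zero_smul, add_zero, add_zero]
  simp only [hu, hu2]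
  constructor
  · rintro ⟨l, h1, h2, h3⟩
    by_cases hl : α^(d+1) = l
    · subst hl
      rw [sub_self, mul_zero, zero_add] at h1
      exact Or.inl ⟨x, rfl, (mul_eq_zero.1 h1).resolve_right hs, (mul_eq_zero.1 h3).resolve_right (sub_ne_zero.2 e1.symm)⟩
    · have hy := (mul_eq_zero.1 h2).resolve_right (sub_ne_zero.2 hl)
      rw [hy, zero_mul, add_zero] at h1
      exact Or.inr ⟨z, (mul_eq_zero.1 h1).resolve_right (sub_ne_zero.2 hl), hy, rfl⟩
  · rintro (⟨m, rfl, rfl, rfl⟩ | ⟨m, rfl, rfl, rfl⟩)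
    · exact ⟨α^(d+1), by simp, by simp, by simp⟩
    · exact ⟨γ^(d+1), by simp, by simp, by simp⟩

theorem PC_tri_all (c : Fin 3 → k) (g : Matrix.GeneralLinearGroup (Fin 3) k) (hg : g.val = cm c)
    (α : K) (hE : isE c α α α) (h0 : α ≠ 0) (h2 : (2 : K) ≠ 0) (d n : ℕ) (hn : 0 < n) (hd : ((d+1:ℕ):K) = 0) :
    PC k K n (g^(d+1)) = (Fintype.card k ^ n)^2 + Fintype.card k ^ n + 1 := by
  apply PC_all n hn
  intro v
  obtain ⟨x, y, z, rfl⟩ := d3_span _ _ _ (d3_tri α) v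
  obtain ⟨r, hr, H⟩ := eig_tri c α hE d
  rw [Units.val_pow_eq_pow_val, hg, H]
  have hr0 : r = 0 := by
    rw [hd, zero_mul, zero_mul] at hr
    exact (mul_eq_zero.1 hr).resolve_left (mul_ne_zero h2 h0)
  exact ⟨α^(d+1), by simp [hd, hr0], by simp [hd], by simp⟩

theorem PC_tri_none (c : Fin 3 → k) (g : Matrix.GeneralLinearGroup (Fin 3) k) (hg : g.val = cm c)
    (α : K) (hE : isE c α α α) (h0 : α ≠ 0) (hα : α ^ Fintype.card k = α) (d n : ℕ) (hd : ((d+1:ℕ):K) ≠ 0) :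
    PC k K n (g^(d+1)) = 1 := by
  classical
  obtain ⟨a, rfl⟩ := fix_alg α hα
  set α := algebraMap k K a with ha
  have fα : α ^ (Fintype.card k ^ n) = α := alg_fix n a
  rw [PC_vd n _ {α}]
  · rw [Finset.filter_true_of_mem, Finset.card_singleton]
    intro x hx
    simp only [Finset.mem_singleton] at hx
    rwa [hx]
  intro v _
  obtain ⟨x, y, z, rfl⟩ := d3_span _ _ _ (d3_tri α) v
  obtain ⟨r, hr, H⟩ := eig_tri c α hE d
  rw [Units.val_pow_eq_pow_val, hg, H]
  have hs : ((d+1:ℕ):K) * α^d ≠ 0 := mul_ne_zero hd (pow_ne_zero _ h0)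
  simp only [Finset.mem_singleton, exists_eq_left]
  have hu2 : ∀ m : K, x • vd α + y • vd1 α + z • vd2 α = m • vd α ↔ x = m ∧ y = 0 ∧ z = 0 := by
    intro m
    rw [← d3_indep _ _ _ (d3_tri α), zero_smul, zero_smul, add_zero, add_zero]
  simp only [hu2]
  constructor
  · rintro ⟨l, h1, h2, h3⟩
    by_cases hl : α^(d+1) = l
    · subst hl
      rw [sub_self, mul_zero, zero_add] at h1 h2
      have hz := (mul_eq_zero.1 h2).resolve_right hs
      rw [hz, zero_mul, add_zero] at h1
      exact ⟨x, rfl, (mul_eq_zero.1 h1).resolve_right hs, hz⟩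
    · have hl' := sub_ne_zero.2 hl
      have hz := (mul_eq_zero.1 h3).resolve_right hl'
      rw [hz, zero_mul, add_zero] at h2
      exact ⟨x, rfl, (mul_eq_zero.1 h2).resolve_right hl', hz⟩
  · rintro ⟨m, rfl, rfl, rfl⟩
    exact ⟨α^(d+1), by simp, by simp, by simp⟩

/-! rank one type -/
/-- `a + u wᵀ` -/
def r1 (a : k) (u w : Fin 3 → k) : Matrix (Fin 3) (Fin 3) k := a • 1 + Matrix.vecMulVec u w

theorem r1_mv (a : k) (u w v : Fin 3 → k) : (r1 a u w).mulVec v = a • v + (w ⬝ᵥ v) • u := by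
  unfold r1
  rw [Matrix.add_mulVec, Matrix.smul_mulVec, Matrix.one_mulVec, Matrix.vecMulVec_mulVec]
  simp

theorem r1_pow (a : k) (u w : Fin 3 → k) (d : ℕ) : ∃ s : k, (r1 a u w)^d = r1 (a^d) (s • u) w ∧
    s * (w ⬝ᵥ u) = (a + w ⬝ᵥ u)^d - a^d ∧ (w ⬝ᵥ u = 0 → a * s = d * a^d) := by
  induction d with
  | zero => exact ⟨0, by simp [r1], by simp, by simp⟩
  | succ d ih =>
    obtain ⟨s, h1, h2, h3⟩ := ih
    refine ⟨a * s + (a + w ⬝ᵥ u)^d, ?_, ?_, ?_⟩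
    · rw [pow_succ, h1]
      unfold r1
      rw [add_mul, mul_add, mul_add, Matrix.vecMulVec_mul_vecMulVec]
      ext i j
      simp [Matrix.vecMulVec_apply]

      linear_combination (u i * w j) * h2
    · rw [add_mul, mul_assoc, h2]; ring
    · intro h
      rw [mul_add, h3 h, h]; push_cast; ring

theorem eig_r1 (a s : k) (u w : Fin 3 → k) (hu : u ≠ 0) (hs : s ≠ 0) (v : Fin 3 → K) (hv : v ≠ 0) :
    eig k K (r1 a (s • u) w) v ↔ (algebraMap k K (w 0) * v 0 + algebraMap k K (w 1) * v 1 + algebraMap k K (w 2) * v 2 = 0 ∨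
      ∃ m : K, v = m • fun i => algebraMap k K (u i)) := by
  set t := algebraMap k K (w 0) * v 0 + algebraMap k K (w 1) * v 1 + algebraMap k K (w 2) * v 2 with ht
  have hs' : algebraMap k K s ≠ 0 := by simpa using hs
  have e : ((r1 a (s • u) w).map (algebraMap k K)).mulVec v = algebraMap k K a • v + (t * algebraMap k K s) • fun i => algebraMap k K (u i) := by
    funext i
    fin_cases i <;> simp [r1, Matrix.mulVec, dotProduct, Fin.sum_univ_three, Matrix.vecMulVec_apply, Matrix.one_apply, ht] <;> (try simp only [Algebra.smul_def]) <;> ring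
  unfold eig
  rw [e]
  constructor
  · rintro ⟨l, hl⟩
    by_cases h0 : t = 0
    · exact Or.inl h0
    · right
      refine ⟨t * algebraMap k K s / (l - algebraMap k K a), ?_⟩
      have hl' : (t * algebraMap k K s) • (fun i => algebraMap k K (u i)) = (l - algebraMap k K a) • v := by
        rw [sub_smul, ← hl]; abel
      have hne : l - algebraMap k K a ≠ 0 := by
        intro h
        rw [h, zero_smul] at hl'
        rcases smul_eq_zero.1 hl' with h' | h'
        · exact mul_ne_zero h0 hs' h'
        · apply hu
          funext i
          have := congrFun h' i
          simpa using this
      rw [div_eq_inv_mul, mul_smul, hl', smul_smul, inv_mul_cancel₀ hne, one_smul]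
  · rintro (h | ⟨m, hm⟩)
    · exact ⟨algebraMap k K a, by rw [h]; simp⟩
    · have hm0 : m ≠ 0 := by rintro rfl; simp at hm; exact hv hm
      refine ⟨algebraMap k K a + t * algebraMap k K s / m, ?_⟩
      have : (fun i => algebraMap k K (u i)) = m⁻¹ • v := by rw [hm, smul_smul, inv_mul_cancel₀ hm0, one_smul]
      rw [this, add_smul, smul_smul, div_eq_mul_inv]

theorem PC_r1_all (g : Matrix.GeneralLinearGroup (Fin 3) k) (a : k) (u w : Fin 3 → k) (hg : g.val = r1 a u w) (ha : a ≠ 0)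
    (d n : ℕ) (hn : 0 < n) (h : (w ⬝ᵥ u = 0 ∧ (d : k) = 0) ∨ (w ⬝ᵥ u ≠ 0 ∧ (a + w ⬝ᵥ u)^d = a^d)) :
    PC k K n (g^d) = (Fintype.card k ^ n)^2 + Fintype.card k ^ n + 1 := by
  apply PC_all n hn
  intro v
  obtain ⟨s, h1, h2, h3⟩ := r1_pow a u w d
  rw [Units.val_pow_eq_pow_val, hg, h1]
  have hs : s = 0 := by
    rcases h with ⟨h4, h5⟩ | ⟨h4, h5⟩
    · have := h3 h4
      rw [h5, zero_mul] at this
      exact (mul_eq_zero.1 this).resolve_left ha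
    · rw [h5, sub_self] at h2
      exact (mul_eq_zero.1 h2).resolve_right h4
  refine ⟨algebraMap k K (a^d), ?_⟩
  rw [hs]
  funext i
  fin_cases i <;> simp [r1, Matrix.mulVec, dotProduct, Fin.sum_univ_three, Matrix.vecMulVec_apply, Matrix.one_apply]

theorem PC_r1_line (g : Matrix.GeneralLinearGroup (Fin 3) k) (a : k) (u w : Fin 3 → k) (hg : g.val = r1 a u w) (ha : a ≠ 0)
    (hu : u ≠ 0) (hw : w ≠ 0)
    (d n : ℕ) (hn : 0 < n) (h0 : w ⬝ᵥ u = 0) (hd : (d : k) ≠ 0) :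
    PC k K n (g^d) = Fintype.card k ^ n + 1 := by
  apply PC_line n hn _ (fun i => algebraMap k K (w i)) (fun i => alg_fix n _)
  · intro h; apply hw; funext i; simpa using congrFun h i
  intro v hv
  obtain ⟨s, h1, h2, h3⟩ := r1_pow a u w d
  have hs : s ≠ 0 := by
    rintro rfl
    have := h3 h0
    rw [mul_zero] at this
    exact mul_ne_zero hd (pow_ne_zero _ ha) this.symm
  rw [Units.val_pow_eq_pow_val, hg, h1, eig_r1 _ s u w hu hs v hv]
  constructor
  · rintro (h | ⟨m, rfl⟩)
    · exact h
    · have := congrArg (algebraMap k K) h0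
      simp [dotProduct, Fin.sum_univ_three] at this ⊢
      linear_combination m * this
  · exact Or.inl

theorem PC_r1_pt (g : Matrix.GeneralLinearGroup (Fin 3) k) (a : k) (u w : Fin 3 → k) (hg : g.val = r1 a u w) 
    (d n : ℕ) (hn : 0 < n) (h0 : w ⬝ᵥ u ≠ 0) (hd : (a + w ⬝ᵥ u)^d ≠ a^d) :
    PC k K n (g^d) = Fintype.card k ^ n + 2 := by
  have hu : u ≠ 0 := by rintro rfl; simp at h0
  apply PC_line_pt n hn _ (fun i => algebraMap k K (w i)) (fun i => algebraMap k K (u i)) (fun i => alg_fix n _) (fun i => alg_fix n _)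
  · intro h
    apply h0
    apply (algebraMap k K).injective
    simpa [dotProduct, Fin.sum_univ_three] using h
  intro v hv
  obtain ⟨s, h1, h2, h3⟩ := r1_pow a u w d
  have hs : s ≠ 0 := by
    rintro rfl
    rw [zero_mul] at h2
    exact hd (sub_eq_zero.1 h2.symm)
  rw [Units.val_pow_eq_pow_val, hg, h1, eig_r1 _ s u w hu hs v hv]

theorem PC_scal (g : Matrix.GeneralLinearGroup (Fin 3) k) (a : k) (hg : g.val = a • 1)
    (d n : ℕ) (hn : 0 < n) :
    PC k K n (g^d) = (Fintype.card k ^ n)^2 + Fintype.card k ^ n + 1 := by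
  apply PC_all n hn
  intro v
  rw [Units.val_pow_eq_pow_val, hg]
  refine ⟨algebraMap k K (a^d), ?_⟩
  rw [smul_pow, one_pow]
  funext i
  fin_cases i <;> simp [Matrix.mulVec, dotProduct, Fin.sum_univ_three, Matrix.one_apply]

end comp
end T7

namespace T7
open Finset
set_option linter.unusedSectionVars false
set_option linter.unusedSimpArgs false

/-- number of points of the plane -/
def fu (q : ℚ) (n : ℕ) : ℚ := (q^n)^2 + q^n + 1

/-- a function on `{2,…,8}` given by its values -/
def sel (a2 a3 a4 a5 a6 a7 a8 : ℚ) (m : ℕ) : ℚ :=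
  if m = 2 then a2 else if m = 3 then a3 else if m = 4 then a4 else if m = 5 then a5
  else if m = 6 then a6 else if m = 7 then a7 else a8

def f1 (q : ℚ) : ℚ := q^14+q^13+q^12-q^10-q^9-q^8

theorem NP1 (q : ℚ) : NP (fun _ n => fu q n) = f1 q := by
  unfold NP Phi fu f1
  ring

def f2 (q : ℚ) : ℕ → ℚ := sel 0 (q^7+q^6-q^3-q^2) 0 (q^7-q^5+q^4) 0 (q^7-q^5+q^2) (q^7-q^5)

theorem NP2 (q : ℚ) (r : ℕ) (hr : r = 3 ∨ r = 5 ∨ r = 7 ∨ r = 8) :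
    NP (fun d n => if r ∣ d then fu q n else q^n+1) = f2 q r := by
  rcases hr with rfl | rfl | rfl | rfl <;> norm_num only [NP, Phi, f2, sel, fu, if_true, if_false] <;> ring

def f3 (q : ℚ) : ℕ → ℚ := sel 0 (q^4+q^3-q) 0 0 0 (q^2+q) 0

theorem NP3 (q : ℚ) (r : ℕ) (hr : r = 3 ∨ r = 5 ∨ r = 7 ∨ r = 8) :
    NP (fun d n => if r ∣ d then fu q n else 1) = f3 q r := by
  rcases hr with rfl | rfl | rfl | rfl <;> norm_num only [NP, Phi, f3, sel, fu, if_true, if_false] <;> ring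

def f4 (q : ℚ) : ℕ → ℚ := sel
  (4*q^7+5*q^6-8*q^5-9*q^4+6*q^3+6*q^2-2*q-2)
  (q^7+2*q^6+q^5-q^4-4*q^3-3*q^2+2*q+2)
  (q^7+q^6-2*q^3-q^2+q)
  (q^7+q^6-q^5+q^3-q-1)
  (q^7+q^6-q^5-q^4+q^3+2*q^2-q-2)
  (q^7+q^6-q^5-q^4+q^2-1)
  (q^7+q^6-q^5-q^4)

theorem NP4 (q : ℚ) (m : ℕ) (hm : 2 ≤ m) (hm' : m ≤ 8) :
    NP (fun d n => if m ∣ d then fu q n else q^n+2) = f4 q m := by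
  interval_cases m <;> norm_num only [NP, Phi, f4, sel, fu, if_true, if_false] <;> ring

def f5 (q : ℚ) (r : ℕ) : ℕ → ℚ :=
  if r = 3 then sel (3*q^3-q^2-2) 0 (3*q^2-3*q) (2*q^2-q-1) 0 (2*q^2-q-1) (2*q^2-2*q)
  else if r = 5 then sel (2*q^3-3*q^2+4*q-2) (2*q^2-3*q+2) q 0 (3*q-2) (2*q-1) q
  else if r = 7 then sel (2*q^3-4*q^2+5*q-2) (2*q^2-3*q+2) q (2*q-1) (3*q-2) 0 q
  else sel (2*q^3-4*q^2+4*q-2) (2*q^2-4*q+2) 0 (q-1) (2*q-2) (q-1) 0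

theorem NP5 (q : ℚ) (r m : ℕ) (hr : r = 3 ∨ r = 5 ∨ r = 7 ∨ r = 8) (hm : 2 ≤ m) (hm' : m ≤ 8)
    (h3 : r = 3 → m ≠ 3 ∧ m ≠ 6) (h5 : r = 5 → m ≠ 5) (h7 : r = 7 → m ≠ 7) :
    NP (fun d n => if r ∣ d then (if m ∣ d then fu q n else q^n+2) else if m ∣ d then q^n+1 else 2) = f5 q r m := by
  rcases hr with rfl | rfl | rfl | rfl <;> interval_cases m <;> (try (exfalso; omega)) <;>
  norm_num only [NP, Phi, f5, sel, fu, if_true, if_false] <;> ring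

def psi (q : ℚ) : ℕ → ℚ := sel (3*q^3-5*q^2+4*q-2) (3*q^2-6*q+3) (q-1) (3*q-3) (3*q-3) (q-1) 0

def chi (q : ℚ) (i j : ℕ) : ℚ :=
  sel (sel 0 (q^3+3*q^2-9*q+5) 0 (q^2-2*q+1) 0 0 0 j)
    (sel (q^3+3*q^2-9*q+5) (q^4+q^3-5*q^2+3*q) (q^2-2*q+1) 0 0 0 0 j)
    (sel 0 (q^2-2*q+1) (3*q^3-2*q^2-5*q+4) 0 0 0 0 j)
    (sel (q^2-2*q+1) 0 0 (q^2-2*q+1) 0 0 0 j)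
    (sel 0 0 0 0 (3*q^2-6*q+3) 0 0 j)
    (sel 0 0 0 0 0 ((q^2-2*q+1)/3) 0 j) 0 i

def P6 (q : ℚ) (a b c : ℕ) (d n : ℕ) : ℚ :=
  if a ∣ d then (if b ∣ d then fu q n else q^n+2) else if b ∣ d then q^n+2 else if c ∣ d then q^n+2 else 3

set_option maxHeartbeats 4000000 in
theorem NP6 (q : ℚ) (a b c : ℕ) (ha : 2 ≤ a) (ha' : a ≤ 8) (hb : 2 ≤ b) (hb' : b ≤ 8) (hc : 2 ≤ c) (hc' : c ≤ 8)
    (H : ∀ d ∈ [2,3,4,5,6,7], (a ∣ d → b ∣ d → c ∣ d) ∧ (b ∣ d → c ∣ d → a ∣ d) ∧ (a ∣ d → c ∣ d → b ∣ d))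
    (h4 : ¬ (a = 4 ∧ b = 4 ∧ c = 4))
    (h6 : a ∣ 6 → b ∣ 6 → c ∣ 6 → (if a ∣ 3 then (1:ℤ) else -1) * (if b ∣ 3 then (1:ℤ) else -1) * (if c ∣ 3 then (1:ℤ) else -1) = 1) :
    NP (P6 q a b c) = psi q a + psi q b + psi q c + chi q a b + chi q b c + chi q c a := by
  interval_cases a <;> interval_cases b <;> interval_cases c <;>
  first
  | (exfalso; revert H; decide)
  | (exfalso; revert h4; decide)
  | (exfalso; revert h6; decide)
  | (norm_num only [NP, Phi, P6, psi, chi, sel, fu, if_true, if_false] <;> ring)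

def f7a (q : ℚ) : ℕ → ℚ := sel (q^3+q^2-2*q-2) (q^2-1) (q+1) (q+1) (q+1) (q+1) 0
def f7b (q : ℚ) : ℕ → ℚ := sel 0 (q^4+q^3-q^2-q) (q^3+2*q^2-q-2) (q^2-1) (q^2-1) (q^2-1) 0

theorem NP7 (q : ℚ) (m m' : ℕ) (hm : 2 ≤ m) (hm' : m ≤ 8)
    (h : m' = 8 ∨ (m = 3 ∧ m' = 3) ∨ (m = 2 ∧ m' = 4) ∨ (m = 5 ∧ m' = 5) ∨ (m = 3 ∧ m' = 6) ∨ (m = 7 ∧ m' = 7)) :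
    NP (fun d n => if m' ∣ d then fu q n else if m ∣ d then q^n+2 else if 2 ∣ n then 3 else 1) = f7a q m + f7b q m' := by
  rcases h with rfl | ⟨rfl, rfl⟩ | ⟨rfl, rfl⟩ | ⟨rfl, rfl⟩ | ⟨rfl, rfl⟩ | ⟨rfl, rfl⟩
  · interval_cases m <;> norm_num only [NP, Phi, f7a, f7b, sel, fu, if_true, if_false] <;> ring
  all_goals norm_num only [NP, Phi, f7a, f7b, sel, fu, if_true, if_false]; ring

def f8 (q : ℚ) : ℕ → ℚ := sel 0 0 0 0 0 (q^2+q+1) 0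

theorem NP8 (q : ℚ) (m : ℕ) (hm : m = 3 ∨ m = 7 ∨ m = 8) :
    NP (fun d n => if m ∣ d then fu q n else if 3 ∣ n then 3 else 0) = f8 q m := by
  rcases hm with rfl | rfl | rfl <;> norm_num only [NP, Phi, f8, sel, fu, if_true, if_false] <;> ring

end T7

namespace T7
open Finset
set_option linter.unusedSectionVars false
set_option linter.unusedSimpArgs false

theorem NP_congr (P P' : ℕ → ℕ → ℚ) (h : ∀ d n, 1 ≤ d → d ≤ 7 → 1 ≤ n → P d n = P' d n) : NP P = NP P' := by
  unfold NP
  rw [h 1 1 (by norm_num) (by norm_num) (by norm_num), h 1 2 (by norm_num) (by norm_num) (by norm_num),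
    h 1 3 (by norm_num) (by norm_num) (by norm_num), h 1 4 (by norm_num) (by norm_num) (by norm_num),
    h 1 5 (by norm_num) (by norm_num) (by norm_num), h 1 6 (by norm_num) (by norm_num) (by norm_num),
    h 1 7 (by norm_num) (by norm_num) (by norm_num), h 2 1 (by norm_num) (by norm_num) (by norm_num),
    h 2 2 (by norm_num) (by norm_num) (by norm_num), h 2 3 (by norm_num) (by norm_num) (by norm_num),
    h 3 1 (by norm_num) (by norm_num) (by norm_num), h 3 2 (by norm_num) (by norm_num) (by norm_num),
    h 4 1 (by norm_num) (by norm_num) (by norm_num), h 5 1 (by norm_num) (by norm_num) (by norm_num),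
    h 6 1 (by norm_num) (by norm_num) (by norm_num), h 7 1 (by norm_num) (by norm_num) (by norm_num)]

/-- truncated order -/
noncomputable def tau {M : Type*} [Monoid M] (x : M) : ℕ := if orderOf x ≤ 7 ∧ orderOf x ≠ 0 then orderOf x else 8

theorem tau_dvd {M : Type*} [Monoid M] (x : M) (d : ℕ) (h1 : 1 ≤ d) (h7 : d ≤ 7) : tau x ∣ d ↔ x^d = 1 := by
  rw [← orderOf_dvd_iff_pow_eq_one]
  unfold tau
  split_ifs with h
  · rfl
  · constructor
    · intro h'; have := Nat.le_of_dvd (by omega) h'; omega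
    · intro h'
      have := Nat.le_of_dvd (by omega) h'
      have h2 : orderOf x ≠ 0 := by rintro h0; rw [h0] at h'; have := Nat.eq_zero_of_zero_dvd h'; omega
      exact absurd ⟨by omega, h2⟩ h

theorem tau_le {M : Type*} [Monoid M] (x : M) : tau x ≤ 8 := by
  unfold tau; split_ifs <;> omega

theorem two_le_tau {M : Type*} [Monoid M] (x : M) (h : x ≠ 1) : 2 ≤ tau x := by
  have : orderOf x ≠ 1 := fun h' => h (orderOf_eq_one_iff.1 h')
  unfold tau; split_ifs <;> omega

theorem tau_eq_iff {M : Type*} [Monoid M] (x : M) (m : ℕ) (h1 : 1 ≤ m) (h7 : m ≤ 7) : tau x = m ↔ orderOf x = m := by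
  unfold tau; split_ifs <;> omega

/-- truncated characteristic -/
def rho (k : Type*) [Fintype k] : ℕ :=
  if 3 ∣ Fintype.card k then 3 else if 5 ∣ Fintype.card k then 5 else if 7 ∣ Fintype.card k then 7 else 8

section
variable {k : Type*} [Field k] [Fintype k]
variable (k) in
theorem rho_cases : rho k = 3 ∨ rho k = 5 ∨ rho k = 7 ∨ rho k = 8 := by
  unfold rho; split_ifs <;> simp

theorem prime_zero (r : ℕ) (hr : r.Prime) : (r : k) = 0 ↔ r ∣ Fintype.card k := by
  obtain ⟨p, hp⟩ := CharP.exists k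
  obtain ⟨n, hpp, hc⟩ := FiniteField.card k p
  rw [CharP.cast_eq_zero_iff k p, Nat.prime_dvd_prime_iff_eq hpp hr, hc]
  constructor
  · rintro rfl; exact dvd_pow_self _ n.ne_zero
  · intro h; exact ((Nat.prime_dvd_prime_iff_eq hr hpp).1 (hr.dvd_of_dvd_pow h)).symm

theorem two_ne (hodd : Odd (Fintype.card k)) : (2 : k) ≠ 0 := by
  intro h
  have := (prime_zero (k := k) 2 Nat.prime_two).1 (by exact_mod_cast h)
  exact (Nat.not_even_iff_odd.2 hodd) (even_iff_two_dvd.2 this)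

theorem rho_dvd (hodd : Odd (Fintype.card k)) (d : ℕ) (h1 : 1 ≤ d) (h7 : d ≤ 7) : rho k ∣ d ↔ (d : k) = 0 := by
  obtain ⟨p, hp⟩ := CharP.exists k
  obtain ⟨n, hpp, hc⟩ := FiniteField.card k p
  have key : ∀ r : ℕ, r.Prime → (r ∣ Fintype.card k ↔ p = r) := by
    intro r hr
    rw [← prime_zero r hr, CharP.cast_eq_zero_iff k p, Nat.prime_dvd_prime_iff_eq hpp hr]
  have h2 : p ≠ 2 := by
    intro h
    have := (key 2 Nat.prime_two).2 h
    exact (Nat.not_even_iff_odd.2 hodd) (even_iff_two_dvd.2 this)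
  rw [CharP.cast_eq_zero_iff k p]
  unfold rho
  simp only [key 3 (by norm_num), key 5 (by norm_num), key 7 (by norm_num)]
  split_ifs with a b c
  · rw [a]
  · rw [b]
  · rw [c]
  · constructor
    · intro h; have := Nat.le_of_dvd (by omega) h; omega
    · intro h
      have h8 := Nat.le_of_dvd (by omega) h
      have := hpp.two_le
      exfalso
      have : p = 4 ∨ p = 6 := by omega
      rcases this with rfl | rfl <;> revert hpp <;> norm_num

end

section vals
variable {k K : Type*} [Field k] [Fintype k] [Field K] [Algebra k K] [IsAlgClosed K]

theorem castK (d : ℕ) : ((d : ℕ) : K) = 0 ↔ (d : k) = 0 := by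
  rw [← map_natCast (algebraMap k K) d, map_eq_zero]

theorem NS_scal (h3 : 3 ≤ Fintype.card k) (g : Matrix.GeneralLinearGroup (Fin 3) k) (a : k) (hg : g.val = a • 1) :
    (NS k K g : ℚ) = f1 (Fintype.card k) := by
  rw [NS_eq k K h3, ← NP1]
  apply NP_congr
  intro d n _ _ hn
  rw [PC_scal g a hg d n hn]; simp [fu]

theorem NS_r1_zero (h3 : 3 ≤ Fintype.card k) (hodd : Odd (Fintype.card k)) (g : Matrix.GeneralLinearGroup (Fin 3) k) (a : k) (u w : Fin 3 → k) (hg : g.val = r1 a u w) (ha : a ≠ 0)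
    (hu : u ≠ 0) (hw : w ≠ 0) (h0 : w ⬝ᵥ u = 0) :
    (NS k K g : ℚ) = f2 (Fintype.card k) (rho k) := by
  rw [NS_eq k K h3, ← NP2 _ _ (rho_cases k)]
  apply NP_congr
  intro d n hd hd7 hn
  split_ifs with h <;> rw [rho_dvd hodd d hd hd7] at h
  · rw [PC_r1_all g a u w hg ha d n hn (Or.inl ⟨h0, h⟩)]; simp [fu]
  · rw [PC_r1_line g a u w hg ha hu hw d n hn h0 h]; simp

theorem NS_r1_ne (h3 : 3 ≤ Fintype.card k) (g : Matrix.GeneralLinearGroup (Fin 3) k) (a : k) (u w : Fin 3 → k) (hg : g.val = r1 a u w) (ha : a ≠ 0)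
    (h0 : w ⬝ᵥ u ≠ 0) :
    (NS k K g : ℚ) = f4 (Fintype.card k) (tau ((a + w ⬝ᵥ u) / a)) := by
  have hne : (a + w ⬝ᵥ u) / a ≠ 1 := by
    intro h; rw [div_eq_one_iff_eq ha] at h; simp at h; exact h0 h
  rw [NS_eq k K h3, ← NP4 _ _ (two_le_tau _ hne) (tau_le _)]
  apply NP_congr
  intro d n hd hd7 hn
  split_ifs with h <;> rw [tau_dvd _ d hd hd7, div_pow, div_eq_one_iff_eq (pow_ne_zero d ha)] at h
  · rw [PC_r1_all g a u w hg ha d n hn (Or.inr ⟨h0, h⟩)]; simp [fu]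
  · rw [PC_r1_pt g a u w hg d n hn h0 h]; simp

theorem NS_tri (h3 : 3 ≤ Fintype.card k) (hodd : Odd (Fintype.card k)) (c : Fin 3 → k) (g : Matrix.GeneralLinearGroup (Fin 3) k) (hg : g.val = cm c)
    (α : K) (hE : isE c α α α) (h0 : α ≠ 0) (hα : α ^ Fintype.card k = α) :
    (NS k K g : ℚ) = f3 (Fintype.card k) (rho k) := by
  rw [NS_eq k K h3, ← NP3 _ _ (rho_cases k)]
  have h2 : (2 : K) ≠ 0 := by
    have := two_ne hodd
    intro h; apply this
    have := (castK (k := k) (K := K) 2).1 (by exact_mod_cast h)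
    exact_mod_cast this
  apply NP_congr
  intro d n hd hd7 hn
  obtain ⟨d, rfl⟩ : ∃ e, d = e + 1 := ⟨d - 1, by omega⟩
  split_ifs with h <;> rw [rho_dvd hodd _ hd hd7, ← castK (k := k) (K := K)] at h
  · rw [PC_tri_all c g hg α hE h0 h2 d n hn h]; simp [fu]
  · rw [PC_tri_none c g hg α hE h0 hα d n h]; simp

theorem NS_dbl (h3 : 3 ≤ Fintype.card k) (hodd : Odd (Fintype.card k)) (c : Fin 3 → k) (g : Matrix.GeneralLinearGroup (Fin 3) k) (hg : g.val = cm c)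
    (α γ : K) (hE : isE c α α γ) (h13 : α ≠ γ) (h0 : α ≠ 0) (hα : α ^ Fintype.card k = α) (hγ : γ ^ Fintype.card k = γ) :
    (NS k K g : ℚ) = f5 (Fintype.card k) (rho k) (tau (γ / α)) := by
  have hne : γ / α ≠ 1 := by
    intro h; rw [div_eq_one_iff_eq h0] at h; exact h13 h.symm
  -- no element of order p
  have hp : ∀ r : ℕ, r.Prime → (r : k) = 0 → ∀ x : K, x ^ r = 1 → x = 1 := by
    intro r hr h x hx
    have hK : (r : K) = 0 := (castK (k := k) r).2 h
    have : CharP K r := by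
      have := hr.two_le
      obtain ⟨p, hp⟩ := CharP.exists K
      have h1 := (CharP.cast_eq_zero_iff K p r).1 hK
      rcases (Nat.dvd_prime hr).1 h1 with h1 | h1
      · subst h1; exact absurd ((CharP.cast_eq_zero_iff K 1 1).2 dvd_rfl) (by rw [Nat.cast_one]; exact one_ne_zero)
      · subst h1; exact hp
    have := Fact.mk hr
    apply sub_eq_zero.1
    apply eq_zero_of_pow_eq_zero (n := r)
    rw [sub_pow_char, hx, one_pow, sub_self]
  have hch : ∀ r : ℕ, r.Prime → r ≤ 7 → rho k = r → ¬ (tau (γ/α) ∣ r) := by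
    intro r hr h7 h hd
    have := hr.two_le
    rw [tau_dvd _ r (by omega) h7] at hd
    exact hne (hp r hr ((rho_dvd hodd r (by omega) h7).1 (by rw [h])) _ hd)
  rw [NS_eq k K h3, ← NP5 _ _ _ (rho_cases k) (two_le_tau _ hne) (tau_le _)]
  · apply NP_congr
    intro d n hd hd7 hn
    obtain ⟨d, rfl⟩ : ∃ e, d = e + 1 := ⟨d - 1, by omega⟩
    split_ifs with h h' h' <;> rw [rho_dvd hodd _ hd hd7, ← castK (k := k) (K := K)] at h <;>
      rw [tau_dvd _ _ hd hd7, div_pow, div_eq_one_iff_eq (pow_ne_zero _ h0)] at h'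
    · rw [PC_dbl_all c g hg α γ hE h13 d n hn h'.symm h]; simp [fu]
    · rw [PC_dbl_ne c g hg α γ hE h13 hα hγ d n hn (fun e => h' e.symm) h]; simp
    · rw [PC_dbl_eq c g hg α γ hE h13 hα hγ h0 d n hn h'.symm h]; simp
    · rw [PC_dbl_none c g hg α γ hE h13 hα hγ h0 d n (fun e => h' e.symm) h]; simp
  · intro h
    refine ⟨fun h' => hch 3 (by norm_num) (by norm_num) h (by rw [h']), fun h' => ?_⟩
    -- x^6=1 gives (x^2)^3 = 1
    have h6 : (γ/α)^6 = 1 := (tau_dvd _ 6 (by norm_num) (by norm_num)).1 (by rw [h'])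
    have h2 : (γ/α)^2 = 1 := hp 3 (by norm_num) ((rho_dvd hodd 3 (by omega) (by omega)).1 (by rw [h])) _ (by rw [← pow_mul]; exact h6)
    have := (tau_dvd _ 2 (by norm_num) (by norm_num)).2 h2
    rw [h'] at this
    revert this; decide
  · intro h h'; exact hch 5 (by norm_num) (by norm_num) h (by rw [h'])
  · intro h h'; exact hch 7 (by norm_num) (by norm_num) h (by rw [h'])

end vals
end T7

namespace T7
open Finset
set_option linter.unusedSectionVars false
set_option linter.unusedSimpArgs false

section vals
variable {k K : Type*} [Field k] [Fintype k] [Field K] [Algebra k K] [IsAlgClosed K]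

theorem two_neK (hodd : Odd (Fintype.card k)) : (2 : K) ≠ 0 := by
  have := two_ne hodd
  intro h; apply this
  have := (castK (k := k) (K := K) 2).1 (by exact_mod_cast h)
  exact_mod_cast this

theorem fix_pow {α : K} (hα : α ^ Fintype.card k = α) (n : ℕ) : α ^ (Fintype.card k ^ n) = α := by
  induction n with
  | zero => simp
  | succ n ih => rw [pow_succ, pow_mul, ih, hα]

theorem tau_constraints (h2 : (2 : K) ≠ 0) (x y z : K) (hx : x ≠ 1) (hy : y ≠ 1) (hz : z ≠ 1) (h : x * y * z = 1) :
    (∀ d ∈ [2,3,4,5,6,7], (tau x ∣ d → tau y ∣ d → tau z ∣ d) ∧ (tau y ∣ d → tau z ∣ d → tau x ∣ d) ∧ (tau x ∣ d → tau z ∣ d → tau y ∣ d))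
    ∧ ¬ (tau x = 4 ∧ tau y = 4 ∧ tau z = 4) ∧ 
    (tau x ∣ 6 → tau y ∣ 6 → tau z ∣ 6 → (if tau x ∣ 3 then (1:ℤ) else -1) * (if tau y ∣ 3 then (1:ℤ) else -1) * (if tau z ∣ 3 then (1:ℤ) else -1) = 1) := by
  have hm : (-1 : K) ≠ 1 := by
    intro h; apply h2; linear_combination -h
  refine ⟨?_, ?_, ?_⟩
  · intro d hd
    have hd' : 1 ≤ d ∧ d ≤ 7 := by
      simp at hd; omega
    rw [tau_dvd x d hd'.1 hd'.2, tau_dvd y d hd'.1 hd'.2, tau_dvd z d hd'.1 hd'.2]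
    have hp : x^d * y^d * z^d = 1 := by rw [← mul_pow, ← mul_pow, h, one_pow]
    refine ⟨fun a b => by simpa [a, b] using hp, fun a b => by simpa [a, b] using hp, fun a b => by simpa [a, b] using hp⟩
  · rintro ⟨a, b, c⟩
    have key : ∀ t : K, tau t = 4 → t^2 = -1 := by
      intro t ht
      have h4 : t^4 = 1 := (tau_dvd t 4 (by norm_num) (by norm_num)).1 (by rw [ht])
      have h2 : t^2 ≠ 1 := fun e => by
        have := (tau_dvd t 2 (by norm_num) (by norm_num)).2 e
        rw [ht] at this; revert this; decide
      have : (t^2 - 1) * (t^2 + 1) = 0 := by linear_combination h4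
      rcases mul_eq_zero.1 this with h | h
      · exact absurd (sub_eq_zero.1 h) h2
      · exact eq_neg_of_add_eq_zero_left h
    have hp : x^2 * y^2 * z^2 = 1 := by rw [← mul_pow, ← mul_pow, h, one_pow]
    rw [key x a, key y b, key z c] at hp
    apply hm; linear_combination hp
  · intro a b c
    have key : ∀ t : K, tau t ∣ 6 → t^3 = ((if tau t ∣ 3 then (1:ℤ) else -1 : ℤ) : K) := by
      intro t ht
      have h6 : t^6 = 1 := (tau_dvd t 6 (by norm_num) (by norm_num)).1 ht
      rw [apply_ite (fun z : ℤ => (z : K))]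
      split_ifs with h3
      · have := (tau_dvd t 3 (by norm_num) (by norm_num)).1 h3
        rw [this]; simp
      · have h3' : t^3 ≠ 1 := fun e => h3 ((tau_dvd t 3 (by norm_num) (by norm_num)).2 e)
        have : (t^3 - 1) * (t^3 + 1) = 0 := by linear_combination h6
        rcases mul_eq_zero.1 this with h | h
        · exact absurd (sub_eq_zero.1 h) h3'
        · rw [eq_neg_of_add_eq_zero_left h]; simp
    have hp : x^3 * y^3 * z^3 = 1 := by rw [← mul_pow, ← mul_pow, h, one_pow]
    rw [key x a, key y b, key z c] at hp
    by_cases A : tau x ∣ 3 <;> by_cases B : tau y ∣ 3 <;> by_cases C : tau z ∣ 3 <;> simp [A, B, C] at hp ⊢ <;> exact hm hp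

theorem NS_split (h3 : 3 ≤ Fintype.card k) (hodd : Odd (Fintype.card k)) (c : Fin 3 → k) (g : Matrix.GeneralLinearGroup (Fin 3) k) (hg : g.val = cm c)
    (α β γ : K) (hE : isE c α β γ) (h12 : α ≠ β) (h23 : β ≠ γ) (h13 : α ≠ γ)
    (a0 : α ≠ 0) (b0 : β ≠ 0) (c0 : γ ≠ 0)
    (hα : α ^ Fintype.card k = α) (hβ : β ^ Fintype.card k = β) (hγ : γ ^ Fintype.card k = γ) :
    (NS k K g : ℚ) = psi (Fintype.card k) (tau (α / β)) + psi (Fintype.card k) (tau (β / γ)) + psi (Fintype.card k) (tau (γ / α))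
      + chi (Fintype.card k) (tau (α/β)) (tau (β/γ)) + chi (Fintype.card k) (tau (β/γ)) (tau (γ/α)) + chi (Fintype.card k) (tau (γ/α)) (tau (α/β)) := by
  classical
  have hx : α / β ≠ 1 := by rw [Ne, div_eq_one_iff_eq b0]; exact h12
  have hy : β / γ ≠ 1 := by rw [Ne, div_eq_one_iff_eq c0]; exact h23
  have hz : γ / α ≠ 1 := by rw [Ne, div_eq_one_iff_eq a0]; exact h13.symm
  obtain ⟨H, H4, H6⟩ := tau_constraints (two_neK hodd) _ _ _ hx hy hz (by field_simp)
  rw [NS_eq k K h3, ← NP6 _ _ _ _ (two_le_tau _ hx) (tau_le _) (two_le_tau _ hy) (tau_le _) (two_le_tau _ hz) (tau_le _) H H4 H6]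
  apply NP_congr
  intro d n hd hd7 hn
  unfold P6
  have e1 : tau (α/β) ∣ d ↔ α^d = β^d := by rw [tau_dvd _ _ hd hd7, div_pow, div_eq_one_iff_eq (pow_ne_zero _ b0)]
  have e2 : tau (β/γ) ∣ d ↔ β^d = γ^d := by rw [tau_dvd _ _ hd hd7, div_pow, div_eq_one_iff_eq (pow_ne_zero _ c0)]
  have e3 : tau (γ/α) ∣ d ↔ γ^d = α^d := by rw [tau_dvd _ _ hd hd7, div_pow, div_eq_one_iff_eq (pow_ne_zero _ a0)]
  split_ifs with h1 h2 h2 h3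
  · rw [PC_dist_all c g hg α β γ hE h12 h23 h13 d n hn (e1.1 h1) (e2.1 h2)]; simp [fu]
  · rw [PC_dist_two c g hg α β γ hE h12 h23 h13 d n hn (e1.1 h1) (fun h => h2 (e2.2 h))]; simp
  · rw [PC_dist_two c g hg β γ α (isE_rot hE) h23 h13.symm h12.symm d n hn (e2.1 h2)]; · simp
    intro h; exact h1 (e1.2 (h.symm.trans (e2.1 h2).symm))
  · rw [PC_dist_two c g hg γ α β (isE_rot (isE_rot hE)) h13.symm h12 h23.symm d n hn (e3.1 h3) (fun h => h1 (e1.2 h))]; simp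
  · rw [PC_dist_none c g hg α β γ hE h12 h23 h13 d n (fun h => h1 (e1.2 h)) (fun h => h2 (e2.2 h)) (fun h => h3 (e3.2 h.symm))]
    rw [Finset.filter_true_of_mem]
    · rw [Finset.card_eq_three.2 ⟨α, β, γ, h12, h13, h23, rfl⟩]; simp
    · intro x hx
      simp only [Finset.mem_insert, Finset.mem_singleton] at hx
      rcases hx with rfl | rfl | rfl <;> apply fix_pow <;> assumption

theorem per2 {δ : K} (hδ : δ ^ (Fintype.card k ^ 2) = δ) (hδ' : δ ^ Fintype.card k ≠ δ) (n : ℕ) :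
    δ ^ (Fintype.card k ^ n) = δ ↔ 2 ∣ n := by
  have key : ∀ j, δ ^ (Fintype.card k ^ (2 * j)) = δ := by
    intro j
    induction j with
    | zero => simp
    | succ j ih => rw [mul_add, pow_add, pow_mul, ih, mul_one, hδ]
  rcases Nat.even_or_odd' n with ⟨j, rfl | rfl⟩
  · simp [key j]
  · rw [pow_succ, pow_mul, key j]
    constructor
    · intro h; exact absurd h hδ'
    · intro h; omega

theorem per3 {δ : K} (hδ : δ ^ (Fintype.card k ^ 3) = δ) (hδ' : δ ^ Fintype.card k ≠ δ) (n : ℕ) :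
    δ ^ (Fintype.card k ^ n) = δ ↔ 3 ∣ n := by
  have key : ∀ j, δ ^ (Fintype.card k ^ (3 * j)) = δ := by
    intro j
    induction j with
    | zero => simp
    | succ j ih => rw [mul_add, pow_add, pow_mul, ih, mul_one, hδ]
  have h2 : δ ^ (Fintype.card k ^ 2) ≠ δ := by
    intro h
    apply hδ'
    have : δ ^ (Fintype.card k ^ 3) = δ ^ Fintype.card k := by rw [pow_succ, pow_mul, h]
    rw [← this, hδ]
  obtain ⟨j, hj⟩ : ∃ j, n = 3 * j ∨ n = 3 * j + 1 ∨ n = 3 * j + 2 := ⟨n / 3, by omega⟩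
  rcases hj with rfl | rfl | rfl
  · simp [key j]
  · rw [pow_succ, pow_mul, key j]
    constructor
    · intro h; exact absurd h hδ'
    · intro h; omega
  · rw [pow_add, pow_mul, key j]
    constructor
    · intro h; exact absurd h h2
    · intro h; omega

theorem gcd_facts (m e : ℕ) (h2 : 2 ∣ e) (hm : ¬ m ∣ e) (h1 : 1 ≤ m) (h7 : m ≤ 7) :
    (m = 3 ∧ m / Nat.gcd m e = 3) ∨ (m = 4 ∧ m / Nat.gcd m e = 2) ∨ (m = 5 ∧ m / Nat.gcd m e = 5) ∨ (m = 6 ∧ m / Nat.gcd m e = 3)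
     ∨ (m = 7 ∧ m / Nat.gcd m e = 7) := by
  rw [Nat.gcd_rec]
  have hr : e % m < m := Nat.mod_lt _ (by omega)
  have hr' : e % m ≠ 0 := fun h => hm (Nat.dvd_of_mod_eq_zero h)
  have hpar : (2 ∣ m) → 2 ∣ e % m := fun h => (Nat.dvd_mod_iff h).2 h2
  generalize e % m = s at *
  clear hm h2
  interval_cases m <;> interval_cases s <;> revert hr' hpar <;> decide

theorem tau_combo (x : K) (e : ℕ) (h2 : 2 ∣ e) (he : e ≠ 0) (hx : x^e ≠ 1) :
    tau x = 8 ∨ (tau (x^e) = 3 ∧ tau x = 3) ∨ (tau (x^e) = 2 ∧ tau x = 4) ∨ (tau (x^e) = 5 ∧ tau x = 5) ∨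
     (tau (x^e) = 3 ∧ tau x = 6) ∨ (tau (x^e) = 7 ∧ tau x = 7) := by
  by_cases h : orderOf x ≤ 7 ∧ orderOf x ≠ 0
  · have ht : tau x = orderOf x := if_pos h
    have hd : ¬ orderOf x ∣ e := fun hd => hx (orderOf_dvd_iff_pow_eq_one.1 hd)
    have ho := orderOf_pow' x he
    right
    rw [ht]
    have := gcd_facts _ e h2 hd (by omega) h.1
    rw [← ho] at this
    rcases this with ⟨a, b⟩ | ⟨a, b⟩ | ⟨a, b⟩ | ⟨a, b⟩ | ⟨a, b⟩ <;> rw [tau_eq_iff _ _ (by norm_num) (by norm_num), tau_eq_iff _ _ (by norm_num) (by norm_num), tau_eq_iff _ _ (by norm_num) (by norm_num), tau_eq_iff _ _ (by norm_num) (by norm_num)] <;> omega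
  · left; exact if_neg h

theorem NS_lq (h3 : 3 ≤ Fintype.card k) (hodd : Odd (Fintype.card k)) (c : Fin 3 → k) (g : Matrix.GeneralLinearGroup (Fin 3) k) (hg : g.val = cm c)
    (a δ : K) (hE : isE c (a*δ) (a*δ^Fintype.card k) a) (a0 : a ≠ 0) (ha : a ^ Fintype.card k = a)
    (hδ : δ ^ (Fintype.card k ^ 2) = δ) (hδ' : δ ^ Fintype.card k ≠ δ) :
    (NS k K g : ℚ) = f7a (Fintype.card k) (tau (δ ^ (Fintype.card k - 1))) + f7b (Fintype.card k) (tau δ) := by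
  classical
  set q := Fintype.card k with hq
  have d0 : δ ≠ 0 := by rintro rfl; apply hδ'; rw [zero_pow (by omega)]
  have hq1 : δ ^ (q-1) * δ = δ^q := by rw [← pow_succ]; congr 1; omega
  have hx : δ ^ (q-1) ≠ 1 := by intro h; rw [h, one_mul] at hq1; exact hδ' hq1.symm
  have h12 : a * δ ≠ a * δ^q := fun h => hδ' (mul_left_cancel₀ a0 h).symm
  have h13 : a * δ ≠ a := by
    intro h
    have : δ = 1 := mul_left_cancel₀ a0 (by rw [h, mul_one])
    apply hδ'; rw [this, one_pow]
  have h23 : a * δ^q ≠ a := by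
    intro h
    have : δ^q = 1 := mul_left_cancel₀ a0 (by rw [h, mul_one])
    have h1 : δ = 1 := by rw [← hδ, pow_two, pow_mul, this, one_pow]
    apply hδ'; rw [h1, one_pow]
  rw [NS_eq k K h3, ← NP7 _ _ _ (two_le_tau _ hx) (tau_le _) (tau_combo δ (q-1) (by obtain ⟨j, hj⟩ := hodd; omega) (by omega) hx)]
  apply NP_congr
  intro d n hd hd7 hn
  have e1 : tau δ ∣ d ↔ (a*δ)^d = a^d := by
    rw [tau_dvd _ _ hd hd7, mul_pow, mul_eq_left₀ (pow_ne_zero _ a0)]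
  have e1' : tau δ ∣ d ↔ (a*δ^q)^d = a^d := by
    rw [tau_dvd _ _ hd hd7, mul_pow, mul_eq_left₀ (pow_ne_zero _ a0)]
    constructor
    · intro h; rw [← pow_mul, mul_comm, pow_mul, h, one_pow]
    · intro h
      have : ((δ^q)^d)^q = δ^d := by rw [← pow_mul, mul_comm d q, pow_mul, ← pow_mul δ q q, ← pow_two, hδ]
      rw [← this, h, one_pow]
  have e2 : tau (δ^(q-1)) ∣ d ↔ (a*δ)^d = (a*δ^q)^d := by
    rw [tau_dvd _ _ hd hd7, ← hq1, mul_pow, mul_pow, mul_pow, ← mul_assoc, mul_right_comm, eq_comm (b := _ * (δ ^ (q - 1)) ^ d),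
     mul_eq_left₀ (mul_ne_zero (pow_ne_zero _ a0) (pow_ne_zero _ d0))]
  split_ifs with h1 h2 h4
  · rw [PC_dist_all c g hg _ _ _ hE h12 h23 h13 d n hn ((e1.1 h1).trans (e1'.1 h1).symm) (e1'.1 h1)]; simp [fu, ← hq]
  · rw [PC_dist_two c g hg _ _ _ hE h12 h23 h13 d n hn (e2.1 h2) (fun h => h1 (e1'.2 h))]; simp [← hq]
  all_goals
    rw [PC_dist_none c g hg _ _ _ hE h12 h23 h13 d n (fun h => h2 (e2.2 h)) (fun h => h1 (e1'.2 h)) (fun h => h1 (e1.2 h))]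
    have fa := fix_pow (k := k) ha n
    have fd : (a*δ) ^ (q^n) = a*δ ↔ 2 ∣ n := by
      rw [mul_pow, fa, ← per2 hδ hδ' n]
      exact ⟨fun h => mul_left_cancel₀ a0 h, fun h => by rw [h]⟩
    have fd' : (a*δ^q) ^ (q^n) = a*δ^q ↔ 2 ∣ n := by
      rw [mul_pow, fa, ← per2 hδ hδ' n]
      constructor
      · intro h
        have h' := mul_left_cancel₀ a0 h
        have : (δ ^ (q^n))^(q^1) = δ^(q^1) := by rw [pow_one, ← pow_mul, mul_comm, pow_mul]; exact h'
        exact frn_inj 1 this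
      · intro h; rw [← pow_mul δ, mul_comm q, pow_mul, hq, h]
  · rw [Finset.filter_true_of_mem]
    · rw [Finset.card_eq_three.2 ⟨_, _, _, h12, h13, h23, rfl⟩]; simp
    · intro x hx
      simp only [Finset.mem_insert, Finset.mem_singleton] at hx
      rcases hx with rfl | rfl | rfl
      · exact fd.2 h4
      · exact fd'.2 h4
      · exact fa
  · have : ({a*δ, a*δ^q, a} : Finset K).filter (fun x => x ^ (q^n) = x) = {a} := by
      ext x
      simp only [Finset.mem_filter, Finset.mem_insert, Finset.mem_singleton]
      constructor
      · rintro ⟨rfl | rfl | rfl, h⟩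
        · exact absurd (fd.1 h) h4
        · exact absurd (fd'.1 h) h4
        · rfl
      · rintro rfl; exact ⟨by simp, fa⟩
    rw [this]; simp

theorem NS_irr (h3 : 3 ≤ Fintype.card k) (c : Fin 3 → k) (g : Matrix.GeneralLinearGroup (Fin 3) k) (hg : g.val = cm c)
    (α : K) (hE : isE c α (α^Fintype.card k) (α^(Fintype.card k^2))) 
    (hδ : α ^ (Fintype.card k ^ 3) = α) (hδ' : α ^ Fintype.card k ≠ α) :
    (NS k K g : ℚ) = f8 (Fintype.card k) (tau (α ^ (Fintype.card k - 1))) := by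
  classical
  set q := Fintype.card k with hq
  have d0 : α ≠ 0 := by rintro rfl; apply hδ'; rw [zero_pow (by omega)]
  have hq1 : α ^ (q-1) * α = α^q := by rw [← pow_succ]; congr 1; omega
  have hx : α ^ (q-1) ≠ 1 := by intro h; rw [h, one_mul] at hq1; exact hδ' hq1.symm
  have p3 := per3 (k := k) hδ hδ'
  have h12 : α ≠ α^q := fun h => hδ' h.symm
  have h13 : α ≠ α^(q^2) := fun h => by have := (p3 2).1 h.symm; omega
  have h23 : α^q ≠ α^(q^2) := by
    intro h
    apply hδ'
    have : α ^ (q^1) = (α^q) ^ (q^1) := by rw [pow_one, ← pow_mul, ← pow_two]; exact h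
    exact (frn_inj 1 this).symm
  have hord : α ^ (q-1) ^ 1 ≠ 0 := pow_ne_zero _ d0
  have hodd3 : (α ^ (q-1)) ^ (q^2+q+1) = 1 := by
    have : α ^ ((q-1) * (q^2+q+1)) * α = α := by
      rw [← pow_succ]
      have : (q-1) * (q^2+q+1) + 1 = q^3 := by
        clear_value q
        obtain ⟨j, rfl⟩ : ∃ j, q = j + 1 := ⟨q - 1, by omega⟩
        rw [Nat.add_sub_cancel]; ring
      rw [this, hδ]
    rw [← pow_mul]
    exact mul_right_cancel₀ d0 (by rw [this, one_mul])
  have hm : tau (α ^ (q-1)) = 3 ∨ tau (α ^ (q-1)) = 7 ∨ tau (α ^ (q-1)) = 8 := by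
    have h1 := two_le_tau _ hx
    have h2 := tau_le (α ^ (q-1))
    by_contra hcon
    have hne8 : tau (α ^ (q-1)) ≠ 8 := fun h => hcon (by simp [h])
    have ht : orderOf (α ^ (q-1)) = tau (α ^ (q-1)) := ((tau_eq_iff _ _ (by omega) (by omega)).1 rfl)
    have hdvd := orderOf_dvd_iff_pow_eq_one.2 hodd3
    rw [ht] at hdvd
    have : tau (α ^ (q-1)) = 2 ∨ tau (α ^ (q-1)) = 4 ∨ tau (α ^ (q-1)) = 6 ∨ tau (α ^ (q-1)) = 5 := by omega
    have ev : ¬ 2 ∣ q^2+q+1 := by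
      have : Even (q^2+q) := by rw [show q^2+q = q * (q+1) by ring]; exact Nat.even_mul_succ_self q
      obtain ⟨j, hj⟩ := this
      omega
    rcases this with h | h | h | h <;> rw [h] at hdvd
    · exact ev hdvd
    · exact ev (dvd_trans (by norm_num) hdvd)
    · exact ev (dvd_trans (by norm_num) hdvd)
    · have h5 : q % 5 < 5 := Nat.mod_lt _ (by norm_num)
      have := Nat.mod_eq_zero_of_dvd hdvd
      rw [Nat.add_mod, Nat.add_mod (q^2), Nat.pow_mod] at this
      generalize q % 5 = s at *
      interval_cases s <;> revert this <;> decide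
  rw [NS_eq k K h3, ← NP8 _ _ hm]
  apply NP_congr
  intro d n hd hd7 hn
  have e2 : tau (α^(q-1)) ∣ d ↔ α^d = (α^q)^d := by
    rw [tau_dvd _ _ hd hd7, ← hq1, mul_pow, eq_comm (a := α^d), mul_eq_right₀ (pow_ne_zero _ d0)]
  have fr : ∀ x y : K, x^d = y^d ↔ (x^q)^d = (y^q)^d := by
    intro x y
    rw [← pow_mul, ← pow_mul, mul_comm, pow_mul, pow_mul]
    constructor
    · intro h; rw [h]
    · intro h; exact frn_inj (k := k) 1 (by rw [pow_one]; exact h)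
  have e3 : α^d = (α^q)^d ↔ (α^q)^d = (α^(q^2))^d := by
    rw [fr, pow_two, pow_mul]
  have e4 : (α^(q^2))^d = α^d ↔ α^d = (α^q)^d := by
    rw [fr]
    have : (α^(q^2))^q = α := by rw [← pow_mul, ← pow_succ, hδ]
    rw [this]
  split_ifs with h1 h2
  · rw [PC_dist_all c g hg _ _ _ hE h12 h23 h13 d n hn (e2.1 h1) (e3.1 (e2.1 h1))]; simp [fu, ← hq]
  all_goals
    have h1' := fun h => h1 (e2.2 h)
    rw [PC_dist_none c g hg _ _ _ hE h12 h23 h13 d n h1' (fun h => h1' (e3.2 h)) (fun h => h1' (e4.1 h.symm))]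
    have f1 := p3 n
    have f2 : ∀ j, (α^(q^j)) ^ (q^n) = α^(q^j) ↔ 3 ∣ n := by
      intro j
      rw [← f1]
      constructor
      · intro h
        apply frn_inj (k := k) j
        rw [← pow_mul, mul_comm, pow_mul]; exact h
      · intro h; rw [← pow_mul, mul_comm, pow_mul, h]
  · rw [Finset.filter_true_of_mem]
    · rw [Finset.card_eq_three.2 ⟨_, _, _, h12, h13, h23, rfl⟩]; simp
    · intro x hx
      simp only [Finset.mem_insert, Finset.mem_singleton] at hx
      rcases hx with rfl | rfl | rfl
      · exact f1.2 h2
      · have := f2 1; rw [pow_one] at this; exact this.2 h2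
      · exact (f2 2).2 h2
  · rw [Finset.filter_false_of_mem]
    · simp
    · intro x hx
      simp only [Finset.mem_insert, Finset.mem_singleton] at hx
      rcases hx with rfl | rfl | rfl
      · exact fun h => h2 (f1.1 h)
      · have := f2 1; rw [pow_one] at this; exact fun h => h2 (this.1 h)
      · exact fun h => h2 ((f2 2).1 h)

end vals
end T7

namespace T7
open Finset
set_option linter.unusedSectionVars false
set_option linter.unusedSimpArgs false

section struct
variable {k : Type*} [Field k]
open Matrix

/-- cocyclicity determinant of a row vector -/
def cd (M : Matrix (Fin 3) (Fin 3) k) (w : Fin 3 → k) : k := d3 w (w ᵥ* M) ((w ᵥ* M) ᵥ* M)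

theorem vecMul_r1 (a : k) (u w v : Fin 3 → k) : v ᵥ* (r1 a u w) = a • v + (v ⬝ᵥ u) • w := by
  unfold r1
  funext i
  fin_cases i <;> simp [Matrix.vecMul, Matrix.vecMulVec, dotProduct, Fin.sum_univ_three, Matrix.one_apply] <;> ring

theorem cd_r1 (a : k) (u w v : Fin 3 → k) : cd (r1 a u w) v = 0 := by
  unfold cd
  rw [vecMul_r1, vecMul_r1]
  simp [d3]; ring

theorem scalar_of_dep (M : Matrix (Fin 3) (Fin 3) k) (h : ∀ w x, d3 w (w ᵥ* M) x = 0) :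
    M = (M 0 0) • (1 : Matrix (Fin 3) (Fin 3) k) := by
  have a1 := h ![1,0,0] ![0,1,0]
  have a2 := h ![1,0,0] ![0,0,1]
  have b1 := h ![0,1,0] ![1,0,0]
  have b2 := h ![0,1,0] ![0,0,1]
  have c1 := h ![0,0,1] ![1,0,0]
  have c2 := h ![0,0,1] ![0,1,0]
  have e1 := h ![1,1,0] ![0,0,1]
  have e2 := h ![1,0,1] ![0,1,0]
  simp [d3, Matrix.vecMul, dotProduct, Fin.sum_univ_three] at a1 a2 b1 b2 c1 c2 e1 e2
  ext i j
  fin_cases i <;> fin_cases j <;> simp [*]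
  · linear_combination e1 + b2 - a2
  · linear_combination -e2 + c2 - a1

theorem r1_of_noncyc (M : Matrix (Fin 3) (Fin 3) k) (h : ∀ w, cd M w = 0) : ∃ a u w, M = r1 a u w := by
  by_cases hs : ∀ w x, d3 w (w ᵥ* M) x = 0
  · refine ⟨M 0 0, 0, 0, ?_⟩
    conv_lhs => rw [scalar_of_dep M hs]
    simp [r1]
  push Not at hs
  obtain ⟨w, x0, hx0⟩ := hs
  obtain ⟨r0, s, μ, hx0M⟩ := d3_span _ _ _ hx0 (x0 ᵥ* M)
  obtain ⟨p0, p1, p2, hwM⟩ := d3_span _ _ _ hx0 ((w ᵥ* M) ᵥ* M)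
  have hp2 : p2 = 0 := by
    have := h w
    unfold cd at this
    rw [hwM] at this
    have h' : p2 * d3 w (w ᵥ* M) x0 = 0 := by
      rw [← this]; simp [d3]; ring
    exact (mul_eq_zero.1 h').resolve_right hx0
  obtain ⟨x, hx⟩ : ∃ x, x = x0 - s • w := ⟨_, rfl⟩
  obtain ⟨w1, hw1⟩ : ∃ w1, w1 = w ᵥ* M := ⟨_, rfl⟩
  obtain ⟨r, hr⟩ : ∃ r, r = r0 + μ * s := ⟨_, rfl⟩
  have hxM : x ᵥ* M = μ • x + r • w := by
    rw [hx, Matrix.sub_vecMul, hx0M, Matrix.smul_vecMul, hr]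
    funext i; simp; ring
  rw [← hw1] at hwM hx0
  rw [hp2, zero_smul, add_zero] at hwM
  have hD : d3 w w1 x ≠ 0 := by
    have : d3 w w1 x = d3 w w1 x0 := by rw [hx]; simp [d3]; ring
    rwa [this]
  have hr0 : r = 0 := by
    have := h x
    unfold cd at this
    rw [hxM, Matrix.add_vecMul, Matrix.smul_vecMul, Matrix.smul_vecMul, hxM, ← hw1] at this
    have h' : (r * r) * d3 w w1 x = 0 := by
      rw [← this]; simp [d3]; ring
    exact mul_self_eq_zero.1 ((mul_eq_zero.1 h').resolve_right hD)
  rw [hr0, zero_smul, add_zero] at hxM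
  have hp : μ^2 - p1 * μ - p0 = 0 := by
    have := h (w + x)
    unfold cd at this
    rw [Matrix.add_vecMul, hxM, ← hw1, Matrix.add_vecMul, Matrix.smul_vecMul, hxM, hwM] at this
    have h' : (μ^2 - p1 * μ - p0) * d3 w w1 x = 0 := by
      rw [← this]; simp [d3]; ring
    exact (mul_eq_zero.1 h').resolve_right hD
  have key : ∀ i, ∃ l : k, (Pi.single i 1) ᵥ* M = μ • (Pi.single i 1) + l • (w1 - μ • w) := by
    intro i
    obtain ⟨X, Y, Z, hv⟩ := d3_span _ _ _ hD (Pi.single i 1)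
    refine ⟨X + (p1 - μ) * Y, ?_⟩
    rw [hv, Matrix.add_vecMul, Matrix.add_vecMul, Matrix.smul_vecMul, Matrix.smul_vecMul, Matrix.smul_vecMul, hxM, hwM, ← hw1]
    funext j
    simp
    linear_combination (- Y * w j) * hp
  choose u hu using key
  refine ⟨μ, u, w1 - μ • w, ?_⟩
  ext i j
  have := congrFun (hu i) j
  rw [Matrix.single_one_vecMul] at this
  simp [Matrix.row] at this
  rw [this]
  simp [r1, Matrix.vecMulVec, Matrix.one_apply, Pi.single_apply, eq_comm]

theorem r1_det (a : k) (u w : Fin 3 → k) : (r1 a u w).det = a * a * (a + w ⬝ᵥ u) := by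
  rw [Matrix.det_fin_three]
  simp [r1, Matrix.vecMulVec, Matrix.one_apply, dotProduct, Fin.sum_univ_three]
  ring

theorem r1_inj_a {a a' : k} {u w u' w' : Fin 3 → k} (h : r1 a u w = r1 a' u' w') : a = a' := by
  have h' : (a' - a) • (1 : Matrix (Fin 3) (Fin 3) k) = Matrix.vecMulVec u w - Matrix.vecMulVec u' w' := by
    unfold r1 at h
    rw [sub_smul, sub_eq_sub_iff_add_eq_add, ← h]; abel
  have := congrArg Matrix.det h'
  rw [Matrix.det_fin_three, Matrix.det_fin_three] at this
  simp [Matrix.vecMulVec, Matrix.one_apply] at this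
  have h3 : (a' - a)^3 = 0 := by
    rw [show (a'-a)^3 = (a' - a) * (a' - a) * (a' - a) by ring, this]; ring
  exact (sub_eq_zero.1 (pow_eq_zero_iff (by norm_num) |>.1 h3)).symm

theorem r1_inj {a a' : k} {u w u' w' : Fin 3 → k} (hu : u ≠ 0) (hw : w ≠ 0) (h : r1 a u w = r1 a' u' w') (hu' : u' ≠ 0) :
   a = a' ∧ ∃ t : k, t ≠ 0 ∧ u' = t⁻¹ • u ∧ w' = t • w := by
  have ha := r1_inj_a h
  refine ⟨ha, ?_⟩
  subst ha
  have h' : ∀ i j, u i * w j = u' i * w' j := by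
    intro i j
    have := congrFun (congrFun h i) j
    simpa [r1, Matrix.vecMulVec] using this
  obtain ⟨i, hi⟩ := Function.ne_iff.1 hu
  obtain ⟨j, hj⟩ := Function.ne_iff.1 hw
  simp at hi hj
  have hij : u' i * w' j ≠ 0 := by rw [← h']; exact mul_ne_zero hi hj
  have h1 := left_ne_zero_of_mul hij
  have h2 := right_ne_zero_of_mul hij
  refine ⟨w' j / w j, div_ne_zero h2 hj, ?_, ?_⟩
  · funext l
    simp
    field_simp
    linear_combination -(h' l j)
  · funext l
    have e1 := h' i l
    have e2 := h' i j
    simp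
    field_simp
    apply mul_left_cancel₀ h1
    linear_combination -e1 * w j + w l * e2

theorem r1_smul (a t : k) (u w : Fin 3 → k) (ht : t ≠ 0) : r1 a (t⁻¹ • u) (t • w) = r1 a u w := by
  unfold r1
  congr 1
  ext i j
  simp [Matrix.vecMulVec]
  field_simp

end struct
end T7

namespace T7
open Finset
set_option linter.unusedSectionVars false
set_option linter.unusedSimpArgs false

section struct
variable {k : Type*} [Field k] [Fintype k] [DecidableEq k]
open Matrix

/-- number of cocyclic vectors -/
noncomputable def cyc (M : Matrix (Fin 3) (Fin 3) k) : ℕ := (univ.filter (fun w : Fin 3 → k => cd M w ≠ 0)).card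

theorem cd_eq_det (M : Matrix (Fin 3) (Fin 3) k) (w : Fin 3 → k) :
    cd M w = (Matrix.of ![w, w ᵥ* M, (w ᵥ* M) ᵥ* M]).det := by
  rw [Matrix.det_fin_three]
  simp [cd, d3]; ring

theorem rows_conj (B : GL (Fin 3) k) (C : Matrix (Fin 3) (Fin 3) k) (w : Fin 3 → k) :
    (w ᵥ* B.val) ᵥ* (B⁻¹.val * C * B.val) = (w ᵥ* C) ᵥ* B.val := by
  rw [Matrix.vecMul_vecMul, Matrix.vecMul_vecMul]
  congr 1
  rw [← mul_assoc, ← mul_assoc, ← Units.val_mul, mul_inv_cancel, Units.val_one, one_mul]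

theorem cd_conj (B : GL (Fin 3) k) (C : Matrix (Fin 3) (Fin 3) k) (w : Fin 3 → k) :
    cd (B⁻¹.val * C * B.val) (w ᵥ* B.val) = cd C w * B.val.det := by
  rw [cd_eq_det, cd_eq_det, ← Matrix.det_mul]
  congr 1
  rw [rows_conj, rows_conj]
  ext i j
  fin_cases i <;> simp [Matrix.mul_apply, Matrix.vecMul, dotProduct, Fin.sum_univ_three] <;> ring

theorem det_ne (B : GL (Fin 3) k) : B.val.det ≠ 0 :=
  ((Matrix.isUnit_iff_isUnit_det _).1 B.isUnit).ne_zero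

theorem cyc_conj (B : GL (Fin 3) k) (C : Matrix (Fin 3) (Fin 3) k) :
    cyc (B⁻¹.val * C * B.val) = cyc C := by
  unfold cyc
  symm
  apply Finset.card_bij (fun w _ => w ᵥ* B.val)
  · intro w hw
    simp only [mem_filter, mem_univ, true_and] at hw ⊢
    rw [cd_conj]; exact mul_ne_zero hw (det_ne B)
  · intro w _ w' _ h
    have := congrArg (fun v => v ᵥ* B⁻¹.val) h
    simpa [Matrix.vecMul_vecMul, ← Units.val_mul] using this
  · intro w hw
    have hw' : (w ᵥ* B⁻¹.val) ᵥ* B.val = w := by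
      rw [Matrix.vecMul_vecMul, ← Units.val_mul, inv_mul_cancel, Units.val_one, Matrix.vecMul_one]
    refine ⟨w ᵥ* B⁻¹.val, ?_, hw'⟩
    simp only [mem_filter, mem_univ, true_and] at hw ⊢
    rw [← hw', cd_conj] at hw
    exact left_ne_zero_of_mul hw

theorem cm_rows (c : Fin 3 → k) : (Pi.single 0 1) ᵥ* cm c = Pi.single 1 1 ∧ (Pi.single 1 1) ᵥ* cm c = Pi.single 2 1
   ∧ (Pi.single 2 1) ᵥ* cm c = c := by
  refine ⟨?_, ?_, ?_⟩ <;> funext i <;> fin_cases i <;> simp [cm, Matrix.single_one_vecMul, Matrix.row]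

theorem cd_cm_e (c : Fin 3 → k) : cd (cm c) (Pi.single 0 1) = 1 := by
  unfold cd
  rw [(cm_rows c).1, (cm_rows c).2.1]
  simp [d3]

/-- the main double counting -/
theorem sum_cyc (H : Matrix (Fin 3) (Fin 3) k → ℚ) (hH : ∀ (B : GL (Fin 3) k) C, H (B⁻¹.val * C * B.val) = H C) :
    ∑ M, ∑ w : Fin 3 → k, (if cd M w ≠ 0 then H M else 0) = Fintype.card (GL (Fin 3) k) * ∑ c : Fin 3 → k, H (cm c) := by
  rw [← Finset.sum_product', ← Finset.sum_filter, ← Finset.card_univ, ← nsmul_eq_mul, ← Finset.sum_const, ← Finset.sum_product']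
  symm
  apply Finset.sum_bij (fun (p : GL (Fin 3) k × (Fin 3 → k)) _ => (p.1⁻¹.val * cm p.2 * p.1.val, (Pi.single 0 1 : Fin 3 → k) ᵥ* p.1.val))
  · rintro ⟨B, c⟩ _
    simp only [mem_filter, mem_univ, true_and, mem_product]
    rw [cd_conj, cd_cm_e, one_mul]
    simpa using det_ne B
  · rintro ⟨B, c⟩ _ ⟨B', c'⟩ _ h
    simp only [Prod.mk.injEq] at h
    obtain ⟨h1, h2⟩ := h
    have r1 := rows_conj B (cm c) (Pi.single 0 1)
    rw [h1, h2, rows_conj, (cm_rows c).1, (cm_rows c').1] at r1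
    have r2 := rows_conj B (cm c) (Pi.single 1 1)
    rw [h1, ← r1, rows_conj, (cm_rows c).2.1, (cm_rows c').2.1] at r2
    have hB : B = B' := by
      apply Units.ext
      ext i j
      rw [Matrix.single_one_vecMul, Matrix.single_one_vecMul] at h2 r1 r2
      fin_cases i
      · exact congrFun h2 j
      · exact (congrFun r1 j).symm
      · exact (congrFun r2 j).symm
    subst hB
    simp only [Prod.mk.injEq, true_and]
    have hC : cm c = cm c' := by
      have := congrArg (fun X => B.val * X * B⁻¹.val) h1
      simpa [mul_assoc, ← Units.val_mul] using this
    rw [← (cm_rows c).2.2, hC, (cm_rows c').2.2]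
  · rintro ⟨M, w⟩ hM
    simp only [mem_filter, mem_univ, true_and, mem_product] at hM
    rw [cd_eq_det] at hM
    obtain ⟨B, hB⟩ : ∃ B : GL (Fin 3) k, B.val = Matrix.of ![w, w ᵥ* M, (w ᵥ* M) ᵥ* M] :=
      ⟨Matrix.GeneralLinearGroup.mkOfDetNeZero _ hM, rfl⟩
    have b0 : (Pi.single 0 1 : Fin 3 → k) ᵥ* B.val = w := by rw [hB, Matrix.single_one_vecMul]; rfl
    have b1 : (Pi.single 1 1 : Fin 3 → k) ᵥ* B.val = w ᵥ* M := by rw [hB, Matrix.single_one_vecMul]; rfl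
    have b2 : (Pi.single 2 1 : Fin 3 → k) ᵥ* B.val = (w ᵥ* M) ᵥ* M := by rw [hB, Matrix.single_one_vecMul]; rfl
    have cancel : ∀ v, (v ᵥ* B.val) ᵥ* B⁻¹.val = v := by
      intro v
      rw [Matrix.vecMul_vecMul, ← Units.val_mul, mul_inv_cancel, Units.val_one, Matrix.vecMul_one]
    have hC : B.val * M * B⁻¹.val = cm ((Pi.single 2 1 : Fin 3 → k) ᵥ* (B.val * M * B⁻¹.val)) := by
      have e0 : (Pi.single 0 1 : Fin 3 → k) ᵥ* (B.val * M * B⁻¹.val) = Pi.single 1 1 := by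
        rw [← Matrix.vecMul_vecMul, ← Matrix.vecMul_vecMul, b0, ← b1, cancel]
      have e1 : (Pi.single 1 1 : Fin 3 → k) ᵥ* (B.val * M * B⁻¹.val) = Pi.single 2 1 := by
        rw [← Matrix.vecMul_vecMul, ← Matrix.vecMul_vecMul, b1, ← b2, cancel]
      generalize B.val * M * B⁻¹.val = X at *
      rw [Matrix.single_one_vecMul] at e0 e1 ⊢
      ext i j
      fin_cases i
      · have := congrFun e0 j
        fin_cases j <;> simpa [cm, Matrix.row] using this
      · have := congrFun e1 j
        fin_cases j <;> simpa [cm, Matrix.row] using this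
      · fin_cases j <;> simp [cm, Matrix.row]
    refine ⟨(B, (Pi.single 2 1 : Fin 3 → k) ᵥ* (B.val * M * B⁻¹.val)), by simp, ?_⟩
    simp only [Prod.mk.injEq]
    refine ⟨?_, b0⟩
    rw [← hC]
    simp only [mul_assoc, ← Units.val_mul]
    rw [inv_mul_cancel, Units.val_one, mul_one, ← mul_assoc, ← Units.val_mul, inv_mul_cancel, Units.val_one, one_mul]
  · rintro ⟨B, c⟩ _
    exact (hH B _).symm

theorem r1_fiber (M : Matrix (Fin 3) (Fin 3) k) (a : k) (u w : Fin 3 → k) (hu : u ≠ 0) (hw : w ≠ 0) (hM : M = r1 a u w) :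
    (univ.filter (fun p : k × (Fin 3 → k) × (Fin 3 → k) => p.2.1 ≠ 0 ∧ p.2.2 ≠ 0 ∧ M = r1 p.1 p.2.1 p.2.2)).card = Fintype.card k - 1 := by
  have : (univ.erase (0:k)).card = Fintype.card k - 1 := by rw [card_erase_of_mem (mem_univ _), card_univ]
  rw [← this]
  symm
  apply Finset.card_bij (fun t _ => (a, t⁻¹ • u, t • w))
  · intro t ht
    have ht : t ≠ 0 := by simpa using ht
    simp [hu, hw, ht, r1_smul, hM]
  · intro t _ t' _ h
    simp only [Prod.mk.injEq, true_and] at h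
    obtain ⟨j, hj⟩ := Function.ne_iff.1 hw
    have := congrFun h.2 j
    exact mul_right_cancel₀ hj this
  · rintro ⟨a', u', w'⟩ h
    simp only [mem_filter, mem_univ, true_and] at h
    obtain ⟨hu', hw', h⟩ := h
    obtain ⟨h1, t, ht, h2, h3⟩ := r1_inj hu hw (hM.symm.trans h) hu'
    exact ⟨t, by simpa using ht, by rw [h1, h2, h3]⟩

theorem sum_all (hq : 2 ≤ Fintype.card k) (N : Matrix (Fin 3) (Fin 3) k → ℚ) (hN : ∀ (B : GL (Fin 3) k) C, N (B⁻¹.val * C * B.val) = N C) :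
    ∑ M, N M = ∑ a : k, N (a • 1) + (∑ a : k, ∑ u : Fin 3 → k, ∑ w : Fin 3 → k, if u ≠ 0 ∧ w ≠ 0 then N (r1 a u w) else 0) / (Fintype.card k - 1)
     + Fintype.card (GL (Fin 3) k) * ∑ c : Fin 3 → k, N (cm c) / cyc (cm c) := by
  have hq1 : ((Fintype.card k : ℚ) - 1) ≠ 0 := by
    have : (2:ℚ) ≤ Fintype.card k := by exact_mod_cast hq
    linarith
  rw [← sum_cyc (fun M => N M / cyc M) (fun B C => by rw [hN, cyc_conj])]
  have e1 : ∑ a : k, N (a • 1) = ∑ M, ∑ a : k, if M = a • 1 then N M else 0 := by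
    rw [Finset.sum_comm]
    apply Finset.sum_congr rfl; intro a _
    simp
  have e2 : (∑ a : k, ∑ u : Fin 3 → k, ∑ w : Fin 3 → k, if u ≠ 0 ∧ w ≠ 0 then N (r1 a u w) else 0) = 
     ∑ M, ∑ p : k × (Fin 3 → k) × (Fin 3 → k), if p.2.1 ≠ 0 ∧ p.2.2 ≠ 0 ∧ M = r1 p.1 p.2.1 p.2.2 then N M else 0 := by
    conv_rhs => rw [Finset.sum_comm, Fintype.sum_prod_type]
    apply Finset.sum_congr rfl; intro a _
    rw [Fintype.sum_prod_type]
    apply Finset.sum_congr rfl; intro u _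
    apply Finset.sum_congr rfl; intro w _
    by_cases hu : u = 0 <;> by_cases hw : w = 0 <;> simp [hu, hw]
  rw [e1, e2, Finset.sum_div, ← Finset.sum_add_distrib, ← Finset.sum_add_distrib]
  apply Finset.sum_congr rfl
  intro M _
  rw [← Finset.sum_filter, ← Finset.sum_filter, ← Finset.sum_filter, Finset.sum_const, Finset.sum_const, Finset.sum_const,
    nsmul_eq_mul, nsmul_eq_mul, nsmul_eq_mul]
  change N M = _ + _ + (cyc M : ℚ) * _
  by_cases hc : cyc M = 0
  · have hc' : ∀ w, cd M w = 0 := by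
      intro w
      by_contra hw
      unfold cyc at hc
      rw [Finset.card_eq_zero, Finset.filter_eq_empty_iff] at hc
      exact hc (mem_univ w) hw
    obtain ⟨a, u, w, hM⟩ := r1_of_noncyc M hc'
    by_cases hs : u = 0 ∨ w = 0
    · have hM' : M = a • 1 := by rw [hM, r1]; rcases hs with rfl | rfl <;> simp
      have c1 : (univ.filter (fun a : k => M = a • 1)) = {a} := by
        ext b
        simp only [mem_filter, mem_univ, true_and, mem_singleton, hM']
        constructor
        · intro h
          have := congrFun (congrFun h 0) 0
          simpa [eq_comm] using this
        · rintro rfl; rfl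
      have c2 : (univ.filter (fun p : k × (Fin 3 → k) × (Fin 3 → k) => p.2.1 ≠ 0 ∧ p.2.2 ≠ 0 ∧ M = r1 p.1 p.2.1 p.2.2)) = ∅ := by
        rw [Finset.filter_eq_empty_iff]
        rintro ⟨b, u', w'⟩ _ ⟨h1, h2, h3⟩
        have h4 : r1 b u' w' = r1 a 0 0 := by rw [← h3, hM']; simp [r1]
        have := r1_inj_a h4
        subst this
        obtain ⟨i, hi⟩ := Function.ne_iff.1 h1
        obtain ⟨j, hj⟩ := Function.ne_iff.1 h2
        have := congrFun (congrFun h4 i) j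
        simp [r1, Matrix.vecMulVec] at this
        rcases this with h | h
        · exact hi h
        · exact hj h
      rw [c1, c2, hc]; simp
    · push Not at hs
      have c1 : (univ.filter (fun a : k => M = a • 1)) = ∅ := by
        rw [Finset.filter_eq_empty_iff]
        intro b _ hb
        have h4 : r1 a u w = r1 b 0 0 := by rw [← hM, hb]; simp [r1]
        have := r1_inj_a h4
        subst this
        obtain ⟨i, hi⟩ := Function.ne_iff.1 hs.1
        obtain ⟨j, hj⟩ := Function.ne_iff.1 hs.2
        have := congrFun (congrFun h4 i) j
        simp [r1, Matrix.vecMulVec] at this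
        rcases this with h | h
        · exact hi h
        · exact hj h
      rw [c1, r1_fiber M a u w hs.1 hs.2 hM, hc, Nat.cast_sub (by omega)]
      simp
      field_simp
  · obtain ⟨w, hw⟩ : ∃ w, cd M w ≠ 0 := by
      by_contra hcon
      push Not at hcon
      apply hc
      unfold cyc
      rw [Finset.card_eq_zero, Finset.filter_eq_empty_iff]
      intro w _; simpa using hcon w
    have c1 : (univ.filter (fun a : k => M = a • 1)) = ∅ := by
      rw [Finset.filter_eq_empty_iff]
      intro b _ hb
      apply hw
      have : M = r1 b 0 0 := by rw [hb]; simp [r1]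
      rw [this, cd_r1]
    have c2 : (univ.filter (fun p : k × (Fin 3 → k) × (Fin 3 → k) => p.2.1 ≠ 0 ∧ p.2.2 ≠ 0 ∧ M = r1 p.1 p.2.1 p.2.2)) = ∅ := by
      rw [Finset.filter_eq_empty_iff]
      rintro ⟨b, u', w'⟩ _ ⟨h1, h2, h3⟩
      apply hw
      rw [h3, cd_r1]
    rw [c1, c2]
    have : (cyc M : ℚ) ≠ 0 := by exact_mod_cast hc
    simp
    field_simp

end struct
end T7

namespace T7
open Finset
set_option linter.unusedSectionVars false
set_option linter.unusedSimpArgs false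
set_option linter.unusedVariables false

section roots
variable {k K : Type*} [Field k] [Fintype k] [Field K] [Algebra k K] [IsAlgClosed K]

theorem isE_exists_roots (c : Fin 3 → k) : ∃ α β γ : K, isE c α β γ := by
  set c0 := algebraMap k K (c 0) with h0
  set c1 := algebraMap k K (c 1) with h1
  set c2 := algebraMap k K (c 2) with h2
  obtain ⟨α, hα⟩ := IsAlgClosed.exists_root (Polynomial.C 1 * Polynomial.X^3 + Polynomial.C (-c2) * Polynomial.X^2 + Polynomial.C (-c1) * Polynomial.X + Polynomial.C (-c0) : Polynomial K)
    (by rw [Polynomial.degree_cubic one_ne_zero]; decide)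
  obtain ⟨β, hβ⟩ := IsAlgClosed.exists_root (Polynomial.C 1 * Polynomial.X^2 + Polynomial.C (-(c2 - α)) * Polynomial.X + Polynomial.C (-c1 - α * (c2 - α)) : Polynomial K)
    (by rw [Polynomial.degree_quadratic one_ne_zero]; decide)
  simp [Polynomial.IsRoot] at hα hβ
  refine ⟨α, β, c2 - α - β, ?_, ?_, ?_⟩
  · rw [← h0]; linear_combination -hα + α * hβ
  · rw [← h1]; linear_combination -hβ
  · rw [← h2]; ring

/-- `(x,y,z)` is a permutation of `(α,β,γ)` -/
def isPm (x y z α β γ : K) : Prop :=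
  (x = α ∧ y = β ∧ z = γ) ∨ (x = α ∧ y = γ ∧ z = β) ∨ (x = β ∧ y = α ∧ z = γ) ∨ (x = β ∧ y = γ ∧ z = α) ∨
  (x = γ ∧ y = α ∧ z = β) ∨ (x = γ ∧ y = β ∧ z = α)

theorem two_perm {y z β γ : K} (h1 : y + z = β + γ) (h2 : y * z = β * γ) : (y = β ∧ z = γ) ∨ (y = γ ∧ z = β) := by
  have : (y - β) * (y - γ) = 0 := by linear_combination y * h1 - h2
  rcases mul_eq_zero.1 this with h | h
  · left; exact ⟨sub_eq_zero.1 h, by linear_combination h1 - h⟩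
  · right; exact ⟨sub_eq_zero.1 h, by linear_combination h1 - h⟩

theorem perm3 {x y z α β γ : K} (h1 : x + y + z = α + β + γ) (h2 : x*y+y*z+x*z = α*β+β*γ+α*γ) (h3 : x*y*z = α*β*γ) :
    isPm x y z α β γ := by
  have : (x - α) * ((x - β) * (x - γ)) = 0 := by linear_combination x^2 * h1 - x * h2 + h3
  rcases mul_eq_zero.1 this with h | h
  · have hx := sub_eq_zero.1 h; subst hx
    rcases two_perm (y := y) (z := z) (β := β) (γ := γ) (by linear_combination h1) (by linear_combination h2 - x * h1) with h | h
    · exact Or.inl ⟨rfl, h⟩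
    · exact Or.inr (Or.inl ⟨rfl, h⟩)
  rcases mul_eq_zero.1 h with h | h
  · have hx := sub_eq_zero.1 h; subst hx
    rcases two_perm (y := y) (z := z) (β := α) (γ := γ) (by linear_combination h1) (by linear_combination h2 - x * h1) with h | h
    · exact Or.inr (Or.inr (Or.inl ⟨rfl, h⟩))
    · exact Or.inr (Or.inr (Or.inr (Or.inl ⟨rfl, h⟩)))
  · have hx := sub_eq_zero.1 h; subst hx
    rcases two_perm (y := y) (z := z) (β := α) (γ := β) (by linear_combination h1) (by linear_combination h2 - x * h1) with h | h
    · exact Or.inr (Or.inr (Or.inr (Or.inr (Or.inl ⟨rfl, h⟩))))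
    · exact Or.inr (Or.inr (Or.inr (Or.inr (Or.inr ⟨rfl, h⟩))))

theorem isE_perm {c : Fin 3 → k} {x y z α β γ : K} (h : isE c x y z) (h' : isE c α β γ) : isPm x y z α β γ := by
  obtain ⟨a0, a1, a2⟩ := h
  obtain ⟨b0, b1, b2⟩ := h'
  exact perm3 (a2.symm.trans b2) (neg_injective (a1.symm.trans b1)) (a0.symm.trans b0)

theorem isE_of_perm {c : Fin 3 → k} {x y z α β γ : K} (h' : isE c α β γ) (h : isPm x y z α β γ) : isE c x y z := by
  obtain ⟨b0, b1, b2⟩ := h'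
  rcases h with ⟨rfl, rfl, rfl⟩ | ⟨rfl, rfl, rfl⟩ | ⟨rfl, rfl, rfl⟩ | ⟨rfl, rfl, rfl⟩ | ⟨rfl, rfl, rfl⟩ | ⟨rfl, rfl, rfl⟩ <;>
  exact ⟨b0.trans (by ring), b1.trans (by ring), b2.trans (by ring)⟩

theorem qadd (x y : K) : (x + y) ^ Fintype.card k = x ^ Fintype.card k + y ^ Fintype.card k := by
  have := map_add (frn k K 1) x y
  simpa [frn_apply] using this

theorem qalg (a : k) : (algebraMap k K a) ^ Fintype.card k = algebraMap k K a := by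
  have := alg_fix (k := k) (K := K) 1 a
  simpa using this

theorem qinj {x y : K} (h : x ^ Fintype.card k = y ^ Fintype.card k) : x = y :=
  frn_inj (k := k) 1 (by simpa using h)

theorem qneg (x : K) : (-x) ^ Fintype.card k = - x ^ Fintype.card k := by
  have := map_neg (frn k K 1) x
  simpa [frn_apply] using this

theorem isE_frob {c : Fin 3 → k} {α β γ : K} (h : isE c α β γ) :
    isE c (α ^ Fintype.card k) (β ^ Fintype.card k) (γ ^ Fintype.card k) := by
  obtain ⟨b0, b1, b2⟩ := h
  refine ⟨?_, ?_, ?_⟩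
  · rw [← qalg, b0, mul_pow, mul_pow]
  · rw [← qalg, b1, qneg, qadd, qadd, mul_pow, mul_pow, mul_pow]
  · rw [← qalg, b2, qadd, qadd]

theorem isE_of_frob {α β γ : K} (h : isPm (α ^ Fintype.card k) (β ^ Fintype.card k) (γ ^ Fintype.card k) α β γ) :
    ∃ c : Fin 3 → k, isE c α β γ := by
  obtain ⟨c0, h0⟩ := fix_alg (k := k) (α * β * γ) (by
    rw [mul_pow, mul_pow]
    rcases h with ⟨h1, h2, h3⟩ | ⟨h1, h2, h3⟩ | ⟨h1, h2, h3⟩ | ⟨h1, h2, h3⟩ | ⟨h1, h2, h3⟩ | ⟨h1, h2, h3⟩ <;> rw [h1, h2, h3] <;> ring)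
  obtain ⟨c1, h1⟩ := fix_alg (k := k) (-(α*β+β*γ+α*γ)) (by
    rw [qneg, qadd, qadd, mul_pow, mul_pow, mul_pow]
    rcases h with ⟨h1, h2, h3⟩ | ⟨h1, h2, h3⟩ | ⟨h1, h2, h3⟩ | ⟨h1, h2, h3⟩ | ⟨h1, h2, h3⟩ | ⟨h1, h2, h3⟩ <;> rw [h1, h2, h3] <;> ring)
  obtain ⟨c2, h2⟩ := fix_alg (k := k) (α + β + γ) (by
    rw [qadd, qadd]
    rcases h with ⟨h1, h2, h3⟩ | ⟨h1, h2, h3⟩ | ⟨h1, h2, h3⟩ | ⟨h1, h2, h3⟩ | ⟨h1, h2, h3⟩ | ⟨h1, h2, h3⟩ <;> rw [h1, h2, h3] <;> ring)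
  exact ⟨![c0, c1, c2], h0, h1, h2⟩

theorem isE_unique {c c' : Fin 3 → k} {α β γ : K} (h : isE c α β γ) (h' : isE c' α β γ) : c = c' := by
  obtain ⟨a0, a1, a2⟩ := h
  obtain ⟨b0, b1, b2⟩ := h'
  have inj := (algebraMap k K).injective
  funext i
  fin_cases i
  · exact inj (a0.trans b0.symm)
  · exact inj (a1.trans b1.symm)
  · exact inj (a2.trans b2.symm)

/-- double counting over a parametrisation -/
theorem dcount [DecidableEq k] {ι : Type*} (S : Finset ι) (t1 t2 t3 : ι → K) (H : (Fin 3 → k) → ℚ) (v : ι → ℚ)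
    (hf : ∀ s ∈ S, isPm (t1 s ^ Fintype.card k) (t2 s ^ Fintype.card k) (t3 s ^ Fintype.card k) (t1 s) (t2 s) (t3 s))
    (hv : ∀ s ∈ S, ∀ c, isE c (t1 s) (t2 s) (t3 s) → H c = v s) [∀ c s, Decidable (isE (k := k) c (t1 s) (t2 s) (t3 s))] :
    ∑ s ∈ S, v s = ∑ c : Fin 3 → k, (S.filter (fun s => isE c (t1 s) (t2 s) (t3 s))).card * H c := by
  simp_rw [← nsmul_eq_mul, ← Finset.sum_const, Finset.sum_filter]
  rw [Finset.sum_comm]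
  apply Finset.sum_congr rfl
  intro s hs
  obtain ⟨c, hc⟩ := isE_of_frob (hf s hs)
  rw [Finset.sum_eq_single c]
  · rw [if_pos hc, hv s hs c hc]
  · intro b _ hb
    rw [if_neg]
    intro h; exact hb (isE_unique h hc)
  · simp

theorem root_types (c : Fin 3 → k) : ∃ α β γ : K, isE c α β γ ∧
   ((α = β ∧ β = γ ∧ α ^ Fintype.card k = α) ∨
    (α = β ∧ β ≠ γ ∧ α ^ Fintype.card k = α ∧ γ ^ Fintype.card k = γ) ∨
    (α ≠ β ∧ β ≠ γ ∧ α ≠ γ ∧ α ^ Fintype.card k = α ∧ β ^ Fintype.card k = β ∧ γ ^ Fintype.card k = γ) ∨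
    (α ≠ β ∧ β ≠ γ ∧ α ≠ γ ∧ α ^ Fintype.card k = β ∧ β ^ Fintype.card k = α ∧ γ ^ Fintype.card k = γ) ∨
    (α ≠ β ∧ β ≠ γ ∧ α ≠ γ ∧ α ^ Fintype.card k = β ∧ β ^ Fintype.card k = γ ∧ γ ^ Fintype.card k = α)) := by
  obtain ⟨α, β, γ, h⟩ := isE_exists_roots (K := K) c
  have dbl : ∀ α γ : K, isE c α α γ → α ≠ γ → α ^ Fintype.card k = α ∧ γ ^ Fintype.card k = γ := by
    intro α γ h hne
    rcases isE_perm (isE_frob h) h with h | h | h | h | h | h <;> grind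
  by_cases h12 : α = β
  · subst h12
    by_cases h23 : α = γ
    · subst h23
      refine ⟨α, α, α, h, Or.inl ⟨rfl, rfl, ?_⟩⟩
      rcases isE_perm (isE_frob h) h with h | h | h | h | h | h <;> exact h.1
    · exact ⟨α, α, γ, h, Or.inr (Or.inl ⟨rfl, h23, dbl _ _ h h23⟩)⟩
  by_cases h23 : β = γ
  · subst h23
    have h' : isE c β β α := isE_rot h
    exact ⟨β, β, α, h', Or.inr (Or.inl ⟨rfl, Ne.symm h12, dbl _ _ h' (Ne.symm h12)⟩)⟩
  by_cases h13 : α = γ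
  · subst h13
    have h' : isE c α α β := isE_rot (isE_rot h)
    exact ⟨α, α, β, h', Or.inr (Or.inl ⟨rfl, h12, dbl _ _ h' h12⟩)⟩
  rcases isE_perm (isE_frob h) h with ⟨a, b, d⟩ | ⟨a, b, d⟩ | ⟨a, b, d⟩ | ⟨a, b, d⟩ | ⟨a, b, d⟩ | ⟨a, b, d⟩
  · exact ⟨α, β, γ, h, Or.inr (Or.inr (Or.inl ⟨h12, h23, h13, a, b, d⟩))⟩
  · exact ⟨β, γ, α, isE_rot h, Or.inr (Or.inr (Or.inr (Or.inl ⟨h23, Ne.symm h13, Ne.symm h12, b, d, a⟩)))⟩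
  · exact ⟨α, β, γ, h, Or.inr (Or.inr (Or.inr (Or.inl ⟨h12, h23, h13, a, b, d⟩)))⟩
  · exact ⟨α, β, γ, h, Or.inr (Or.inr (Or.inr (Or.inr ⟨h12, h23, h13, a, b, d⟩)))⟩
  · exact ⟨α, γ, β, isE_swap (isE_rot (isE_rot h)), Or.inr (Or.inr (Or.inr (Or.inr ⟨h13, Ne.symm h23, h12, a, d, b⟩)))⟩
  · exact ⟨γ, α, β, isE_rot (isE_rot h), Or.inr (Or.inr (Or.inr (Or.inl ⟨Ne.symm h13, h12, Ne.symm h23, d, a, b⟩)))⟩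

end roots
end T7

namespace T7
open Finset
set_option linter.unusedSectionVars false
set_option linter.unusedSimpArgs false
set_option linter.unusedVariables false

section roots
variable {k K : Type*} [Field k] [Fintype k] [Field K] [Algebra k K] [IsAlgClosed K]

set_option maxHeartbeats 1000000 in
theorem wt [DecidableEq K] (Q : K → K) (SA : Finset (K × K × K)) (SB SD : Finset (K × K)) (F1 F3 : Finset K)
    (mA : ∀ s, s ∈ SA ↔ (s.1 ≠ 0 ∧ Q s.1 = s.1) ∧ (s.2.1 ≠ 0 ∧ Q s.2.1 = s.2.1) ∧ (s.2.2 ≠ 0 ∧ Q s.2.2 = s.2.2) ∧ s.1 ≠ s.2.1 ∧ s.2.1 ≠ s.2.2 ∧ s.1 ≠ s.2.2)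
    (mB : ∀ s, s ∈ SB ↔ (Q s.1 ≠ s.1 ∧ Q (Q s.1) = s.1) ∧ (s.2 ≠ 0 ∧ Q s.2 = s.2))
    (mD : ∀ s, s ∈ SD ↔ (s.1 ≠ 0 ∧ Q s.1 = s.1) ∧ (s.2 ≠ 0 ∧ Q s.2 = s.2) ∧ s.1 ≠ s.2)
    (hF1 : ∀ x, x ∈ F1 ↔ x ≠ 0 ∧ Q x = x)
    (hF3 : ∀ x, x ∈ F3 ↔ Q x ≠ x ∧ Q (Q (Q x)) = x)
    (α β γ : K) (nα : α ≠ 0) (nβ : β ≠ 0) (nγ : γ ≠ 0)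
    (ht : (α = β ∧ β = γ ∧ Q α = α) ∨ (α = β ∧ β ≠ γ ∧ Q α = α ∧ Q γ = γ) ∨
        (α ≠ β ∧ β ≠ γ ∧ α ≠ γ ∧ Q α = α ∧ Q β = β ∧ Q γ = γ) ∨
        (α ≠ β ∧ β ≠ γ ∧ α ≠ γ ∧ Q α = β ∧ Q β = α ∧ Q γ = γ) ∨
        (α ≠ β ∧ β ≠ γ ∧ α ≠ γ ∧ Q α = β ∧ Q β = γ ∧ Q γ = α)) (h : ℚ)
    [DecidablePred (fun s : K × K × K => isPm s.1 s.2.1 s.2.2 α β γ)]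
    [DecidablePred (fun s : K × K => isPm s.1 (Q s.1) s.2 α β γ)]
    [DecidablePred (fun s : K => isPm s (Q s) (Q (Q s)) α β γ)]
    [DecidablePred (fun s : K × K => isPm s.1 s.1 s.2 α β γ)]
    [DecidablePred (fun s : K => isPm s s s α β γ)] :
    h = (SA.filter (fun s => isPm s.1 s.2.1 s.2.2 α β γ)).card * h / 6 + (SB.filter (fun s => isPm s.1 (Q s.1) s.2 α β γ)).card * h / 2 +
     (F3.filter (fun s => isPm s (Q s) (Q (Q s)) α β γ)).card * h / 3 + (SD.filter (fun s => isPm s.1 s.1 s.2 α β γ)).card * h +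
      (F1.filter (fun s => isPm s s s α β γ)).card * h := by
  have e0 : ∀ {ι : Type _} (S : Finset ι) (p : ι → Prop) [DecidablePred p], (∀ s ∈ S, ¬ p s) → (S.filter p).card = 0 := by
    intro ι S p _ h
    rw [Finset.card_eq_zero, Finset.filter_eq_empty_iff]
    intro s hs; exact h s hs
  have zA : ¬ (α ≠ β ∧ β ≠ γ ∧ α ≠ γ ∧ Q α = α ∧ Q β = β ∧ Q γ = γ) → (SA.filter (fun s => isPm s.1 s.2.1 s.2.2 α β γ)).card = 0 := by
    intro hno
    apply e0
    rintro ⟨x, y, z⟩ hs hp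
    rw [mA] at hs
    simp only [isPm] at hs hp
    clear * - hs hp hno
    grind
  have zB : ¬ (α ≠ β ∧ β ≠ γ ∧ α ≠ γ ∧ Q α = β ∧ Q β = α ∧ Q γ = γ) → 
     ((α = β ∧ β = γ ∧ Q α = α) ∨ (α = β ∧ β ≠ γ ∧ Q α = α ∧ Q γ = γ) ∨
      (α ≠ β ∧ β ≠ γ ∧ α ≠ γ ∧ Q α = α ∧ Q β = β ∧ Q γ = γ) ∨ 
      (α ≠ β ∧ β ≠ γ ∧ α ≠ γ ∧ Q α = β ∧ Q β = γ ∧ Q γ = α)) → (SB.filter (fun s => isPm s.1 (Q s.1) s.2 α β γ)).card = 0 := by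
    intro hno hyes
    apply e0
    rintro ⟨x, a⟩ hs hp
    rw [mB] at hs
    simp only [isPm] at hs hp
    clear * - hs hp hyes
    grind
  have zC : ((α = β ∧ β = γ ∧ Q α = α) ∨ (α = β ∧ β ≠ γ ∧ Q α = α ∧ Q γ = γ) ∨
      (α ≠ β ∧ β ≠ γ ∧ α ≠ γ ∧ Q α = α ∧ Q β = β ∧ Q γ = γ) ∨ 
      (α ≠ β ∧ β ≠ γ ∧ α ≠ γ ∧ Q α = β ∧ Q β = α ∧ Q γ = γ)) → (F3.filter (fun s => isPm s (Q s) (Q (Q s)) α β γ)).card = 0 := by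
    intro hyes
    apply e0
    rintro x hs hp
    rw [hF3] at hs
    simp only [isPm] at hs hp
    clear * - hs hp hyes
    grind
  have zD : ((α = β ∧ β = γ ∧ Q α = α) ∨ (α ≠ β ∧ β ≠ γ ∧ α ≠ γ)) → (SD.filter (fun s => isPm s.1 s.1 s.2 α β γ)).card = 0 := by
    intro hyes
    apply e0
    rintro ⟨x, y⟩ hs hp
    rw [mD] at hs
    simp only [isPm] at hs hp
    clear * - hs hp hyes
    grind
  have zE : (β ≠ γ) → (F1.filter (fun s => isPm s s s α β γ)).card = 0 := by
    intro hyes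
    apply e0
    rintro x hs hp
    simp only [isPm] at hs hp
    clear * - hs hp hyes
    grind
  rcases ht with h | h | h | h | h
  · rw [zA (fun e => e.1 h.1), zB (fun e => e.1 h.1) (Or.inl h), zC (Or.inl h), zD (Or.inl h)]
    have : F1.filter (fun s => isPm s s s α β γ) = {α} := by
      ext x
      rw [mem_filter, hF1]
      simp only [mem_singleton, isPm]
      clear * - h nα nβ nγ
      grind
    rw [this]; simp
  · rw [zA (fun e => e.1 h.1), zB (fun e => e.1 h.1) (Or.inr (Or.inl h)), zC (Or.inr (Or.inl h)), zE h.2.1]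
    have : SD.filter (fun s => isPm s.1 s.1 s.2 α β γ) = {(α, γ)} := by
      ext ⟨x, y⟩
      rw [mem_filter, mD]
      simp only [mem_singleton, isPm, Prod.mk.injEq]
      clear * - h nα nβ nγ
      grind
    rw [this]; simp
  · rw [zB (by clear * - h; grind) (Or.inr (Or.inr (Or.inl h))), zC (Or.inr (Or.inr (Or.inl h))), zD (Or.inr ⟨h.1, h.2.1, h.2.2.1⟩), zE h.2.1]
    have : SA.filter (fun s => isPm s.1 s.2.1 s.2.2 α β γ) = {(α,β,γ),(α,γ,β),(β,α,γ),(β,γ,α),(γ,α,β),(γ,β,α)} := by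
      ext ⟨x, y, z⟩
      rw [mem_filter, mA]
      simp only [mem_insert, mem_singleton, isPm, Prod.mk.injEq]
      clear * - h nα nβ nγ
      grind
    obtain ⟨h1, h2, h3, _⟩ := h
    rw [this]
    rw [card_insert_of_notMem, card_insert_of_notMem, card_insert_of_notMem, card_insert_of_notMem, card_insert_of_notMem, card_singleton]
    · norm_num
    all_goals
      simp only [mem_insert, mem_singleton, Prod.mk.injEq]
      clear * - h1 h2 h3
      grind
  · rw [zA (by clear * - h; grind), zC (Or.inr (Or.inr (Or.inr h))), zD (Or.inr ⟨h.1, h.2.1, h.2.2.1⟩), zE h.2.1]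
    have : SB.filter (fun s => isPm s.1 (Q s.1) s.2 α β γ) = {(α,γ),(β,γ)} := by
      ext ⟨x, y⟩
      rw [mem_filter, mB]
      simp only [mem_insert, mem_singleton, isPm, Prod.mk.injEq]
      clear * - h nα nβ nγ
      grind
    obtain ⟨h1, h2, h3, _⟩ := h
    rw [this, card_pair (by simp [h1])]
    norm_num
  · rw [zA (by clear * - h; grind), zB (by clear * - h; grind) (Or.inr (Or.inr (Or.inr h))), zD (Or.inr ⟨h.1, h.2.1, h.2.2.1⟩), zE h.2.1]
    have : F3.filter (fun s => isPm s (Q s) (Q (Q s)) α β γ) = {α,β,γ} := by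
      ext x
      rw [mem_filter, hF3]
      simp only [mem_insert, mem_singleton, isPm]
      clear * - h nα nβ nγ
      grind
    obtain ⟨h1, h2, h3, _⟩ := h
    rw [this, card_eq_three.2 ⟨α, β, γ, h1, h3, h2, rfl⟩]
    norm_num

set_option maxHeartbeats 1000000 in
theorem sum_c [DecidableEq k] [DecidableEq K] (F1 F2 F3 : Finset K) 
    (hF1 : ∀ x, x ∈ F1 ↔ x ≠ 0 ∧ x ^ Fintype.card k = x)
    (hF2 : ∀ x, x ∈ F2 ↔ x ^ Fintype.card k ≠ x ∧ x ^ (Fintype.card k ^ 2) = x)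
    (hF3 : ∀ x, x ∈ F3 ↔ x ^ Fintype.card k ≠ x ∧ x ^ (Fintype.card k ^ 3) = x)
    (H : (Fin 3 → k) → ℚ) (h0 : ∀ c, c 0 = 0 → H c = 0)
    (vA : K × K × K → ℚ) (vB : K × K → ℚ) (vC : K → ℚ) (vD : K × K → ℚ) (vE : K → ℚ)
    (hA : ∀ c (x y z : K), isE c x y z → x ≠ 0 → y ≠ 0 → z ≠ 0 → x ^ Fintype.card k = x → y ^ Fintype.card k = y → z ^ Fintype.card k = z →
      x ≠ y → y ≠ z → x ≠ z → H c = vA (x, y, z))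
    (hB : ∀ c (x a : K), isE c x (x^Fintype.card k) a → a ≠ 0 → a ^ Fintype.card k = a → x ^ Fintype.card k ≠ x → x ^ (Fintype.card k ^ 2) = x → 
      H c = vB (x, a))
    (hC : ∀ c (x : K), isE c x (x^Fintype.card k) (x^(Fintype.card k^2)) → x ^ Fintype.card k ≠ x → x ^ (Fintype.card k ^ 3) = x → 
      H c = vC x)
    (hD : ∀ c (x y : K), isE c x x y → x ≠ 0 → y ≠ 0 → x ^ Fintype.card k = x → y ^ Fintype.card k = y →
      x ≠ y → H c = vD (x, y))
    (hE : ∀ c (x : K), isE c x x x → x ≠ 0 → x ^ Fintype.card k = x → H c = vE x) :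
    ∑ c, H c = (∑ s ∈ (F1 ×ˢ F1 ×ˢ F1).filter (fun s => s.1 ≠ s.2.1 ∧ s.2.1 ≠ s.2.2 ∧ s.1 ≠ s.2.2), vA s) / 6
      + (∑ s ∈ F2 ×ˢ F1, vB s) / 2 + (∑ s ∈ F3, vC s) / 3
      + ∑ s ∈ (F1 ×ˢ F1).filter (fun s => s.1 ≠ s.2), vD s + ∑ s ∈ F1, vE s := by
  classical
  have hq2 : ∀ x : K, x ^ (Fintype.card k ^ 2) = (x ^ Fintype.card k) ^ Fintype.card k := fun x => by rw [pow_two, pow_mul]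
  have hq3 : ∀ x : K, x ^ (Fintype.card k ^ 3) = ((x ^ Fintype.card k) ^ Fintype.card k) ^ Fintype.card k := fun x => by rw [pow_succ, pow_mul, hq2]
  obtain ⟨Q, hQ⟩ : ∃ Q : K → K, ∀ x, x ^ Fintype.card k = Q x := ⟨_, fun _ => rfl⟩
  have hQi : ∀ x y, Q x = Q y → x = y := fun x y h => qinj (k := k) (by rw [hQ, hQ, h])
  simp only [hq2, hq3, hQ] at hF1 hF2 hF3 hA hB hC hD hE
  have mA : ∀ s, s ∈ (F1 ×ˢ F1 ×ˢ F1).filter (fun s => s.1 ≠ s.2.1 ∧ s.2.1 ≠ s.2.2 ∧ s.1 ≠ s.2.2) ↔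
      (s.1 ≠ 0 ∧ Q s.1 = s.1) ∧ (s.2.1 ≠ 0 ∧ Q s.2.1 = s.2.1) ∧ (s.2.2 ≠ 0 ∧ Q s.2.2 = s.2.2) ∧ s.1 ≠ s.2.1 ∧ s.2.1 ≠ s.2.2 ∧ s.1 ≠ s.2.2 := by
    intro s; simp only [mem_filter, mem_product, hF1]; tauto
  have mB : ∀ s, s ∈ F2 ×ˢ F1 ↔ (Q s.1 ≠ s.1 ∧ Q (Q s.1) = s.1) ∧ (s.2 ≠ 0 ∧ Q s.2 = s.2) := by
    intro s; simp only [mem_product, hF1, hF2]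
  have mD : ∀ s, s ∈ (F1 ×ˢ F1).filter (fun s => s.1 ≠ s.2) ↔
      (s.1 ≠ 0 ∧ Q s.1 = s.1) ∧ (s.2 ≠ 0 ∧ Q s.2 = s.2) ∧ s.1 ≠ s.2 := by
    intro s; simp only [mem_filter, mem_product, hF1]; tauto
  generalize (F1 ×ˢ F1 ×ˢ F1).filter (fun s => s.1 ≠ s.2.1 ∧ s.2.1 ≠ s.2.2 ∧ s.1 ≠ s.2.2) = SA at *
  generalize F2 ×ˢ F1 = SB at *
  generalize (F1 ×ˢ F1).filter (fun s => s.1 ≠ s.2) = SD at *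
  rw [dcount SA (fun s => s.1) (fun s => s.2.1) (fun s => s.2.2) H vA, dcount SB (fun s => s.1) (fun s => Q s.1) (fun s => s.2) H vB,
    dcount F3 (fun s => s) (fun s => Q s) (fun s => Q (Q s)) H vC, dcount SD (fun s => s.1) (fun s => s.1) (fun s => s.2) H vD,
    dcount F1 (fun s => s) (fun s => s) (fun s => s) H vE, Finset.sum_div, Finset.sum_div, Finset.sum_div, ← Finset.sum_add_distrib,
    ← Finset.sum_add_distrib, ← Finset.sum_add_distrib, ← Finset.sum_add_distrib]
  · apply Finset.sum_congr rfl
    intro c _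
    by_cases hc0 : c 0 = 0
    · rw [h0 c hc0]; simp
    obtain ⟨α, β, γ, hr, ht⟩ := root_types (K := K) c
    simp only [hQ] at ht
    have hne : α * β * γ ≠ 0 := by
      rw [← hr.1]
      simpa using hc0
    have nα : α ≠ 0 := left_ne_zero_of_mul (left_ne_zero_of_mul hne)
    have nβ : β ≠ 0 := right_ne_zero_of_mul (left_ne_zero_of_mul hne)
    have nγ : γ ≠ 0 := right_ne_zero_of_mul hne
    have hiff : ∀ x y z : K, isE c x y z ↔ isPm x y z α β γ := fun x y z => ⟨fun h => isE_perm h hr, fun h => isE_of_perm hr h⟩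
    simp only [hiff]
    exact wt Q SA SB SD F1 F3 mA mB mD hF1 hF3 α β γ nα nβ nγ ht (H c)
  · intro s hs
    rw [hF1] at hs
    simp only [hQ, hs.2]; exact Or.inl ⟨rfl, rfl, rfl⟩
  · intro s hs c hc
    rw [hF1] at hs
    exact hE c s hc hs.1 hs.2
  · intro s hs
    rw [mD] at hs
    simp only [hQ, hs.1.2, hs.2.1.2]; exact Or.inl ⟨rfl, rfl, rfl⟩
  · intro s hs c hc
    rw [mD] at hs
    exact hD c _ _ hc hs.1.1 hs.2.1.1 hs.1.2 hs.2.1.2 hs.2.2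
  · intro s hs
    rw [hF3] at hs
    simp only [hQ, hs.2, isPm]; simp
  · intro s hs c hc
    rw [hF3] at hs
    exact hC c _ hc hs.1 hs.2
  · intro s hs
    rw [mB] at hs
    simp only [hQ, hs.1.2, hs.2.2, isPm]; simp
  · intro s hs c hc
    rw [mB] at hs
    exact hB c _ _ hc hs.2.1 hs.2.2 hs.1.1 hs.1.2
  · intro s hs
    rw [mA] at hs
    simp only [hQ, hs.1.2, hs.2.1.2, hs.2.2.1.2, isPm]; simp
  · intro s hs c hc
    rw [mA] at hs
    obtain ⟨a, b, d, e, f, g⟩ := hs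
    exact hA c _ _ _ hc a.1 b.1 d.1 a.2 b.2 d.2 e f g

end roots
end T7

namespace T7
open Finset
set_option linter.unusedSectionVars false
set_option linter.unusedSimpArgs false
set_option linter.unusedVariables false

section cycs
variable {k K : Type*} [Field k] [Fintype k] [DecidableEq k] [Field K] [Algebra k K] [IsAlgClosed K]

/-- evaluation of a vector as a polynomial -/
def ev (w : Fin 3 → k) (x : K) : K := algebraMap k K (w 0) + algebraMap k K (w 1) * x + algebraMap k K (w 2) * x^2

theorem cd_ev (c : Fin 3 → k) (α β γ : K) (h : isE c α β γ) (w : Fin 3 → k) :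
    algebraMap k K (cd (cm c) w) = ev w α * ev w β * ev w γ := by
  obtain ⟨h0, h1, h2⟩ := h
  simp [cd, cm, d3, Matrix.vecMul, dotProduct, Fin.sum_univ_three, ev]
  rw [h0, h1, h2]
  ring

theorem cd_ne (c : Fin 3 → k) (α β γ : K) (h : isE c α β γ) (w : Fin 3 → k) :
    cd (cm c) w ≠ 0 ↔ ev w α ≠ 0 ∧ ev w β ≠ 0 ∧ ev w γ ≠ 0 := by
  rw [← (map_ne_zero (algebraMap k K)), cd_ev c α β γ h, mul_ne_zero_iff, mul_ne_zero_iff, and_assoc]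

theorem ev_q (w : Fin 3 → k) (x : K) : ev w (x ^ Fintype.card k) = (ev w x) ^ Fintype.card k := by
  unfold ev
  rw [qadd, qadd, mul_pow, mul_pow, qalg, qalg, qalg, ← pow_mul, ← pow_mul, mul_comm (Fintype.card k) 2]

theorem ev_q0 (w : Fin 3 → k) (x : K) : ev w (x ^ Fintype.card k) = 0 ↔ ev w x = 0 := by
  rw [ev_q, pow_eq_zero_iff Fintype.card_ne_zero]

theorem ev_two (w : Fin 3 → k) (x y : K) (hxy : x ≠ y) : (ev w x = 0 ∧ ev w y = 0) ↔
    (algebraMap k K (w 1) = -(x+y) * algebraMap k K (w 2) ∧ algebraMap k K (w 0) = x*y * algebraMap k K (w 2)) := by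
  unfold ev
  constructor
  · rintro ⟨h1, h2⟩
    have e : algebraMap k K (w 1) = -(x+y) * algebraMap k K (w 2) := by
      have : (x - y) * (algebraMap k K (w 1) - (-(x+y) * algebraMap k K (w 2))) = 0 := by linear_combination h1 - h2
      exact sub_eq_zero.1 ((mul_eq_zero.1 this).resolve_left (sub_ne_zero.2 hxy))
    refine ⟨e, ?_⟩
    rw [e] at h1
    linear_combination h1
  · rintro ⟨h1, h2⟩
    rw [h1, h2]
    constructor <;> ring

theorem ev_three (w : Fin 3 → k) (x y z : K) (hxy : x ≠ y) (hyz : y ≠ z) (hxz : x ≠ z) (h1 : ev w x = 0) (h2 : ev w y = 0) (h3 : ev w z = 0) : w = 0 := by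
  obtain ⟨a, b⟩ := (ev_two w x y hxy).1 ⟨h1, h2⟩
  obtain ⟨a', b'⟩ := (ev_two w y z hyz).1 ⟨h2, h3⟩
  have e2 : algebraMap k K (w 2) = 0 := by
    have : (z - x) * algebraMap k K (w 2) = 0 := by linear_combination a' - a
    exact (mul_eq_zero.1 this).resolve_left (sub_ne_zero.2 hxz.symm)
  rw [e2, mul_zero] at a b
  funext i
  fin_cases i
  · simpa using b
  · simpa using a
  · simpa using e2

theorem Z1 (x : K) (hx : x ^ Fintype.card k = x) [DecidablePred (fun w : Fin 3 → k => ev w x = 0)] :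
    (univ.filter (fun w : Fin 3 → k => ev w x = 0)).card = Fintype.card k ^ 2 := by
  obtain ⟨a, rfl⟩ := fix_alg (k := k) x hx
  have : Fintype.card k ^ 2 = (univ : Finset (k × k)).card := by rw [Finset.card_univ, Fintype.card_prod, pow_two]
  rw [this]
  refine Finset.card_bij' (fun w _ => (w 1, w 2)) (fun p _ => ![-(p.1 * a + p.2 * a^2), p.1, p.2]) ?_ ?_ ?_ ?_
  · intro w _; exact mem_univ _
  · rintro ⟨p1, p2⟩ _
    rw [mem_filter]
    refine ⟨mem_univ _, ?_⟩
    simp [ev]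
  · intro w hw
    simp only [mem_filter, mem_univ, true_and, ev, ← map_mul, ← map_add, ← map_pow, map_eq_zero] at hw
    funext i
    fin_cases i
    · simp; linear_combination -hw
    · simp
    · simp
  · rintro ⟨p1, p2⟩ _
    simp

theorem Z2 (s p : k) : (univ.filter (fun w : Fin 3 → k => w 1 = s * w 2 ∧ w 0 = p * w 2)).card = Fintype.card k := by
  rw [← Finset.card_univ]
  refine Finset.card_bij' (fun w _ => w 2) (fun x _ => ![p * x, s * x, x]) ?_ ?_ ?_ ?_
  · intro w _; exact mem_univ _
  · intro x _; simp
  · intro w hw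
    simp only [mem_filter, mem_univ, true_and] at hw
    funext i
    fin_cases i
    · simp [hw.2]
    · simp [hw.1]
    · simp
  · intro x _; simp

theorem Z2' (x y : K) (hxy : x ≠ y) (hs : (x+y) ^ Fintype.card k = x + y) (hp : (x*y) ^ Fintype.card k = x*y)
    [DecidablePred (fun w : Fin 3 → k => ev w x = 0 ∧ ev w y = 0)] :
    (univ.filter (fun w : Fin 3 → k => ev w x = 0 ∧ ev w y = 0)).card = Fintype.card k := by
  obtain ⟨s, hs⟩ := fix_alg (k := k) _ hs
  obtain ⟨p, hp⟩ := fix_alg (k := k) _ hp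
  rw [← Z2 (-s) p]
  congr 1
  apply Finset.filter_congr
  intro w _
  rw [ev_two w x y hxy, ← hs, ← hp, ← map_neg, ← map_mul, ← map_mul]
  rw [(algebraMap k K).injective.eq_iff, (algebraMap k K).injective.eq_iff]

open Classical in
theorem cyc_sum (c : Fin 3 → k) (α β γ : K) (h : isE c α β γ) : (cyc (cm c) : ℚ) =
    ∑ w : Fin 3 → k, (1 - if ev w α = 0 then (1:ℚ) else 0) * (1 - if ev w β = 0 then (1:ℚ) else 0) * (1 - if ev w γ = 0 then (1:ℚ) else 0) := by
  unfold cyc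
  rw [Finset.card_filter]
  push_cast
  apply Finset.sum_congr rfl
  intro w _
  rw [if_congr (cd_ne c α β γ h w) rfl rfl]
  by_cases h1 : ev w α = 0 <;> by_cases h2 : ev w β = 0 <;> by_cases h3 : ev w γ = 0 <;> simp [h1, h2, h3]

theorem card_w : (Fintype.card (Fin 3 → k) : ℚ) = Fintype.card k ^ 3 := by
  rw [Fintype.card_fun]; simp

theorem cyc_E (c : Fin 3 → k) (α : K) (h : isE c α α α) (hα : α ^ Fintype.card k = α) :
    (cyc (cm c) : ℚ) = (Fintype.card k : ℚ)^2 * (Fintype.card k - 1) := by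
  classical
  rw [cyc_sum c α α α h]
  have : ∀ w : Fin 3 → k, (1 - if ev w α = 0 then (1:ℚ) else 0) * (1 - if ev w α = 0 then (1:ℚ) else 0) * (1 - if ev w α = 0 then (1:ℚ) else 0)
    = 1 - if ev w α = 0 then (1:ℚ) else 0 := by
    intro w; split_ifs <;> norm_num
  simp_rw [this]
  rw [Finset.sum_sub_distrib, Finset.sum_boole, Z1 α hα]
  simp [card_w]; ring

theorem cyc_D (c : Fin 3 → k) (α γ : K) (h : isE c α α γ) (hα : α ^ Fintype.card k = α) (hγ : γ ^ Fintype.card k = γ) (hne : α ≠ γ) :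
    (cyc (cm c) : ℚ) = (Fintype.card k : ℚ) * (Fintype.card k - 1)^2 := by
  classical
  rw [cyc_sum c α α γ h]
  have : ∀ w : Fin 3 → k, (1 - if ev w α = 0 then (1:ℚ) else 0) * (1 - if ev w α = 0 then (1:ℚ) else 0) * (1 - if ev w γ = 0 then (1:ℚ) else 0)
    = 1 - (if ev w α = 0 then (1:ℚ) else 0) - (if ev w γ = 0 then (1:ℚ) else 0) + (if ev w α = 0 ∧ ev w γ = 0 then (1:ℚ) else 0) := by
    intro w; by_cases h1 : ev w α = 0 <;> by_cases h2 : ev w γ = 0 <;> simp [h1, h2]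
  simp_rw [this]
  rw [Finset.sum_add_distrib, Finset.sum_sub_distrib, Finset.sum_sub_distrib, Finset.sum_boole, Finset.sum_boole, Finset.sum_boole, Z1 α hα, Z1 γ hγ,
    Z2' α γ hne (by rw [qadd, hα, hγ]) (by rw [mul_pow, hα, hγ])]
  simp [card_w]; ring

theorem ev_zero (x : K) : ev (0 : Fin 3 → k) x = 0 := by simp [ev]

theorem cyc_A (c : Fin 3 → k) (α β γ : K) (h : isE c α β γ) (hα : α ^ Fintype.card k = α) (hβ : β ^ Fintype.card k = β) (hγ : γ ^ Fintype.card k = γ)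
    (h12 : α ≠ β) (h23 : β ≠ γ) (h13 : α ≠ γ) :
    (cyc (cm c) : ℚ) = ((Fintype.card k : ℚ) - 1)^3 := by
  classical
  rw [cyc_sum c α β γ h]
  have : ∀ w : Fin 3 → k, (1 - if ev w α = 0 then (1:ℚ) else 0) * (1 - if ev w β = 0 then (1:ℚ) else 0) * (1 - if ev w γ = 0 then (1:ℚ) else 0)
    = 1 - (if ev w α = 0 then (1:ℚ) else 0) - (if ev w β = 0 then (1:ℚ) else 0) - (if ev w γ = 0 then (1:ℚ) else 0)
     + (if ev w α = 0 ∧ ev w β = 0 then (1:ℚ) else 0) + (if ev w β = 0 ∧ ev w γ = 0 then (1:ℚ) else 0)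
      + (if ev w α = 0 ∧ ev w γ = 0 then (1:ℚ) else 0) - (if w = 0 then (1 : ℚ) else 0) := by
    intro w
    have h0 : w = 0 ↔ (ev w α = 0 ∧ ev w β = 0 ∧ ev w γ = 0) := 
      ⟨by rintro rfl; simp [ev_zero], fun e => ev_three w _ _ _ h12 h23 h13 e.1 e.2.1 e.2.2⟩
    rw [if_congr h0 rfl rfl]
    by_cases h1 : ev w α = 0 <;> by_cases h2 : ev w β = 0 <;> by_cases h3 : ev w γ = 0 <;> simp [h1, h2, h3]
  simp_rw [this]
  rw [Finset.sum_sub_distrib, Finset.sum_add_distrib, Finset.sum_add_distrib, Finset.sum_add_distrib, Finset.sum_sub_distrib, Finset.sum_sub_distrib, Finset.sum_sub_distrib, 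
    Finset.sum_boole, Finset.sum_boole, Finset.sum_boole, Finset.sum_boole, Finset.sum_boole, Finset.sum_boole, Z1 α hα, Z1 β hβ, Z1 γ hγ,
    Z2' α β h12 (by rw [qadd, hα, hβ]) (by rw [mul_pow, hα, hβ]),
    Z2' β γ h23 (by rw [qadd, hβ, hγ]) (by rw [mul_pow, hβ, hγ]),
    Z2' α γ h13 (by rw [qadd, hα, hγ]) (by rw [mul_pow, hα, hγ])]
  simp [card_w]; ring

theorem cyc_B (c : Fin 3 → k) (α γ : K) (h : isE c α (α ^ Fintype.card k) γ) (hα : α ^ Fintype.card k ≠ α) (hα2 : α ^ (Fintype.card k ^ 2) = α)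
    (hγ : γ ^ Fintype.card k = γ) :
    (cyc (cm c) : ℚ) = ((Fintype.card k : ℚ) - 1) * ((Fintype.card k : ℚ)^2 - 1) := by
  classical
  rw [cyc_sum c α _ γ h]
  rw [pow_two, pow_mul] at hα2
  have h13 : α ≠ γ := by rintro rfl; exact hα hγ
  have h23 : α ^ Fintype.card k ≠ γ := by
    intro e; rw [← hγ] at e; exact h13 (qinj (k := k) e)
  have : ∀ w : Fin 3 → k, (1 - if ev w α = 0 then (1:ℚ) else 0) * (1 - if ev w (α ^ Fintype.card k) = 0 then (1:ℚ) else 0) * (1 - if ev w γ = 0 then (1:ℚ) else 0)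
    = 1 - (if ev w γ = 0 then (1:ℚ) else 0) 
     - (if ev w α = 0 ∧ ev w (α ^ Fintype.card k) = 0 then (1:ℚ) else 0)  + (if w = 0 then (1 : ℚ) else 0) := by
    intro w
    have h0 : w = 0 ↔ (ev w α = 0 ∧ ev w γ = 0) := 
      ⟨by rintro rfl; simp [ev_zero], fun e => ev_three w _ _ _ (Ne.symm hα) h23 h13 e.1 ((ev_q0 w α).2 e.1) e.2⟩
    simp only [ev_q0]
    rw [if_congr h0 rfl rfl]
    by_cases h1 : ev w α = 0 <;> by_cases h3 : ev w γ = 0 <;> simp [h1, h3]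
  simp_rw [this]
  rw [Finset.sum_add_distrib, Finset.sum_sub_distrib, Finset.sum_sub_distrib, 
    Finset.sum_boole, Finset.sum_boole, Z1 γ hγ,
    Z2' α _ (Ne.symm hα) (by rw [qadd, hα2, add_comm]) (by rw [mul_pow, hα2, mul_comm])]
  simp [card_w]; ring

theorem cyc_C (c : Fin 3 → k) (α : K) (h : isE c α (α ^ Fintype.card k) (α ^ (Fintype.card k ^ 2))) (hα : α ^ Fintype.card k ≠ α) 
   (hα3 : α ^ (Fintype.card k ^ 3) = α) :
    (cyc (cm c) : ℚ) = (Fintype.card k : ℚ)^3 - 1 := by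
  classical
  rw [cyc_sum c α _ _ h]
  have h13 : α ≠ α ^ (Fintype.card k ^ 2) := by
    intro e
    have := (per3 hα3 hα 2).1 e.symm
    omega
  have h23 : α ^ Fintype.card k ≠ α ^ (Fintype.card k ^ 2) := by
    intro e; rw [pow_two, pow_mul] at e; exact hα (qinj (k := k) e).symm
  have : ∀ w : Fin 3 → k, (1 - if ev w α = 0 then (1:ℚ) else 0) * (1 - if ev w (α ^ Fintype.card k) = 0 then (1:ℚ) else 0) * (1 - if ev w (α ^ (Fintype.card k ^ 2)) = 0 then (1:ℚ) else 0)
    = 1 - (if w = 0 then (1 : ℚ) else 0) := by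
    intro w
    have e2 : ev w (α ^ (Fintype.card k ^ 2)) = 0 ↔ ev w α = 0 := by rw [pow_two, pow_mul, ev_q0, ev_q0]
    have h0 : w = 0 ↔ (ev w α = 0) := 
      ⟨by rintro rfl; simp [ev_zero], fun e => ev_three w _ _ _ (Ne.symm hα) h23 h13 e ((ev_q0 w α).2 e) (e2.2 e)⟩
    simp only [ev_q0, e2]
    rw [if_congr h0 rfl rfl]
    by_cases h1 : ev w α = 0 <;> simp [h1]
  simp_rw [this]
  rw [Finset.sum_sub_distrib]
  simp [card_w]

end cycs
end T7

namespace T7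
open Finset
set_option linter.unusedSectionVars false
set_option linter.unusedSimpArgs false
set_option linter.unusedVariables false

/-- number of elements of order `i` in a cyclic group of order `N` -/
def cc (N i : ℕ) : ℚ := if i ∣ N then (Nat.totient i : ℚ) else 0

/-- sum of `F ∘ tau` over the nontrivial elements of a cyclic group of order `N` -/
def SS (N : ℕ) (F : ℕ → ℚ) : ℚ := ((N : ℚ) - 1) * F 8 + ∑ i ∈ Icc 2 7, cc N i * (F i - F 8)

theorem tau_expand {M : Type*} [Monoid M] (x : M) (hx : x ≠ 1) (F : ℕ → ℚ) :
    F (tau x) = F 8 + ∑ i ∈ Icc 2 7, (F i - F 8) * (if orderOf x = i then 1 else 0) := by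
  have h : ∀ i ∈ Icc 2 7, (F i - F 8) * (if orderOf x = i then (1:ℚ) else 0) = if tau x = i then F i - F 8 else 0 := by
    intro i hi
    rw [mem_Icc] at hi
    rw [← if_congr (tau_eq_iff x i (by omega) (by omega)) rfl rfl]
    split_ifs <;> simp
  rw [Finset.sum_congr rfl h, Finset.sum_ite_eq]
  have h1 := two_le_tau x hx
  have h2 := tau_le x
  split_ifs with h
  · ring
  · rw [mem_Icc] at h
    have : tau x = 8 := by omega
    rw [this]; ring

section
variable {K : Type*} [Field K] [IsAlgClosed K]

/-- the `N`-th roots of unity -/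
noncomputable def U (K : Type*) [Field K] (N : ℕ) : Finset K := Polynomial.nthRootsFinset N (1 : K)

theorem mem_U {N : ℕ} (hN : N ≠ 0) (x : K) : x ∈ U K N ↔ x ^ N = 1 := by
  unfold U; rw [Polynomial.mem_nthRootsFinset (Nat.pos_of_ne_zero hN)]

theorem exists_prim (N : ℕ) (hN : (N : K) ≠ 0) : ∃ ζ : K, IsPrimitiveRoot ζ N := by
  have : NeZero (N : K) := ⟨hN⟩
  exact HasEnoughRootsOfUnity.exists_primitiveRoot K N

theorem card_U (N : ℕ) (hN : (N : K) ≠ 0) : (U K N).card = N := by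
  obtain ⟨ζ, h⟩ := exists_prim (K := K) N hN
  exact h.card_nthRootsFinset

theorem ne_of_cast {N : ℕ} (hN : (N : K) ≠ 0) : N ≠ 0 := by rintro rfl; simp at hN

theorem count_order (N : ℕ) (hN : (N : K) ≠ 0) (i : ℕ) (hi : 2 ≤ i) [DecidableEq K] :
    ((((U K N).erase 1).filter (fun x => orderOf x = i)).card : ℚ) = cc N i := by
  have hN0 := ne_of_cast hN
  unfold cc
  split_ifs with h
  · have hi0 : (i : K) ≠ 0 := by
      obtain ⟨j, rfl⟩ := h
      push_cast at hN
      exact left_ne_zero_of_mul hN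
    obtain ⟨ζ, hz⟩ := exists_prim (K := K) i hi0
    rw [← hz.card_primitiveRoots]
    congr 2
    ext x
    rw [mem_filter, mem_erase, mem_U hN0, mem_primitiveRoots (by omega)]
    constructor
    · rintro ⟨_, rfl⟩; exact IsPrimitiveRoot.orderOf x
    · intro hx
      have e := hx.eq_orderOf
      refine ⟨⟨?_, ?_⟩, e.symm⟩
      · rintro rfl; simp at e; omega
      · exact orderOf_dvd_iff_pow_eq_one.1 (e ▸ h)
  · rw [Nat.cast_eq_zero, card_eq_zero, filter_eq_empty_iff]
    intro x hx e
    rw [mem_erase, mem_U hN0] at hx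
    exact h (e ▸ orderOf_dvd_iff_pow_eq_one.2 hx.2)

theorem sum_U [DecidableEq K] (N : ℕ) (hN : (N : K) ≠ 0) (F : ℕ → ℚ) :
    ∑ x ∈ (U K N).erase 1, F (tau x) = SS N F := by
  rw [Finset.sum_congr rfl (fun x hx => tau_expand x (ne_of_mem_erase hx) F)]
  rw [Finset.sum_add_distrib, Finset.sum_comm, Finset.sum_const, card_erase_of_mem (by rw [mem_U (ne_of_cast hN), one_pow]), card_U N hN]
  unfold SS
  congr 1
  · rw [nsmul_eq_mul, Nat.cast_sub (Nat.pos_of_ne_zero (ne_of_cast hN))]; simp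
  · apply Finset.sum_congr rfl
    intro i hi
    rw [mem_Icc] at hi
    rw [← Finset.mul_sum, Finset.sum_boole, count_order N hN i hi.1, mul_comm]

/-- fibres of the power map -/
theorem sum_pow [DecidableEq K] (N M : ℕ) (hN : (N : K) ≠ 0) (hM : (M : K) ≠ 0) (F : K → ℚ) :
    ∑ x ∈ U K (N * M), F (x ^ N) = N * ∑ y ∈ U K M, F y := by
  have hN0 := ne_of_cast hN
  have hM0 := ne_of_cast hM
  have hmaps : ∀ x ∈ U K (N*M), x ^ N ∈ U K M := by
    intro x hx
    rw [mem_U (mul_ne_zero hN0 hM0)] at hx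
    rw [mem_U hM0, ← pow_mul, hx]
  rw [← Finset.sum_fiberwise_of_maps_to hmaps, Finset.mul_sum]
  apply Finset.sum_congr rfl
  intro y hy
  rw [Finset.sum_congr rfl (g := fun _ => F y) (fun x hx => by rw [(mem_filter.1 hx).2]), Finset.sum_const, nsmul_eq_mul]
  congr 2
  rw [mem_U hM0] at hy
  have hy0 : y ≠ 0 := by rintro rfl; rw [zero_pow hM0] at hy; exact zero_ne_one hy
  obtain ⟨z, hz⟩ := IsAlgClosed.exists_pow_nat_eq y (Nat.pos_of_ne_zero hN0)
  have hz0 : z ≠ 0 := by rintro rfl; rw [zero_pow hN0] at hz; exact hy0 hz.symm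
  refine Eq.trans ?_ (card_U (K := K) N hN)
  symm
  refine Finset.card_bij' (fun x _ => x * z) (fun x _ => x / z) ?_ ?_ ?_ ?_
  · intro x hx
    rw [mem_U hN0] at hx
    rw [mem_filter, mem_U (mul_ne_zero hN0 hM0), pow_mul, mul_pow, hx, hz, one_mul]
    exact ⟨hy, rfl⟩
  · intro x hx
    rw [mem_U hN0, div_pow, (mem_filter.1 hx).2, hz, div_self hy0]
  · intro x _; field_simp
  · intro x _; field_simp

theorem sum_pow_tau [DecidableEq K] (N M : ℕ) (hN : (N : K) ≠ 0) (hM : (M : K) ≠ 0) (F : ℕ → ℚ) :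
    ∑ x ∈ U K (N * M) \ U K N, F (tau (x ^ N)) = N * SS M F := by
  have hN0 := ne_of_cast hN
  have hM0 := ne_of_cast hM
  rw [← sum_U M hM F]
  have h := sum_pow N M hN hM (fun y => if y = 1 then 0 else F (tau y))
  rw [← Finset.sum_sdiff (s₁ := U K N) (s₂ := U K (N*M))] at h
  · rw [Finset.sum_congr rfl (s₁ := U K (N * M) \ U K N) (g := fun x => F (tau (x ^ N)))] at h
    · rw [Finset.sum_congr rfl (s₁ := U K N) (g := fun x => (0:ℚ))] at h
      · rw [Finset.sum_const_zero, add_zero] at h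
        rw [h, ← Finset.sum_erase (U K M) (a := 1) (by simp)]
        congr 1
        apply Finset.sum_congr rfl
        intro x hx
        rw [if_neg (ne_of_mem_erase hx)]
      · intro x hx
        rw [mem_U hN0] at hx
        simp [hx]
    · intro x hx
      rw [mem_sdiff, mem_U hN0] at hx
      simp [hx.2]
  · intro x hx
    rw [mem_U hN0] at hx
    rw [mem_U (mul_ne_zero hN0 hM0), pow_mul, hx, one_pow]

theorem sum_diff [DecidableEq K] (N M : ℕ) (hN : (N : K) ≠ 0) (hM : (M : K) ≠ 0) (F : ℕ → ℚ) :
    ∑ x ∈ U K (N * M) \ U K N, F (tau x) = SS (N*M) F - SS N F := by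
  have hN0 := ne_of_cast hN
  have hM0 := ne_of_cast hM
  have hs : U K N ⊆ U K (N*M) := by
    intro x hx
    rw [mem_U hN0] at hx
    rw [mem_U (mul_ne_zero hN0 hM0), pow_mul, hx, one_pow]
  rw [← sum_U (K := K) N hN F, ← sum_U (K := K) (N*M) (by rw [Nat.cast_mul]; exact mul_ne_zero hN hM) F, eq_sub_iff_add_eq]
  rw [← Finset.sum_sdiff (Finset.erase_subset_erase 1 hs)]
  congr 2
  ext x
  simp only [mem_sdiff, mem_erase, mem_U hN0]
  constructor
  · rintro ⟨h1, h2⟩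
    have : x ≠ 1 := by rintro rfl; simp at h2
    tauto
  · tauto

/-- shifting by a unit -/
theorem sum_scale [DecidableEq K] (N : ℕ) (hN : N ≠ 0) (S : Finset K) (hS : ∀ x ∈ S, ∀ a : K, a ^ N = 1 → x * a ∈ S) (F : K → ℚ)
    (a : K) (ha : a ∈ U K N) : ∑ x ∈ S, F (x / a) = ∑ x ∈ S, F x := by
  rw [mem_U hN] at ha
  have ha0 : a ≠ 0 := by rintro rfl; rw [zero_pow hN] at ha; exact zero_ne_one ha
  refine Finset.sum_bij' (fun x _ => x / a) (fun x _ => x * a) ?_ ?_ ?_ ?_ ?_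
  · intro x hx; rw [div_eq_mul_inv]; exact hS x hx _ (by rw [inv_pow, ha, inv_one])
  · intro x hx; exact hS x hx a ha
  · intro x _; field_simp
  · intro x _; field_simp
  · intro x _; rfl

theorem sum_U' [DecidableEq K] (N : ℕ) (hN : (N : K) ≠ 0) (F : ℕ → ℚ) :
    ∑ x ∈ U K N, (if x = 1 then 0 else F (tau x)) = SS N F := by
  rw [← sum_U (K := K) N hN F, ← Finset.sum_erase (U K N) (a := 1) (by simp)]
  apply Finset.sum_congr rfl
  intro x hx
  rw [if_neg (ne_of_mem_erase hx)]

theorem U_ne {N : ℕ} (hN : N ≠ 0) {a : K} (ha : a ∈ U K N) : a ≠ 0 := by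
  rintro rfl; rw [mem_U hN, zero_pow hN] at ha; exact zero_ne_one ha

theorem U_mul {N : ℕ} (hN : N ≠ 0) : ∀ x ∈ U K N, ∀ a : K, a ^ N = 1 → x * a ∈ U K N := by
  intro x hx a ha
  rw [mem_U hN] at *
  rw [mul_pow, hx, ha, one_mul]

theorem U_scale [DecidableEq K] {N : ℕ} (hN : N ≠ 0) (F : K → ℚ) (a : K) (ha : a ∈ U K N) :
    ∑ x ∈ U K N, F (x / a) = ∑ x ∈ U K N, F x := sum_scale N hN _ (U_mul hN) F a ha

theorem U_scale' [DecidableEq K] {N : ℕ} (hN : N ≠ 0) (F : K → ℚ) (a : K) (ha : a ∈ U K N) :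
    ∑ x ∈ U K N, F (a / x) = ∑ x ∈ U K N, F x := by
  have ha0 := U_ne hN ha
  have key : ∀ x ∈ U K N, a / x ∈ U K N := by
    intro x hx
    rw [mem_U hN] at *
    rw [div_pow, hx, ha, div_one]
  refine Finset.sum_bij' (fun x _ => a / x) (fun x _ => a / x) key key ?_ ?_ ?_
  · intro x hx; have := U_ne hN hx; field_simp
  · intro x hx; have := U_ne hN hx; field_simp
  · intro x _; rfl

/-- pairs of distinct elements -/
theorem sum_pairs [DecidableEq K] (N : ℕ) (hN : (N : K) ≠ 0) (F : ℕ → ℚ) :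
    ∑ s ∈ (U K N ×ˢ U K N).filter (fun s => s.1 ≠ s.2), F (tau (s.2 / s.1)) = N * SS N F := by
  have hN0 := ne_of_cast hN
  rw [Finset.sum_filter, Finset.sum_product]
  rw [Finset.sum_congr rfl (g := fun _ => SS N F)]
  · rw [Finset.sum_const, card_U N hN, nsmul_eq_mul]
  intro a ha
  have ha0 := U_ne hN0 ha
  rw [← sum_U' (K := K) N hN F, ← U_scale hN0 (fun x => if x = 1 then 0 else F (tau x)) a ha]
  apply Finset.sum_congr rfl
  intro y hy
  simp only
  by_cases h : a = y
  · subst h; simp [ha0]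
  · have : y / a ≠ 1 := by rw [Ne, div_eq_one_iff_eq ha0]; exact Ne.symm h
    simp [h, this]

theorem tau_inv (x : K) : tau x⁻¹ = tau x := by
  have : orderOf x⁻¹ = orderOf x := by
    rw [orderOf_eq_orderOf_iff]; intro n; rw [inv_pow, inv_eq_one]
  unfold tau; rw [this]

/-- triples of distinct elements -/
theorem sum_triples [DecidableEq K] (N : ℕ) (hN : (N : K) ≠ 0) (A : ℕ → ℕ → ℚ) :
    ∑ s ∈ (U K N ×ˢ U K N ×ˢ U K N).filter (fun s => s.1 ≠ s.2.1 ∧ s.2.1 ≠ s.2.2 ∧ s.1 ≠ s.2.2), A (tau (s.1 / s.2.1)) (tau (s.2.1 / s.2.2)) =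
      N * (SS N (fun i => SS N (fun j => A i j)) - SS N (fun i => A i i)) := by
  have hN0 := ne_of_cast hN
  let g : K → K → ℚ := fun s t => if s = 1 then 0 else ((if t = 1 then 0 else A (tau s) (tau t)) - (if t = s⁻¹ then A (tau s) (tau s) else 0))
  rw [Finset.sum_filter, Finset.sum_product]
  have h1 : ∀ x ∈ U K N, (∑ p ∈ U K N ×ˢ U K N, if (x, p).1 ≠ (x, p).2.1 ∧ (x, p).2.1 ≠ (x, p).2.2 ∧ (x, p).1 ≠ (x, p).2.2 then
      A (tau ((x, p).1 / (x, p).2.1)) (tau ((x, p).2.1 / (x, p).2.2)) else 0) = ∑ y ∈ U K N, ∑ t ∈ U K N, g (x / y) t := by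
    intro x hx
    have hx0 := U_ne hN0 hx
    rw [Finset.sum_product]
    apply Finset.sum_congr rfl
    intro y hy
    have hy0 := U_ne hN0 hy
    rw [← U_scale' hN0 (fun t => g (x / y) t) y hy]
    apply Finset.sum_congr rfl
    intro z hz
    have hz0 := U_ne hN0 hz
    simp only [g, div_eq_one_iff_eq hy0, div_eq_one_iff_eq hz0, inv_div, div_left_inj' hy0]
    have e : y / z = y / x ↔ x = z := by
      constructor
      · intro h; field_simp at h; exact h
      · rintro rfl; rfl
    simp only [e]
    by_cases a : x = y
    · simp [a]
    by_cases b : y = z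
    · subst b; simp [a]
    by_cases c : x = z
    · subst c
      have : tau (y / x) = tau (x / y) := by rw [← tau_inv, inv_div]
      simp [a, b, this]
    simp [a, b, c]
  rw [Finset.sum_congr rfl h1, Finset.sum_comm]
  rw [Finset.sum_congr rfl (g := fun _ => SS N (fun i => SS N (fun j => A i j)) - SS N (fun i => A i i))]
  · rw [Finset.sum_const, card_U N hN, nsmul_eq_mul]
  intro y hy
  rw [U_scale hN0 (fun s => ∑ t ∈ U K N, g s t) y hy]
  rw [← sum_U' (K := K) N hN (fun i => SS N (fun j => A i j)), ← sum_U' (K := K) N hN (fun i => A i i), ← Finset.sum_sub_distrib]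
  apply Finset.sum_congr rfl
  intro s hs
  by_cases h : s = 1
  · simp [g, h]
  simp only [g, h, if_false]
  rw [Finset.sum_sub_distrib, sum_U' N hN, Finset.sum_ite_eq', if_pos]
  rw [mem_U hN0] at *
  rw [inv_pow, hs, inv_one]

theorem sum_triples' [DecidableEq K] (N : ℕ) (hN : (N : K) ≠ 0) (A : ℕ → ℕ → ℚ) :
    ∑ s ∈ (U K N ×ˢ U K N ×ˢ U K N).filter (fun s => s.1 ≠ s.2.1 ∧ s.2.1 ≠ s.2.2 ∧ s.1 ≠ s.2.2),
      (A (tau (s.1 / s.2.1)) (tau (s.2.1 / s.2.2)) + A (tau (s.2.1 / s.2.2)) (tau (s.2.2 / s.1)) + A (tau (s.2.2 / s.1)) (tau (s.1 / s.2.1))) =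
      3 * (N * (SS N (fun i => SS N (fun j => A i j)) - SS N (fun i => A i i))) := by
  rw [Finset.sum_add_distrib, Finset.sum_add_distrib, sum_triples N hN A]
  have e1 : ∀ B : K → K → K → ℚ, ∑ s ∈ (U K N ×ˢ U K N ×ˢ U K N).filter (fun s => s.1 ≠ s.2.1 ∧ s.2.1 ≠ s.2.2 ∧ s.1 ≠ s.2.2), B s.2.1 s.2.2 s.1
    = ∑ s ∈ (U K N ×ˢ U K N ×ˢ U K N).filter (fun s => s.1 ≠ s.2.1 ∧ s.2.1 ≠ s.2.2 ∧ s.1 ≠ s.2.2), B s.1 s.2.1 s.2.2 := by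
    intro B
    refine Finset.sum_bij' (fun s _ => (s.2.1, s.2.2, s.1)) (fun s _ => (s.2.2, s.1, s.2.1)) ?_ ?_ ?_ ?_ ?_
    · rintro ⟨x, y, z⟩ h
      simp only [mem_filter, mem_product] at h ⊢
      exact ⟨⟨h.1.2.1, h.1.2.2, h.1.1⟩, h.2.2.1, Ne.symm h.2.2.2, Ne.symm h.2.1⟩
    · rintro ⟨x, y, z⟩ h
      simp only [mem_filter, mem_product] at h ⊢
      exact ⟨⟨h.1.2.2, h.1.1, h.1.2.1⟩, Ne.symm h.2.2.2, h.2.1, Ne.symm h.2.2.1⟩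
    · intro s _; rfl
    · intro s _; rfl
    · intro s _; rfl
  rw [e1 (fun x y z => A (tau (x / y)) (tau (y / z))), sum_triples N hN A]
  rw [← e1 (fun x y z => A (tau (z / x)) (tau (x / y))), sum_triples N hN A]
  ring

end
end T7

namespace T7
open Finset
set_option linter.unusedSectionVars false
set_option linter.unusedSimpArgs false
set_option linter.unusedVariables false

section
variable {k : Type*} [Field k] [Fintype k] [DecidableEq k]

theorem sum_dot (u : Fin 3 → k) (hu : u ≠ 0) (g : k → ℚ) :
    ∑ w : Fin 3 → k, g (w ⬝ᵥ u) = (Fintype.card k : ℚ)^2 * ∑ t, g t := by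
  obtain ⟨i, hi⟩ : ∃ i, u i ≠ 0 := by
    by_contra h; push Not at h; exact hu (funext h)
  let w0 : Fin 3 → k := Pi.single i (u i)⁻¹
  have hw0 : w0 ⬝ᵥ u = 1 := by simp [w0, hi]
  have hc : ∀ t : k, (univ.filter (fun w : Fin 3 → k => w ⬝ᵥ u = t)).card = (univ.filter (fun w : Fin 3 → k => w ⬝ᵥ u = 0)).card := by
    intro t
    refine Finset.card_bij' (fun w _ => w - t • w0) (fun w _ => w + t • w0) ?_ ?_ ?_ ?_
    · intro w hw
      simp only [mem_filter, mem_univ, true_and] at hw ⊢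
      rw [sub_dotProduct, smul_dotProduct, hw0, hw]; simp
    · intro w hw
      simp only [mem_filter, mem_univ, true_and] at hw ⊢
      rw [add_dotProduct, smul_dotProduct, hw0, hw]; simp
    · intro w _; simp
    · intro w _; simp
  have hg : ∀ g : k → ℚ, ∑ w : Fin 3 → k, g (w ⬝ᵥ u) = ((univ.filter (fun w : Fin 3 → k => w ⬝ᵥ u = 0)).card : ℚ) * ∑ t, g t := by
    intro g
    rw [← Finset.sum_fiberwise (univ : Finset (Fin 3 → k)) (fun w => w ⬝ᵥ u), Finset.mul_sum]
    apply Finset.sum_congr rfl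
    intro t _
    rw [Finset.sum_congr rfl (g := fun _ => g t) (fun x hx => by rw [(mem_filter.1 hx).2]), Finset.sum_const, nsmul_eq_mul, hc t]
  have h1 := hg (fun _ => 1)
  simp only [Finset.sum_const, nsmul_eq_mul, mul_one, Finset.card_univ, card_w] at h1
  have hq : (Fintype.card k : ℚ) ≠ 0 := by exact_mod_cast Fintype.card_ne_zero
  rw [hg g]
  congr 1
  apply mul_right_cancel₀ hq
  rw [← h1]; ring

theorem sum_uw (g : k → ℚ) : ∑ u : Fin 3 → k, ∑ w : Fin 3 → k, (if u ≠ 0 ∧ w ≠ 0 then g (w ⬝ᵥ u) else 0) =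
    ((Fintype.card k : ℚ)^3 - 1) * ((Fintype.card k : ℚ)^2 * ∑ t, g t - g 0) := by
  have h : ∀ u : Fin 3 → k, ∑ w : Fin 3 → k, (if u ≠ 0 ∧ w ≠ 0 then g (w ⬝ᵥ u) else 0) = 
      (1 - if u = 0 then (1:ℚ) else 0) * ((Fintype.card k : ℚ)^2 * ∑ t, g t - g 0) := by
    intro u
    by_cases hu : u = 0
    · simp [hu]
    · have e : ∀ w : Fin 3 → k, (if u ≠ 0 ∧ w ≠ 0 then g (w ⬝ᵥ u) else 0) = g (w ⬝ᵥ u) - if w = 0 then g 0 else 0 := by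
        intro w
        by_cases hw : w = 0
        · simp [hw]
        · simp [hu, hw]
      simp_rw [e]
      rw [Finset.sum_sub_distrib, sum_dot u hu g, Finset.sum_ite_eq']
      simp [hu]
  simp_rw [h]
  rw [← Finset.sum_mul, Finset.sum_sub_distrib]
  congr 1
  simp [card_w]

variable {K : Type*} [Field K] [Algebra k K] [IsAlgClosed K]

theorem tau_alg (x : k) : tau (algebraMap k K x) = tau x := by
  have : orderOf (algebraMap k K x) = orderOf x := orderOf_injective (algebraMap k K).toMonoidHom (algebraMap k K).injective x
  unfold tau; rw [this]

theorem card_cast0 : ((Fintype.card k : ℕ) : K) = 0 := by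
  rw [castK (k := k)]; exact FiniteField.cast_card_eq_zero k

theorem card_pred (k : Type*) [Field k] [Fintype k] : ∃ p, Fintype.card k = p + 1 ∧ p ≠ 0 := 
  ⟨Fintype.card k - 1, by have := Fintype.one_lt_card (α := k); omega, by have := Fintype.one_lt_card (α := k); omega⟩

theorem cast_pred (p : ℕ) (hp : Fintype.card k = p + 1) : (p : K) = -1 := by
  have h := card_cast0 (k := k) (K := K)
  rw [hp] at h; push_cast at h
  linear_combination h

theorem mem_U_pred [DecidableEq K] (p : ℕ) (hp : Fintype.card k = p + 1) (hp0 : p ≠ 0) (x : K) : x ∈ U K p ↔ x ≠ 0 ∧ x ^ Fintype.card k = x := by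
  rw [mem_U hp0, hp]
  constructor
  · intro h
    refine ⟨?_, by rw [pow_succ, h, one_mul]⟩
    rintro rfl; rw [zero_pow hp0] at h; exact zero_ne_one h
  · rintro ⟨h0, h⟩
    rw [pow_succ] at h
    exact mul_right_cancel₀ h0 (by rw [h, one_mul])

theorem sum_k (K : Type*) [Field K] [Algebra k K] [IsAlgClosed K] (p : ℕ) (hp : Fintype.card k = p + 1) (hp0 : p ≠ 0) (F : ℕ → ℚ) :
    ∑ b : k, (if b = 0 ∨ b = 1 then 0 else F (tau b)) = SS p F := by
  classical
  have hpK : (p : K) ≠ 0 := by rw [cast_pred (k := k) p hp]; exact neg_ne_zero.2 one_ne_zero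
  rw [← sum_U (K := K) p hpK F]
  rw [← Finset.sum_filter_add_sum_filter_not univ (fun b : k => b = 0 ∨ b = 1)]
  rw [Finset.sum_congr rfl (s₁ := univ.filter (fun b : k => b = 0 ∨ b = 1)) (g := fun _ => (0:ℚ)) (fun x hx => if_pos (mem_filter.1 hx).2), Finset.sum_const_zero, zero_add]
  refine Finset.sum_bij (fun b _ => algebraMap k K b) ?_ ?_ ?_ ?_
  · intro b hb
    simp only [mem_filter, mem_univ, true_and, not_or] at hb
    rw [mem_erase, mem_U_pred p hp hp0]
    refine ⟨by simpa using hb.2, by simpa using hb.1, ?_⟩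
    rw [← map_pow, FiniteField.pow_card]
  · intro a _ b _ h; exact (algebraMap k K).injective h
  · intro x hx
    rw [mem_erase, mem_U_pred p hp hp0] at hx
    obtain ⟨b, rfl⟩ := fix_alg (k := k) x hx.2.2
    refine ⟨b, ?_, rfl⟩
    simp only [mem_filter, mem_univ, true_and, not_or]
    exact ⟨by simpa using hx.2.1, by simpa using hx.1⟩
  · intro b hb
    rw [if_neg (mem_filter.1 hb).2, tau_alg]

/-- the function to be summed -/
noncomputable def NN (k K : Type*) [Field k] [Fintype k] [DecidableEq k] [Field K] [Algebra k K] [IsAlgClosed K] (M : Matrix (Fin 3) (Fin 3) k) : ℚ :=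
  if h : M.det ≠ 0 then (NS k K (Matrix.GeneralLinearGroup.mkOfDetNeZero M h) : ℚ) else 0

theorem NN_of (M : Matrix (Fin 3) (Fin 3) k) (v : ℚ) (h : M.det ≠ 0) (hv : ∀ g : Matrix.GeneralLinearGroup (Fin 3) k, g.val = M → (NS k K g : ℚ) = v) :
    NN k K M = v := by
  unfold NN; rw [dif_pos h]; exact hv _ rfl

theorem NN_zero (M : Matrix (Fin 3) (Fin 3) k) (h : M.det = 0) : NN k K M = 0 := by
  unfold NN; rw [dif_neg (by simpa using h)]

theorem NN_val (g : Matrix.GeneralLinearGroup (Fin 3) k) : NN k K g.val = NS k K g := by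
  apply NN_of
  · exact det_ne g
  · intro g' h; rw [Units.ext h]

theorem NN_conj (h3 : 3 ≤ Fintype.card k) (B : Matrix.GeneralLinearGroup (Fin 3) k) (C : Matrix (Fin 3) (Fin 3) k) :
    NN k K (B⁻¹.val * C * B.val) = NN k K C := by
  by_cases h : C.det = 0
  · rw [NN_zero C h, NN_zero]; simp [h]
  · have e : C = (Matrix.GeneralLinearGroup.mkOfDetNeZero C h).val := rfl
    rw [e, NN_val, ← Units.val_mul, ← Units.val_mul, NN_val]
    have := NS_conj k K h3 B⁻¹ (Matrix.GeneralLinearGroup.mkOfDetNeZero C h)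
    rw [inv_inv] at this
    rw [this]

theorem sum_NN : ∑ g : Matrix.GeneralLinearGroup (Fin 3) k, (NS k K g : ℚ) = ∑ M : Matrix (Fin 3) (Fin 3) k, NN k K M := by
  rw [← Finset.sum_filter_add_sum_filter_not univ (fun M : Matrix (Fin 3) (Fin 3) k => M.det ≠ 0)]
  rw [Finset.sum_congr rfl (s₁ := univ.filter (fun M : Matrix (Fin 3) (Fin 3) k => ¬ (M.det ≠ 0))) (g := fun _ => (0:ℚ)) 
    (fun x hx => NN_zero x (by simpa using (mem_filter.1 hx).2)), Finset.sum_const_zero, add_zero]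
  refine Finset.sum_bij (fun g _ => g.val) ?_ ?_ ?_ ?_
  · intro g _; rw [mem_filter]; exact ⟨mem_univ _, det_ne g⟩
  · intro a _ b _ h; exact Units.ext h
  · intro M hM
    exact ⟨Matrix.GeneralLinearGroup.mkOfDetNeZero M (mem_filter.1 hM).2, mem_univ _, rfl⟩
  · intro g _; rw [NN_val]

/-- the contribution of scalar matrices -/
theorem part1 (h3 : 3 ≤ Fintype.card k) : ∑ a : k, NN k K (a • 1) = ((Fintype.card k : ℚ) - 1) * f1 (Fintype.card k) := by
  have : ∀ a : k, NN k K (a • 1) = f1 (Fintype.card k) - if a = 0 then f1 (Fintype.card k) else 0 := by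
    intro a
    by_cases ha : a = 0
    · rw [NN_zero _ (by simp [ha])]; simp [ha]
    · simp only [ha, if_false, sub_zero]
      exact NN_of _ _ (by simp [ha]) (fun g hg => NS_scal h3 g a hg)
  simp_rw [this]
  rw [Finset.sum_sub_distrib, Finset.sum_ite_eq']
  simp; ring

theorem part2 (h3 : 3 ≤ Fintype.card k) (hodd : Odd (Fintype.card k)) (p : ℕ) (hp : Fintype.card k = p + 1) (hp0 : p ≠ 0) :
    ∑ a : k, ∑ u : Fin 3 → k, ∑ w : Fin 3 → k, (if u ≠ 0 ∧ w ≠ 0 then NN k K (r1 a u w) else 0) =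
    ((Fintype.card k : ℚ) - 1) * (((Fintype.card k : ℚ)^3 - 1) * (((Fintype.card k : ℚ)^2 - 1) * f2 (Fintype.card k) (rho k)
      + (Fintype.card k : ℚ)^2 * SS p (f4 (Fintype.card k)))) := by
  let g : k → k → ℚ := fun a t => if a = 0 ∨ a + t = 0 then 0 else if t = 0 then f2 (Fintype.card k) (rho k) else f4 (Fintype.card k) (tau ((a + t)/a))
  have e : ∀ a : k, ∑ u : Fin 3 → k, ∑ w : Fin 3 → k, (if u ≠ 0 ∧ w ≠ 0 then NN k K (r1 a u w) else 0) =
      ((Fintype.card k : ℚ)^3 - 1) * ((Fintype.card k : ℚ)^2 * ∑ t, g a t - g a 0) := by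
    intro a
    rw [← sum_uw]
    apply Finset.sum_congr rfl; intro u _
    apply Finset.sum_congr rfl; intro w _
    by_cases h : u ≠ 0 ∧ w ≠ 0
    · rw [if_pos h, if_pos h]
      simp only [g]
      by_cases h1 : a = 0 ∨ a + w ⬝ᵥ u = 0
      · rw [if_pos h1, NN_zero]
        rw [r1_det]; rcases h1 with h1 | h1 <;> rw [h1] <;> simp
      · rw [if_neg h1]
        rw [not_or] at h1
        have hd : (r1 a u w).det ≠ 0 := by rw [r1_det]; exact mul_ne_zero (mul_ne_zero h1.1 h1.1) h1.2
        split_ifs with h2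
        · exact NN_of _ _ hd (fun g hg => NS_r1_zero h3 hodd g a u w hg h1.1 h.1 h.2 h2)
        · exact NN_of _ _ hd (fun g hg => NS_r1_ne h3 g a u w hg h1.1 h2)
    · rw [if_neg h, if_neg h]
  have e2 : ∀ a : k, ((Fintype.card k : ℚ)^3 - 1) * ((Fintype.card k : ℚ)^2 * ∑ t, g a t - g a 0) = 
      (1 - if a = 0 then (1 : ℚ) else 0) * (((Fintype.card k : ℚ)^3 - 1) * (((Fintype.card k : ℚ)^2 - 1) * f2 (Fintype.card k) (rho k)
      + (Fintype.card k : ℚ)^2 * SS p (f4 (Fintype.card k)))) := by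
    intro a
    by_cases ha : a = 0
    · simp [g, ha]
    · have : ∑ t, g a t = f2 (Fintype.card k) (rho k) + SS p (f4 (Fintype.card k)) := by
        rw [← sum_k K p hp hp0]
        have : ∀ t, g a t = (if t = 0 then f2 (Fintype.card k) (rho k) else 0) + 
            (fun b : k => if b = 0 ∨ b = 1 then 0 else f4 (Fintype.card k) (tau b)) ((a+t)/a) := by
          intro t
          simp only [g]
          have h0 : (a + t)/a = 0 ↔ a + t = 0 := by rw [div_eq_zero_iff]; tauto
          have h1 : (a + t)/a = 1 ↔ t = 0 := by rw [div_eq_one_iff_eq ha]; simp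
          simp only [h0, h1, ha, false_or]
          by_cases ht : t = 0
          · subst ht; simp [ha]
          · simp [ht]
        simp_rw [this]
        rw [Finset.sum_add_distrib, Finset.sum_ite_eq', if_pos (mem_univ _)]
        congr 1
        refine Fintype.sum_bijective (fun t => (a+t)/a) ?_ _ _ (fun t => rfl)
        constructor
        · intro x y hxy; simpa [div_left_inj' ha] using hxy
        · intro y; exact ⟨a * y - a, by field_simp; ring⟩
      have h0 : g a 0 = f2 (Fintype.card k) (rho k) := by simp [g, ha]
      rw [this, h0, if_neg ha]; ring
  simp_rw [e, e2]
  rw [← Finset.sum_mul, Finset.sum_sub_distrib, Finset.sum_ite_eq']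
  simp

end
end T7

namespace T7
open Finset
set_option linter.unusedSectionVars false
set_option linter.unusedSimpArgs false
set_option linter.unusedVariables false

section
variable {k : Type*} [Field k] [Fintype k] [DecidableEq k]
variable {K : Type*} [Field K] [Algebra k K] [IsAlgClosed K]

/-- psi plus chi -/
def pc (q : ℚ) (i j : ℕ) : ℚ := psi q i + chi q i j

theorem mem_F2 [DecidableEq K] (p : ℕ) (hp : Fintype.card k = p + 1) (hp0 : p ≠ 0) (x : K) :
    x ∈ U K (p * (p + 2)) \ U K p ↔ x ^ Fintype.card k ≠ x ∧ x ^ (Fintype.card k ^ 2) = x := by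
  rw [mem_sdiff, mem_U_pred p hp hp0, mem_U (mul_ne_zero hp0 (by omega))]
  have e : Fintype.card k ^ 2 = p * (p+2) + 1 := by rw [hp]; ring
  rw [e, pow_succ x]
  have hn : p * (p+2) ≠ 0 := mul_ne_zero hp0 (by omega)
  by_cases h : x = 0
  · subst h; simp [hn, hp0]
  · have : x ^ (p * (p+2)) * x = x ↔ x ^ (p * (p+2)) = 1 := by
      rw [mul_eq_right₀ h]
    rw [this]; tauto

theorem mem_F3 [DecidableEq K] (p : ℕ) (hp : Fintype.card k = p + 1) (hp0 : p ≠ 0) (x : K) :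
    x ∈ U K (p * (p^2 + 3*p + 3)) \ U K p ↔ x ^ Fintype.card k ≠ x ∧ x ^ (Fintype.card k ^ 3) = x := by
  have hn : p * (p^2 + 3*p + 3) ≠ 0 := mul_ne_zero hp0 (by omega)
  rw [mem_sdiff, mem_U_pred p hp hp0, mem_U hn]
  have e : Fintype.card k ^ 3 = p * (p^2 + 3*p + 3) + 1 := by rw [hp]; ring
  rw [e, pow_succ x]
  by_cases h : x = 0
  · subst h; simp [hn, hp0]
  · have : x ^ (p * (p^2 + 3*p + 3)) * x = x ↔ x ^ (p * (p^2 + 3*p + 3)) = 1 := by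
      rw [mul_eq_right₀ h]
    rw [this]; tauto

theorem cm_det_ne (c : Fin 3 → k) (x y z : K) (h : isE c x y z) (hx : x ≠ 0) (hy : y ≠ 0) (hz : z ≠ 0) : (cm c).det ≠ 0 := by
  rw [cm_det, ← map_ne_zero (algebraMap k K), h.1]
  exact mul_ne_zero (mul_ne_zero hx hy) hz

theorem part3 (h3 : 3 ≤ Fintype.card k) (hodd : Odd (Fintype.card k)) (p : ℕ) (hp : Fintype.card k = p + 1) (hp0 : p ≠ 0) (q : ℚ) (hq : (Fintype.card k : ℚ) = q) :
    ∑ c, NN k K (cm c) / cyc (cm c) = 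
      (3 * (p * (SS p (fun i => SS p (fun j => pc q i j)) - SS p (fun i => pc q i i)))) / (q - 1)^3 / 6
      + (p * (p * SS (p+2) (f7a q) + (SS (p*(p+2)) (f7b q) - SS p (f7b q)))) / ((q - 1) * (q^2 - 1)) / 2
      + (p * SS (p^2+3*p+3) (f8 q)) / (q^3 - 1) / 3
      + (p * SS p (f5 q (rho k))) / (q * (q-1)^2)
      + (p * f3 q (rho k)) / (q^2 * (q - 1)) := by
  classical
  have hpK1 := cast_pred (k := k) (K := K) p hp
  have hpK : (p : K) ≠ 0 := by rw [hpK1]; exact neg_ne_zero.2 one_ne_zero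
  have hp2K : ((p + 2 : ℕ) : K) ≠ 0 := by push_cast; rw [hpK1]; norm_num
  have hp3K : ((p^2 + 3*p + 3 : ℕ) : K) ≠ 0 := by push_cast; rw [hpK1]; norm_num
  rw [sum_c (K := K) (U K p) (U K (p * (p + 2)) \ U K p) (U K (p * (p^2 + 3*p + 3)) \ U K p) (mem_U_pred p hp hp0) (mem_F2 p hp hp0) (mem_F3 p hp hp0)
    (fun c => NN k K (cm c) / cyc (cm c)) 
    (fun c hc => by rw [NN_zero _ (by rw [cm_det, hc]), zero_div])
    (fun s => (pc q (tau (s.1 / s.2.1)) (tau (s.2.1 / s.2.2)) + pc q (tau (s.2.1 / s.2.2)) (tau (s.2.2 / s.1)) + pc q (tau (s.2.2 / s.1)) (tau (s.1 / s.2.1))) / (q-1)^3)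
    (fun s => (f7a q (tau (s.1 ^ p)) + f7b q (tau (s.1 / s.2))) / ((q - 1) * (q^2 - 1)))
    (fun s => f8 q (tau (s ^ p)) / (q^3 - 1))
    (fun s => f5 q (rho k) (tau (s.2 / s.1)) / (q * (q-1)^2))
    (fun s => f3 q (rho k) / (q^2 * (q - 1)))]
  · rw [← Finset.sum_div, ← Finset.sum_div, ← Finset.sum_div, ← Finset.sum_div, ← Finset.sum_div]
    rw [sum_triples' p hpK, sum_pairs p hpK, sum_pow_tau p (p^2+3*p+3) hpK hp3K, Finset.sum_const, card_U p hpK, nsmul_eq_mul]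
    have eB : ∑ s ∈ (U K (p * (p + 2)) \ U K p) ×ˢ U K p, (f7a q (tau (s.1 ^ p)) + f7b q (tau (s.1 / s.2))) = 
      p * (p * SS (p+2) (f7a q) + (SS (p*(p+2)) (f7b q) - SS p (f7b q))) := by
      rw [Finset.sum_product_right]
      rw [Finset.sum_congr rfl (g := fun _ => p * SS (p+2) (f7a q) + (SS (p*(p+2)) (f7b q) - SS p (f7b q)))]
      · rw [Finset.sum_const, card_U p hpK, nsmul_eq_mul]
      intro a ha
      simp only
      rw [Finset.sum_add_distrib, sum_pow_tau p (p+2) hpK hp2K, ← sum_diff (K := K) p (p+2) hpK hp2K]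
      congr 1
      refine sum_scale p hp0 _ ?_ (fun x => f7b q (tau x)) a ha
      intro x hx b hb
      rw [mem_sdiff, mem_U hp0, mem_U (mul_ne_zero hp0 (by omega))] at *
      rw [mul_pow, mul_pow, hb, pow_mul b, hb, one_pow, mul_one, mul_one]
      exact hx
    rw [eB]
  · intro c x y z hE hx hy hz hxq hyq hzq hxy hyz hxz
    simp only
    rw [cyc_A c x y z hE hxq hyq hzq hxy hyz hxz, hq]
    congr 1
    apply NN_of _ _ (cm_det_ne c x y z hE hx hy hz)
    intro g hg
    rw [NS_split h3 hodd c g hg x y z hE hxy hyz hxz hx hy hz hxq hyq hzq, hq]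
    unfold pc; ring
  · intro c x a hE ha haq hx hx2
    simp only
    have hx0 : x ≠ 0 := by rintro rfl; exact hx (zero_pow Fintype.card_ne_zero)
    rw [cyc_B c x a hE hx hx2 haq, hq]
    congr 1
    apply NN_of _ _ (cm_det_ne c _ _ _ hE hx0 (pow_ne_zero _ hx0) ha)
    intro g hg
    have e1 : a * (x / a) = x := by field_simp
    have e2 : a * (x / a) ^ Fintype.card k = x ^ Fintype.card k := by rw [div_pow, haq]; field_simp
    have e3 : (x / a) ^ (Fintype.card k ^ 2) = x / a := by rw [div_pow, hx2, fix_pow haq]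
    rw [NS_lq h3 hodd c g hg a (x / a) (by rw [e1, e2]; exact hE) ha haq e3 
      (by rw [div_pow, haq]; intro h; exact hx (by rwa [div_left_inj' ha] at h)), hq]
    have : a ^ p = 1 := (mem_U hp0 a).1 ((mem_U_pred p hp hp0 a).2 ⟨ha, haq⟩)
    have e4 : Fintype.card k - 1 = p := by omega
    rw [e4, div_pow, this, div_one]
  · intro c x hE hx hx3
    have hx0 : x ≠ 0 := by rintro rfl; exact hx (zero_pow Fintype.card_ne_zero)
    rw [cyc_C c x hE hx hx3, hq]
    congr 1
    apply NN_of _ _ (cm_det_ne c _ _ _ hE hx0 (pow_ne_zero _ hx0) (pow_ne_zero _ hx0))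
    intro g hg
    have e4 : Fintype.card k - 1 = p := by omega
    rw [NS_irr h3 c g hg x hE hx3 hx, hq, e4]
  · intro c x y hE hx hy hxq hyq hxy
    simp only
    rw [cyc_D c x y hE hxq hyq hxy, hq]
    congr 1
    apply NN_of _ _ (cm_det_ne c _ _ _ hE hx hx hy)
    intro g hg
    rw [NS_dbl h3 hodd c g hg x y hE hxy hx hxq hyq, hq]
  · intro c x hE hx hxq
    rw [cyc_E c x hE hxq, hq]
    congr 1
    apply NN_of _ _ (cm_det_ne c _ _ _ hE hx hx hx)
    intro g hg
    rw [NS_tri h3 hodd c g hg x hE hx hxq, hq]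

theorem total (h3 : 3 ≤ Fintype.card k) (hodd : Odd (Fintype.card k)) (p : ℕ) (hp : Fintype.card k = p + 1) (hp0 : p ≠ 0) (q : ℚ) (hq : (Fintype.card k : ℚ) = q) :
    (t2seven k : ℚ) = 
      (q - 1) * f1 q / ((q^3-1)*(q^3-q)*(q^3-q^2)) + f2 q (rho k) / (q^3*(q-1)) + SS p (f4 q) / ((q^2-1)*(q^2-q))
      + (SS p (fun i => SS p (fun j => pc q i j)) - SS p (fun i => pc q i i)) / (2 * (q - 1)^2)
      + ((q-1) * SS (p+2) (f7a q) + (SS (p*(p+2)) (f7b q) - SS p (f7b q))) / (2 * (q^2 - 1)) 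
      + (q-1) * SS (p^2+3*p+3) (f8 q) / (3 * (q^3 - 1))
      + SS p (f5 q (rho k)) / (q * (q-1))
      + f3 q (rho k) / q^2 := by
  have hGL : (Fintype.card (Matrix.GeneralLinearGroup (Fin 3) k) : ℚ) = (q^3-1)*(q^3-q)*(q^3-q^2) := by
    have := Matrix.card_GL_field (𝔽 := k) 3
    rw [Nat.card_eq_fintype_card] at this
    rw [this, Fin.prod_univ_three]
    have h1 : 1 ≤ Fintype.card k := by omega
    have a1 : Fintype.card k ^ 1 ≤ Fintype.card k ^ 3 := Nat.pow_le_pow_right h1 (by norm_num)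
    have a2 : Fintype.card k ^ 2 ≤ Fintype.card k ^ 3 := Nat.pow_le_pow_right h1 (by norm_num)
    have a0 : Fintype.card k ^ 0 ≤ Fintype.card k ^ 3 := Nat.pow_le_pow_right h1 (by norm_num)
    rw [← hq]
    simp only [Fin.val_zero, Fin.val_one, Fin.val_two]
    rw [Nat.cast_mul, Nat.cast_mul, Nat.cast_sub a0, Nat.cast_sub a1, Nat.cast_sub a2]
    push_cast; ring
  have hb := burnside (k := k)
  have hb' : (t2seven k : ℚ) * Fintype.card (Matrix.GeneralLinearGroup (Fin 3) k) = ∑ g : Matrix.GeneralLinearGroup (Fin 3) k, (NS k (AlgebraicClosure k) g : ℚ) := by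
    exact_mod_cast hb
  rw [sum_NN, sum_all (by omega) _ (NN_conj h3), part1 h3, part2 h3 hodd p hp hp0, part3 h3 hodd p hp hp0 q hq, hGL, hq] at hb'
  have hpq : (p : ℚ) = q - 1 := by rw [← hq, hp]; push_cast; ring
  rw [hpq] at hb'
  have hq3 : (3:ℚ) ≤ q := by rw [← hq]; exact_mod_cast h3
  have n0 : q ≠ 0 := by positivity
  have n1 : q - 1 ≠ 0 := by intro h; linarith
  have n2 : q^2 - 1 ≠ 0 := by intro h; nlinarith
  have n3 : q^3 - 1 ≠ 0 := by intro h; nlinarith [pow_pos (by linarith : (0:ℚ) < q) 2]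
  have e1 : q^3 - q = q * (q^2-1) := by ring
  have e2 : q^3 - q^2 = q^2 * (q-1) := by ring
  have e3 : q^2 - q = q * (q-1) := by ring
  rw [e1, e2] at hb' ⊢
  rw [e3]
  have nG : (q^3-1)*(q * (q^2-1))*(q^2 * (q-1)) ≠ 0 := by positivity
  apply mul_right_cancel₀ nG
  rw [hb']
  generalize SS p (fun i => SS p (fun j => pc q i j)) = X1
  generalize SS p (fun i => pc q i i) = X2
  generalize SS (p+2) (f7a q) = X3
  generalize SS (p*(p+2)) (f7b q) = X4
  generalize SS p (f7b q) = X5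
  generalize SS p (f5 q (rho k)) = X6
  generalize SS p (f4 q) = X7
  generalize SS (p^2+3*p+3) (f8 q) = X8
  generalize f1 q = Y1
  generalize f2 q (rho k) = Y2
  generalize f3 q (rho k) = Y3
  generalize hA : q - 1 = A at *
  generalize hB : q^2 - 1 = B at *
  generalize hC : q^3 - 1 = C at *
  field_simp
  ring
end
end T7

namespace T7
open Finset
set_option linter.unusedSectionVars false
set_option linter.unusedSimpArgs false
set_option linter.unusedVariables false

theorem SS_eq (N : ℕ) (F : ℕ → ℚ) : SS N F = ((N : ℚ) - 1) * F 8 + (cc N 2 * (F 2 - F 8) + cc N 3 * (F 3 - F 8) + cc N 4 * (F 4 - F 8)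
    + cc N 5 * (F 5 - F 8) + cc N 6 * (F 6 - F 8) + cc N 7 * (F 7 - F 8)) := by
  unfold SS
  rw [show Icc 2 7 = ({2,3,4,5,6,7} : Finset ℕ) from by decide]
  simp
  ring

/-- indicator -/
def ind (P : Prop) [Decidable P] : ℚ := if P then 1 else 0

theorem ind_sq (P : Prop) [Decidable P] : ind P * ind P = ind P := by unfold ind; split_ifs <;> norm_num

theorem cc_eq (N i : ℕ) : cc N i = (Nat.totient i : ℚ) * ind (i ∣ N) := by
  unfold cc ind; split_ifs <;> simp

theorem T6_eq (N : ℕ) (q : ℚ) (hN : (N : ℚ) = q - 1) (A3 A4 A5 A7 : ℚ) (h3 : A3 * A3 = A3) (h4 : A4 * A4 = A4) (h5 : A5 * A5 = A5) (h7 : A7 * A7 = A7)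
    (c2 : cc N 2 = 1) (c3 : cc N 3 = 2 * A3) (c4 : cc N 4 = 2 * A4) (c5 : cc N 5 = 4 * A5) (c6 : cc N 6 = 2 * A3) (c7 : cc N 7 = 6 * A7) :
    SS N (fun i => SS N (fun j => pc q i j)) - SS N (fun i => pc q i i) = 
      (q-3)*(psi q 2 + 2*A3* psi q 3 + 2*A4* psi q 4 +4*A5* psi q 5+2*A3* psi q 6+6*A7* psi q 7) + 2*chi q 2 3*2*A3 + 2*chi q 2 5*4*A5
       + chi q 3 3*(4*A3-2*A3)+2*chi q 3 4*4*A3*A4 + chi q 4 4*(4*A4-2*A4)+chi q 5 5*(16-4)*A5+chi q 6 6*(4-2)*A3+chi q 7 7*(36-6)*A7 := by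
  have e : (7 : ℕ) ≠ 8 := by norm_num
  simp only [SS_eq, c2, c3, c4, c5, c6, c7, hN, pc, psi, chi, sel, if_true, if_false, OfNat.ofNat_eq_ofNat, Nat.reduceEqDiff]
  linear_combination (4*(q^4+q^3-5*q^2+3*q) + 4*(3*q^2-6*q+3)) * h3 + 4*(3*q^3-2*q^2-5*q+4) * h4 + 16*(q^2-2*q+1)*h5 + 36*((q^2-2*q+1)/3)*h7

/-- polynomial identity behind the final count -/
theorem final_alg (q : ℚ) (h3q : 3 ≤ q) (r p : ℕ) (hN : (p : ℚ) = q - 1) (A3 A4 A5 A7 B3 B5 B7 C3 C5 C7 D7 : ℚ)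
    (h3 : A3 * A3 = A3) (h4 : A4 * A4 = A4) (h5 : A5 * A5 = A5) (h7 : A7 * A7 = A7)
    (c2 : cc p 2 = 1) (c3 : cc p 3 = 2 * A3) (c4 : cc p 4 = 2 * A4) (c5 : cc p 5 = 4 * A5) (c6 : cc p 6 = 2 * A3) (c7 : cc p 7 = 6 * A7)
    (b2 : cc (p+2) 2 = 1) (b3 : cc (p+2) 3 = 2 * B3) (b4 : cc (p+2) 4 = 2 * (1 - A4)) (b5 : cc (p+2) 5 = 4 * B5) (b6 : cc (p+2) 6 = 2 * B3) (b7 : cc (p+2) 7 = 6 * B7)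
    (e2 : cc (p*(p+2)) 2 = 1) (e3 : cc (p*(p+2)) 3 = 2 * (A3 + B3)) (e4 : cc (p*(p+2)) 4 = 2) (e5 : cc (p*(p+2)) 5 = 4 * (A5 + B5)) (e6 : cc (p*(p+2)) 6 = 2 * (A3 + B3)) 
      (e7 : cc (p*(p+2)) 7 = 6 * (A7 + B7))
    (d7 : cc (p^2+3*p+3) 7 = 6 * D7) (hB3 : B3 = 1 - A3 - C3) 
    (hr : (r = 3 ∧ C3 = 1 ∧ A3 = 0 ∧ C5 = 0 ∧ C7 = 0) ∨ (r = 5 ∧ C3 = 0 ∧ C5 = 1 ∧ A5 = 0 ∧ B5 = 0 ∧ C7 = 0)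
     ∨ (r = 7 ∧ C3 = 0 ∧ C5 = 0 ∧ C7 = 1 ∧ A7 = 0 ∧ B7 = 0 ∧ D7 = 0) ∨ (r = 8 ∧ C3 = 0 ∧ C5 = 0 ∧ C7 = 0)) :
      (q - 1) * f1 q / ((q^3-1)*(q^3-q)*(q^3-q^2)) + f2 q r / (q^3*(q-1)) + SS p (f4 q) / ((q^2-1)*(q^2-q))
      + (SS p (fun i => SS p (fun j => pc q i j)) - SS p (fun i => pc q i i)) / (2 * (q - 1)^2)
      + ((q-1) * SS (p+2) (f7a q) + (SS (p*(p+2)) (f7b q) - SS p (f7b q))) / (2 * (q^2 - 1)) 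
      + (q-1) * SS (p^2+3*p+3) (f8 q) / (3 * (q^3 - 1))
      + SS p (f5 q r) / (q * (q-1))
      + f3 q r / q^2 = 
      q ^ 6 + q ^ 5 + 3 * q ^ 4 + 6 * q ^ 3 + 11 * q ^ 2 + 4 * q + A3 * (2 * (q ^ 2 + 6 * q + 9)) + B5 * 4 + A5 * 20 + A4 * (4 * q + 6)
       + A7 * 8 + B7 * 6 + A3 * A4 * 4 + D7 * 2 + C3 * (q^2 + 4 * q - 1) + C3 * A4 * 2 + C5 * 3 + C7 * 2 := by
  rw [T6_eq p q hN A3 A4 A5 A7 h3 h4 h5 h7 c2 c3 c4 c5 c6 c7]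
  have n0 : q ≠ 0 := by intro h; linarith
  have n1 : q - 1 ≠ 0 := by intro h; linarith
  have n2 : q + 1 ≠ 0 := by intro h; linarith
  have n3 : q^2 + q + 1 ≠ 0 := by intro h; nlinarith
  have s1 : q^2 - 1 = (q-1)*(q+1) := by ring
  have s2 : q^3 - 1 = (q-1)*(q^2+q+1) := by ring
  have s3 : q^3 - q = q*(q-1)*(q+1) := by ring
  have s4 : q^3 - q^2 = q^2*(q-1) := by ring
  have s5 : q^2 - q = q*(q-1) := by ring
  have F8 : SS (p^2+3*p+3) (f8 q) = 6 * D7 * (q^2+q+1) := by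
    simp only [SS_eq, d7, f8, sel, if_true, if_false, OfNat.ofNat_eq_ofNat, Nat.reduceEqDiff]; ring
  have F1 : f1 q = q^8 * (q^2+q+1) * ((q^2+1) * (q-1) * (q+1)) := by unfold f1; ring
  rw [F8, F1]
  simp only [SS_eq, c2, c3, c4, c5, c6, c7, b2, b3, b4, b5, b6, b7, e2, e3, e4, e5, e6, e7, hN, psi, chi, f4, f7a, f7b, sel, if_true, if_false, OfNat.ofNat_eq_ofNat, Nat.reduceEqDiff]
  rw [s1, s2, s3, s4, s5, hB3]
  rcases hr with ⟨rfl, rfl, rfl, rfl, rfl⟩ | ⟨rfl, rfl, rfl, rfl, rfl, rfl⟩ | ⟨rfl, rfl, rfl, rfl, rfl, rfl, rfl⟩ | ⟨rfl, rfl, rfl, rfl⟩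
  all_goals
    simp only [f2, f3, f5, sel, if_true, if_false, OfNat.ofNat_eq_ofNat, Nat.reduceEqDiff]
    field_simp
    ring
end T7

namespace T7
open Finset
set_option linter.unusedSectionVars false
set_option linter.unusedSimpArgs false
set_option linter.unusedVariables false

theorem ind_congr {P Q : Prop} [Decidable P] [Decidable Q] (h : P ↔ Q) : ind P = ind Q := by
  unfold ind; simp only [h]

theorem ind_mul_prime (l a b : ℕ) (hl : l.Prime) (h : ¬ (l ∣ a ∧ l ∣ b)) : ind (l ∣ a * b) = ind (l ∣ a) + ind (l ∣ b) := by
  unfold ind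
  simp only [hl.dvd_mul]
  by_cases h1 : l ∣ a <;> by_cases h2 : l ∣ b <;> simp_all

theorem ind_true {P : Prop} [Decidable P] (h : P) : ind P = 1 := if_pos h
theorem ind_false {P : Prop} [Decidable P] (h : ¬ P) : ind P = 0 := if_neg h

theorem final (k : Type*) [Field k] [Fintype k] (q : ℕ) (hq : Fintype.card k = q) (hodd : Odd q) :
    (t2seven k : ℚ) = (q:ℚ) ^ 6 + q ^ 5 + 3 * q ^ 4 + 6 * q ^ 3 + 11 * q ^ 2 + 4 * q + ind (3 ∣ q - 1) * (2 * (q ^ 2 + 6 * q + 9)) + ind (5 ∣ q + 1) * 4 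
      + ind (5 ∣ q - 1) * 20 + ind (4 ∣ q - 1) * (4 * q + 6)
       + ind (7 ∣ q - 1) * 8 + ind (7 ∣ q + 1) * 6 + ind (3 ∣ q - 1) * ind (4 ∣ q - 1) * 4 + ind (7 ∣ q^2+q+1) * 2 + ind (3 ∣ q) * (q^2 + 4 * q - 1)
       + ind (3 ∣ q) * ind (4 ∣ q - 1) * 2 + ind (5 ∣ q) * 3 + ind (7 ∣ q) * 2 := by
  classical
  obtain ⟨p, hp, hp0⟩ := card_pred k
  have hqp : q = p + 1 := by omega
  have h2 : p % 2 = 0 := by rw [hqp] at hodd; rw [Nat.odd_iff] at hodd; omega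
  have h3 : 3 ≤ Fintype.card k := by omega
  have e1 : q - 1 = p := by omega
  have e2 : q + 1 = p + 2 := by omega
  have e3 : q^2+q+1 = p^2+3*p+3 := by rw [hqp]; ring
  rw [total h3 (hq ▸ hodd) p hp hp0 (q : ℚ) (by rw [hq]), e1, e2, e3]
  have hex : (rho k = 3 ∧ ind (3 ∣ q) = 1 ∧ ind (3 ∣ p) = 0 ∧ ind (5 ∣ q) = 0 ∧ ind (7 ∣ q) = 0) ∨ 
    (rho k = 5 ∧ ind (3 ∣ q) = 0 ∧ ind (5 ∣ q) = 1 ∧ ind (5 ∣ p) = 0 ∧ ind (5 ∣ p+2) = 0 ∧ ind (7 ∣ q) = 0)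
     ∨ (rho k = 7 ∧ ind (3 ∣ q) = 0 ∧ ind (5 ∣ q) = 0 ∧ ind (7 ∣ q) = 1 ∧ ind (7 ∣ p) = 0 ∧ ind (7 ∣ p+2) = 0 ∧ ind (7 ∣ p^2+3*p+3) = 0) 
     ∨ (rho k = 8 ∧ ind (3 ∣ q) = 0 ∧ ind (5 ∣ q) = 0 ∧ ind (7 ∣ q) = 0) := by
    have hpr : ∀ r s : ℕ, r.Prime → s.Prime → r ≠ s → r ∣ q → ¬ s ∣ q := by
      intro r s hr hs hrs h1 h2
      have h1' := (prime_zero (k := k) r hr).2 (hq ▸ h1)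
      have h2' := (prime_zero (k := k) s hs).2 (hq ▸ h2)
      have hco := (Nat.coprime_primes hr hs).2 hrs
      obtain ⟨c, hc⟩ := CharP.exists k
      have d1 := (CharP.cast_eq_zero_iff k c r).1 h1'
      have d2 := (CharP.cast_eq_zero_iff k c s).1 h2'
      have := Nat.eq_one_of_dvd_coprimes hco d1 d2
      subst this
      exact absurd ((CharP.cast_eq_zero_iff k 1 1).2 dvd_rfl) (by rw [Nat.cast_one]; exact one_ne_zero)
    unfold rho
    rw [hq]
    by_cases d3 : 3 ∣ q
    · left
      exact ⟨by simp [d3], ind_true d3, ind_false (by omega), ind_false (hpr 3 5 (by norm_num) (by norm_num) (by norm_num) d3), 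
        ind_false (hpr 3 7 (by norm_num) (by norm_num) (by norm_num) d3)⟩
    by_cases d5 : 5 ∣ q
    · right; left
      exact ⟨by simp [d3, d5], ind_false d3, ind_true d5, ind_false (by omega), ind_false (by omega), 
        ind_false (hpr 5 7 (by norm_num) (by norm_num) (by norm_num) d5)⟩
    by_cases d7 : 7 ∣ q
    · right; right; left
      refine ⟨by simp [d3, d5, d7], ind_false d3, ind_false d5, ind_true d7, ind_false (by omega), ind_false (by omega), ?_⟩
      apply ind_false
      rw [← e3]
      intro h
      rw [pow_two, (Nat.dvd_add_right ((dvd_mul_of_dvd_left d7 q).add d7) : 7 ∣ q*q+q+1 ↔ 7 ∣ 1)] at h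
      omega
    · right; right; right
      exact ⟨by simp [d3, d5, d7], ind_false d3, ind_false d5, ind_false d7⟩
  have m2 : p * (p+2) % 4 = 0 := by
    obtain ⟨m, rfl⟩ : ∃ m, p = 2 * m := ⟨p/2, by omega⟩
    rw [show 2 * m * (2 * m + 2) = 4 * (m * (m+1)) by ring]; omega
  have t2 : (Nat.totient 2 : ℚ) = 1 := by simp
  have t3 : (Nat.totient 3 : ℚ) = 2 := by rw [Nat.totient_prime (by norm_num)]; norm_num
  have t4 : (Nat.totient 4 : ℚ) = 2 := by rw [show Nat.totient 4 = 2 by decide]; norm_num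
  have t5 : (Nat.totient 5 : ℚ) = 4 := by rw [Nat.totient_prime (by norm_num)]; norm_num
  have t6 : (Nat.totient 6 : ℚ) = 2 := by rw [show Nat.totient 6 = 2 by decide]; norm_num
  have t7 : (Nat.totient 7 : ℚ) = 6 := by rw [Nat.totient_prime (by norm_num)]; norm_num
  have a3 : ind (3 ∣ p * (p+2)) = ind (3 ∣ p) + ind (3 ∣ p+2) := ind_mul_prime 3 _ _ (by norm_num) (by omega)
  refine final_alg (q:ℚ) (by rw [← hq]; exact_mod_cast h3) (rho k) p (by rw [hqp]; push_cast; ring) (ind (3 ∣ p)) (ind (4 ∣ p)) (ind (5 ∣ p)) (ind (7 ∣ p)) 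
    (ind (3 ∣ p+2)) (ind (5 ∣ p+2)) (ind (7 ∣ p+2)) (ind (3 ∣ q)) (ind (5 ∣ q)) (ind (7 ∣ q)) (ind (7 ∣ p^2+3*p+3))
    (ind_sq _) (ind_sq _) (ind_sq _) (ind_sq _) ?_ ?_ ?_ ?_ ?_ ?_ ?_ ?_ ?_ ?_ ?_ ?_ ?_ ?_ ?_ ?_ ?_ ?_ ?_ ?_ hex
  all_goals try rw [cc_eq]
  · rw [t2, ind_true (by omega), mul_one]
  · rw [t3]
  · rw [t4]
  · rw [t5]
  · rw [t6, ind_congr (show 6 ∣ p ↔ 3 ∣ p by omega)]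
  · rw [t7]
  · rw [t2, ind_true (by omega), mul_one]
  · rw [t3]
  · rw [t4]
    congr 1
    unfold ind
    by_cases h : 4 ∣ p
    · rw [if_pos h, if_neg (by omega)]; norm_num
    · rw [if_neg h, if_pos (by omega)]; norm_num
  · rw [t5]
  · rw [t6, ind_congr (show 6 ∣ p+2 ↔ 3 ∣ p+2 by omega)]
  · rw [t7]
  · rw [t2, ind_true (by omega), mul_one]
  · rw [t3, a3]
  · rw [t4, ind_true (by omega), mul_one]
  · rw [t5, ind_mul_prime 5 _ _ (by norm_num) (by omega)]
  · rw [t6, ind_congr (show 6 ∣ p*(p+2) ↔ 3 ∣ p*(p+2) by omega), a3]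
  · rw [t7, ind_mul_prime 7 _ _ (by norm_num) (by omega)]
  · rw [t7]
  · unfold ind
    have : p % 3 = 0 ∨ p % 3 = 1 ∨ p % 3 = 2 := by omega
    rcases this with h | h | h
    · rw [if_neg (by omega), if_pos (by omega), if_neg (by omega)]; norm_num
    · rw [if_pos (by omega), if_neg (by omega), if_neg (by omega)]; norm_num
    · rw [if_neg (by omega), if_neg (by omega), if_pos (by omega)]; norm_num

end T7

/-- For `q` odd, the number `t₂(7)` of `PGL₃(𝔽_q)`-orbits of `k`-rational
`7`-sets of `ℙ²(k̄)` is given by the displayed polynomial in `q` with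
divisibility indicators. -/
theorem stmt19 (k : Type*) [Field k] [Fintype k] (q : ℕ)
    (hq : Fintype.card k = q) (hodd : Odd q) :
    t2seven k =
      q ^ 6 + q ^ 5 + 3 * q ^ 4 + 6 * q ^ 3 + 11 * q ^ 2 + 4 * q
        + (if 3 ∣ q - 1 then 2 * (q ^ 2 + 6 * q + 9) else 0)
        + (if 5 ∣ q + 1 then 4 else 0)
        + (if 5 ∣ q - 1 then 20 else 0)
        + (if 4 ∣ q - 1 then 4 * q + 6 else 0)
        + (if 7 ∣ q - 1 then 8 else 0)
        + (if 7 ∣ q + 1 then 6 else 0)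
        + (if 12 ∣ q - 1 then 4 else 0)
        + (if 7 ∣ q ^ 2 + q + 1 then 2 else 0)
        + (if 3 ∣ q then q ^ 2 + 4 * q - 1 else 0)
        + (if 3 ∣ q ∧ 4 ∣ q - 1 then 2 else 0)
        + (if 5 ∣ q then 3 else 0)
        + (if 7 ∣ q then 2 else 0) := by
  have h := T7.final k q hq hodd
  have hq1 : 1 ≤ q := by rw [← hq]; exact Fintype.card_pos
  have hle : 1 ≤ q^2 + 4 * q := by nlinarith
  have e12 : (12 ∣ q - 1) ↔ (3 ∣ q - 1 ∧ 4 ∣ q - 1) := by omega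
  have hm : ∀ (P : Prop) [Decidable P] (c : ℕ) , (((if P then c else 0 : ℕ)) : ℚ) = T7.ind P * (c : ℚ) := by
    intro P _ c; unfold T7.ind; split_ifs <;> simp
  have hand : ∀ (P Q : Prop) [Decidable P] [Decidable Q], T7.ind (P ∧ Q) = T7.ind P * T7.ind Q := by
    intro P Q _ _; unfold T7.ind; by_cases h1 : P <;> by_cases h2 : Q <;> simp [h1, h2]
  have : (t2seven k : ℚ) = ((q ^ 6 + q ^ 5 + 3 * q ^ 4 + 6 * q ^ 3 + 11 * q ^ 2 + 4 * q
        + (if 3 ∣ q - 1 then 2 * (q ^ 2 + 6 * q + 9) else 0)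
        + (if 5 ∣ q + 1 then 4 else 0)
        + (if 5 ∣ q - 1 then 20 else 0)
        + (if 4 ∣ q - 1 then 4 * q + 6 else 0)
        + (if 7 ∣ q - 1 then 8 else 0)
        + (if 7 ∣ q + 1 then 6 else 0)
        + (if 12 ∣ q - 1 then 4 else 0)
        + (if 7 ∣ q ^ 2 + q + 1 then 2 else 0)
        + (if 3 ∣ q then q ^ 2 + 4 * q - 1 else 0)
        + (if 3 ∣ q ∧ 4 ∣ q - 1 then 2 else 0)
        + (if 5 ∣ q then 3 else 0)
        + (if 7 ∣ q then 2 else 0) : ℕ) : ℚ) := by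
    rw [h]
    simp only [Nat.cast_add, hm, Nat.cast_sub hle, hand, T7.ind_congr e12]
    push_cast
    ring
  exact_mod_cast this
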